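/- Let ε > 0 and γ ∈ (0,1) be arbitrary. There exists a constant C > 0 such that for all α ∈ (0,1) there is Δ₀ ∈ ℕ with the following property. Let Δ ≥ Δ₀, n ∈ ℕ, and let k and q ≥ s satisfy 1 ≤ k ≤ Δ^{2αγ}, q = 4(1+γ+ε)Δ / log(Δ^α/√k), and s ≥ Δ^α + C√(log n). Let ℋ = (L,H) be a q-fold correspondence cover of an n-vertex k-locally-sparse graph G = (V,E) of maximum degree Δ. Suppose for each vertex v ∈ V, a set S(v) ⊆ L(v) of size s is sampled independently and uniformly at random. Then with probability at least 1 − 1/n, G has a proper ℋ-coloring φ with φ(v) ∈ S(v) for all v ∈ V. -/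

import Mathlib

open Finset

attribute [local instance] Classical.propDecidable

noncomputable section

/-- The number of ordered pairs of adjacent vertices inside `S`; this is exactly twice the
number of edges of the subgraph induced on `S`. -/
def pairsWithin {V : Type} [Fintype V] (G : SimpleGraph V) (S : Finset V) : ℕ :=
  ((S ×ˢ S).filter fun p => G.Adj p.1 p.2).card

/-- `G` is `k`-locally-sparse: each neighborhood induces at most `k` edges. -/
def LocallySparse {V : Type} [Fintype V] (G : SimpleGraph V) (k : ℝ) : Prop :=
  ∀ v : V, (pairsWithin G (G.neighborFinset v) : ℝ) ≤ 2 * k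

/-- `(L, H)` is a correspondence cover of `G`. -/
structure IsCorrespondenceCover {V C : Type} (G : SimpleGraph V) (H : SimpleGraph C)
    (L : V → Finset C) : Prop where
  partition : ∀ c : C, ∃! v : V, c ∈ L v
  indep : ∀ v : V, ∀ c ∈ L v, ∀ c' ∈ L v, ¬H.Adj c c'
  matching : ∀ u v : V, ∀ c ∈ L u, ∀ c₁ ∈ L v, ∀ c₂ ∈ L v,
    H.Adj c c₁ → H.Adj c c₂ → c₁ = c₂
  not_adj : ∀ u v : V, ¬G.Adj u v → ∀ c ∈ L u, ∀ c' ∈ L v, ¬H.Adj c c'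

set_option linter.unusedSectionVars false
set_option linter.unusedVariables false

section ProductSpace

/-- Expectation on a finite product space. -/
def psEx {ι β : Type} [Fintype ι] [Fintype β] (μ : ι → β → ℝ) (f : (ι → β) → ℝ) : ℝ :=
  ∑ ω : ι → β, (∏ i, μ i (ω i)) * f ω

/-- A family of probability vectors. -/
structure PsProb {ι β : Type} [Fintype ι] [Fintype β] (μ : ι → β → ℝ) : Prop where
  nonneg : ∀ i b, 0 ≤ μ i b
  sum_one : ∀ i, ∑ b, μ i b = 1

/-- Probability of an event. -/
def psPr {ι β : Type} [Fintype ι] [Fintype β] (μ : ι → β → ℝ) (A : (ι → β) → Prop) : ℝ :=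
  psEx μ (fun ω => if A ω then 1 else 0)

variable {ι β : Type} [Fintype ι] [Fintype β] {μ : ι → β → ℝ}

lemma psEx_add (f g : (ι → β) → ℝ) : psEx μ (fun ω => f ω + g ω) = psEx μ f + psEx μ g := by
  simp [psEx, mul_add, Finset.sum_add_distrib]

lemma psEx_sub (f g : (ι → β) → ℝ) : psEx μ (fun ω => f ω - g ω) = psEx μ f - psEx μ g := by
  simp [psEx, mul_sub, Finset.sum_sub_distrib]

lemma psEx_mul_left (a : ℝ) (f : (ι → β) → ℝ) : psEx μ (fun ω => a * f ω) = a * psEx μ f := by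
  simp only [psEx, Finset.mul_sum]
  exact Finset.sum_congr rfl fun _ _ => by ring

lemma psEx_mul_right (a : ℝ) (f : (ι → β) → ℝ) : psEx μ (fun ω => f ω * a) = psEx μ f * a := by
  rw [mul_comm, ← psEx_mul_left]; simp only [mul_comm]

lemma psEx_sum {J : Type} (s : Finset J) (f : J → (ι → β) → ℝ) :
    psEx μ (fun ω => ∑ j ∈ s, f j ω) = ∑ j ∈ s, psEx μ (f j) := by
  simp only [psEx, Finset.mul_sum]
  rw [Finset.sum_comm]

lemma psEx_prod (hμ : PsProb μ) (X : Finset ι) (g : ι → β → ℝ) :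
    psEx μ (fun ω => ∏ i ∈ X, g i (ω i)) = ∏ i ∈ X, ∑ b, μ i b * g i b := by
  have h1 : ∀ ω : ι → β, (∏ i, μ i (ω i)) * ∏ i ∈ X, g i (ω i)
      = ∏ i, (μ i (ω i) * if i ∈ X then g i (ω i) else 1) := by
    intro ω
    rw [Finset.prod_mul_distrib]
    congr 1
    rw [Finset.prod_ite_mem, Finset.univ_inter]
  simp only [psEx, h1]
  have h2 := Finset.prod_univ_sum (fun _ : ι => (Finset.univ : Finset β))
    (fun i b => μ i b * if i ∈ X then g i b else 1)
  rw [Fintype.piFinset_univ] at h2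
  rw [← h2]
  rw [← Finset.prod_subset (Finset.subset_univ X)]
  · exact Finset.prod_congr rfl fun i hi => by simp [hi]
  · intro i _ hi
    simp [hi, hμ.sum_one]

lemma psEx_const (hμ : PsProb μ) (a : ℝ) : psEx μ (fun _ => a) = a := by
  have := psEx_prod hμ ∅ (fun _ _ => (1 : ℝ))
  simp only [Finset.prod_empty] at this
  have h2 := psEx_mul_left (μ := μ) a (fun _ => 1)
  rw [this] at h2
  simpa using h2

lemma psW_nonneg (hμ : PsProb μ) (ω : ι → β) : 0 ≤ ∏ i, μ i (ω i) :=
  Finset.prod_nonneg fun i _ => hμ.nonneg i _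

lemma psEx_mono (hμ : PsProb μ) {f g : (ι → β) → ℝ}
    (h : ∀ ω, f ω ≤ g ω) : psEx μ f ≤ psEx μ g :=
  Finset.sum_le_sum fun ω _ => mul_le_mul_of_nonneg_left (h ω) (psW_nonneg hμ ω)

lemma psEx_nonneg (hμ : PsProb μ) {f : (ι → β) → ℝ} (h : ∀ ω, 0 ≤ f ω) : 0 ≤ psEx μ f :=
  Finset.sum_nonneg fun ω _ => mul_nonneg (psW_nonneg hμ ω) (h ω)

lemma psEx_av (hμ : PsProb μ) (i : ι) (f : (ι → β) → ℝ) :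
    psEx μ f = psEx μ (fun ω => ∑ b, μ i b * f (Function.update ω i b)) := by
  have hsplit : ∀ ω : ι → β, (∏ j, μ j (ω j)) = μ i (ω i) * ∏ j ∈ univ.erase i, μ j (ω j) :=
    fun ω => (Finset.mul_prod_erase univ (fun j => μ j (ω j)) (Finset.mem_univ i)).symm
  have hup : ∀ (ω : ι → β) (b : β), ∏ j ∈ univ.erase i, μ j (Function.update ω i b j)
      = ∏ j ∈ univ.erase i, μ j (ω j) := by
    intro ω b
    refine Finset.prod_congr rfl fun j hj => ?_
    rw [Function.update_of_ne (Finset.ne_of_mem_erase hj)]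
  unfold psEx
  calc ∑ ω : ι → β, (∏ j, μ j (ω j)) * f ω
      = ∑ ω : ι → β, ∑ b, μ i b * ((∏ j, μ j (ω j)) * f ω) := by
        refine Finset.sum_congr rfl fun ω _ => ?_
        rw [← Finset.sum_mul, hμ.sum_one, one_mul]
    _ = ∑ z : (ι → β) × β, μ i z.2 * ((∏ j, μ j (z.1 j)) * f z.1) := by
        rw [Fintype.sum_prod_type]
    _ = ∑ z : (ι → β) × β, μ i (z.1 i) * ((∏ j, μ j (Function.update z.1 i z.2 j)) *
          f (Function.update z.1 i z.2)) := by
        refine Finset.sum_nbij' (fun z => (Function.update z.1 i z.2, z.1 i))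
          (fun z => (Function.update z.1 i z.2, z.1 i)) ?_ ?_ ?_ ?_ ?_ <;> simp
    _ = ∑ ω : ι → β, (∏ j, μ j (ω j)) * ∑ b, μ i b * f (Function.update ω i b) := by
        rw [Fintype.sum_prod_type]
        refine Finset.sum_congr rfl fun ω _ => ?_
        rw [Finset.mul_sum]
        refine Finset.sum_congr rfl fun b _ => ?_
        rw [hsplit, hup, hsplit ω]
        simp only [Function.update_self]
        ring

lemma psEx_mul_indep (hμ : PsProb μ) (S : Finset ι) :
    ∀ (f g : (ι → β) → ℝ), DependsOn f (S : Set ι) → DependsOn g ((S : Set ι)ᶜ) →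
      psEx μ (fun ω => f ω * g ω) = psEx μ f * psEx μ g := by
  induction S using Finset.induction_on with
  | empty =>
    intro f g hf _
    rcases isEmpty_or_nonempty (ι → β) with he | ⟨⟨ω0⟩⟩
    · simp [psEx]
    · have : ∀ ω, f ω = f ω0 := fun ω => hf (by simp)
      have hf' : f = fun _ => f ω0 := funext this
      rw [hf', psEx_mul_left, psEx_const hμ]
  | insert i S hi ih =>
    intro f g hf hg
    rw [psEx_av hμ i (fun ω => f ω * g ω), psEx_av hμ i f]
    rw [← ih]
    · congr 1
      ext ω
      rw [Finset.sum_mul]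
      refine Finset.sum_congr rfl fun b _ => ?_
      have : g (Function.update ω i b) = g ω := by
        apply hg
        intro j hj
        rw [Function.update_of_ne]
        rintro rfl
        simp at hj
      rw [this]; ring
    · intro x y hxy
      refine Finset.sum_congr rfl fun b _ => ?_
      congr 1
      apply hf
      intro j hj
      by_cases hji : j = i
      · subst hji; simp
      · rw [Function.update_of_ne hji, Function.update_of_ne hji]
        apply hxy
        simpa [hji] using hj
    · intro x y hxy
      apply hg
      intro j hj
      apply hxy
      simp at hj ⊢
      exact hj.2

lemma psPr_nonneg (hμ : PsProb μ) (A : (ι → β) → Prop) : 0 ≤ psPr μ A :=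
  psEx_nonneg hμ fun ω => by split_ifs <;> norm_num

lemma psPr_mono (hμ : PsProb μ) {A B : (ι → β) → Prop} (h : ∀ ω, A ω → B ω) :
    psPr μ A ≤ psPr μ B := by
  refine psEx_mono hμ fun ω => ?_
  by_cases hA : A ω
  · simp [hA, h ω hA]
  · simp only [hA, if_false]; split_ifs <;> norm_num

lemma psPr_or (hμ : PsProb μ) (A B : (ι → β) → Prop) :
    psPr μ (fun ω => A ω ∨ B ω) ≤ psPr μ A + psPr μ B := by
  unfold psPr
  rw [← psEx_add]
  refine psEx_mono hμ fun ω => ?_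
  by_cases hA : A ω <;> by_cases hB : B ω <;> simp [hA, hB]

lemma psPr_exists (hμ : PsProb μ) {J : Type} (s : Finset J) (A : J → (ι → β) → Prop) :
    psPr μ (fun ω => ∃ j ∈ s, A j ω) ≤ ∑ j ∈ s, psPr μ (A j) := by
  unfold psPr
  rw [← psEx_sum]
  refine psEx_mono hμ fun ω => ?_
  split_ifs with h
  · obtain ⟨j, hj, hA⟩ := h
    have := Finset.single_le_sum (f := fun j => if A j ω then (1 : ℝ) else 0)
      (fun j _ => by split_ifs <;> norm_num) hj
    simpa [hA] using this
  · exact Finset.sum_nonneg fun j _ => by split_ifs <;> norm_num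

lemma psPr_indep (hμ : PsProb μ) (A B : (ι → β) → Prop) (S T : Set ι)
    (hA : DependsOn A S) (hB : DependsOn B T) (hST : Disjoint S T) :
    psPr μ (fun ω => A ω ∧ B ω) = psPr μ A * psPr μ B := by
  unfold psPr
  rw [← psEx_mul_indep hμ (Finset.univ.filter (· ∈ S))]
  · congr 1; ext ω
    by_cases hA : A ω <;> by_cases hB : B ω <;> simp [hA, hB]
  · intro x y hxy
    have := hA (fun i hi => hxy i (by simpa using hi))
    simp only [this]
  · intro x y hxy
    have : B x = B y := by
      refine hB (fun i hi => hxy i ?_)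
      simp only [Finset.coe_filter, Finset.mem_univ, true_and, Set.mem_compl_iff, Set.mem_setOf_eq]
      exact fun h => Set.disjoint_left.mp hST h hi
    simp only [this]

/-- Lovász local lemma. -/
theorem ps_LLL (hμ : PsProb μ) {J : Type} [Fintype J] (A : J → (ι → β) → Prop)
    (S : J → Set ι) (hdep : ∀ j, DependsOn (A j) (S j))
    (hsum : ∀ j, ∑ j' ∈ univ.filter (fun j' => j' = j ∨ ¬ Disjoint (S j) (S j')),
      psPr μ (A j') ≤ 1 / 4) :
    ∃ ω : ι → β, 0 < ∏ i, μ i (ω i) ∧ ∀ j, ¬ A j ω := by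
  have hP : ∀ j, psPr μ (A j) ≤ 1 / 4 := fun j =>
    (Finset.single_le_sum (f := fun j' => psPr μ (A j'))
      (fun j' _ => psPr_nonneg hμ _) (by simp)).trans (hsum j)
  set N : Finset J → (ι → β) → Prop := fun F ω => ∀ j ∈ F, ¬ A j ω with hN
  have hNdep : ∀ F : Finset J, DependsOn (N F) (⋃ j ∈ F, S j) := by
    intro F x y hxy
    simp only [hN, eq_iff_iff]
    refine forall₂_congr fun j hj => ?_
    rw [hdep j (fun i hi => hxy i (by simp only [Set.mem_iUnion]; exact ⟨j, hj, hi⟩))]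
  have key : ∀ m : ℕ, ∀ F : Finset J, F.card = m → (0 < psPr μ (N F) ∧
      ∀ j, psPr μ (fun ω => A j ω ∧ N F ω) ≤ 2 * psPr μ (A j) * psPr μ (N F)) := by
    intro m
    induction m using Nat.strong_induction_on with
    | _ m ih =>
    intro F hF
    have hpos : 0 < psPr μ (N F) := by
      rcases F.eq_empty_or_nonempty with rfl | ⟨j, hj⟩
      · have : psPr μ (N ∅) = 1 := by
          simp only [psPr, hN]; simp [psEx_const hμ]
        rw [this]; norm_num
      · obtain ⟨h1, h2⟩ := ih (F.erase j).card (by rw [← hF]; exact Finset.card_erase_lt_of_mem hj)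
          (F.erase j) rfl
        have h3 := h2 j
        have h4 : psPr μ (N (F.erase j)) = psPr μ (N F) +
            psPr μ (fun ω => A j ω ∧ N (F.erase j) ω) := by
          unfold psPr
          rw [← psEx_add]
          congr 1; ext ω
          have : N F ω ↔ (¬ A j ω ∧ N (F.erase j) ω) := by
            simp only [hN]
            conv_lhs => rw [← Finset.insert_erase hj]
            simp only [Finset.forall_mem_insert]
          simp only [this]
          by_cases hA : A j ω <;> by_cases hB : N (F.erase j) ω <;> simp [hA, hB]
        nlinarith [hP j]
    refine ⟨hpos, fun j => ?_⟩
    set F1 := F.filter (fun i => ¬ Disjoint (S j) (S i)) with hF1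
    set F2 := F.filter (fun i => Disjoint (S j) (S i)) with hF2
    have hind : psPr μ (fun ω => A j ω ∧ N F2 ω) = psPr μ (A j) * psPr μ (N F2) := by
      refine psPr_indep hμ _ _ (S j) _ (hdep j) (hNdep F2) ?_
      simp only [Set.disjoint_iUnion_right, hF2, Finset.mem_filter]
      exact fun i hi => hi.2
    have hle : psPr μ (fun ω => A j ω ∧ N F ω) ≤ psPr μ (fun ω => A j ω ∧ N F2 ω) := by
      refine psPr_mono hμ fun ω h => ⟨h.1, fun i hi => h.2 i (Finset.mem_of_mem_filter i hi)⟩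
    have hhalf : psPr μ (N F2) ≤ 2 * psPr μ (N F) := by
      by_cases hc : F2.card < m
      · obtain ⟨h1, h2⟩ := ih _ hc F2 rfl
        have h5 : psPr μ (N F2) ≤ psPr μ (N F) +
            ∑ i ∈ F1, psPr μ (fun ω => A i ω ∧ N F2 ω) := by
          refine le_trans ?_ (add_le_add le_rfl (psPr_exists hμ F1 (fun i ω => A i ω ∧ N F2 ω)))
          refine le_trans ?_ (psPr_or hμ _ _)
          refine psPr_mono hμ fun ω h => ?_
          by_cases h' : N F ω
          · exact Or.inl h'
          · right
            simp only [hN, not_forall, not_not] at h'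
            obtain ⟨i, hi, hA⟩ := h'
            refine ⟨i, ?_, hA, h⟩
            rw [hF1, Finset.mem_filter]
            refine ⟨hi, fun hd => h i ?_ hA⟩
            rw [hF2, Finset.mem_filter]; exact ⟨hi, hd⟩
        have h6 : ∑ i ∈ F1, psPr μ (fun ω => A i ω ∧ N F2 ω) ≤
            ∑ i ∈ F1, 2 * psPr μ (A i) * psPr μ (N F2) := Finset.sum_le_sum fun i _ => h2 i
        have h7 : ∑ i ∈ F1, psPr μ (A i) ≤ 1 / 4 := by
          refine le_trans (Finset.sum_le_sum_of_subset_of_nonneg ?_ fun i _ _ => psPr_nonneg hμ _)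
            (hsum j)
          intro i hi
          rw [hF1, Finset.mem_filter] at hi
          simp [hi.2]
        rw [← Finset.sum_mul, ← Finset.mul_sum] at h6
        nlinarith
      · have hFF : F2 = F := Finset.eq_of_subset_of_card_le (Finset.filter_subset _ _)
          (by rw [hF]; omega)
        rw [hFF]; linarith
    have := psPr_nonneg hμ (A j)
    rw [hind] at hle
    nlinarith
  obtain ⟨h1, -⟩ := key _ univ rfl
  by_contra hcon
  push Not at hcon
  have : psPr μ (N univ) ≤ 0 := by
    unfold psPr psEx
    refine Finset.sum_nonpos fun ω _ => ?_
    by_cases hω : N univ ω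
    · rcases (psW_nonneg hμ ω).lt_or_eq with h | h
      · obtain ⟨j, hj⟩ := hcon ω h
        exact absurd hj (hω j (Finset.mem_univ j))
      · rw [← h]; simp
    · simp [hω]
  linarith

end ProductSpace

section Bernoulli

/-- Bernoulli marginals. -/
def bern {ι : Type} (p : ι → ℝ) : ι → Bool → ℝ := fun i b => if b then p i else 1 - p i

variable {ι : Type} [Fintype ι] {p : ι → ℝ}

lemma bern_prob (hp0 : ∀ i, 0 ≤ p i) (hp1 : ∀ i, p i ≤ 1) : PsProb (bern p) where
  nonneg := by
    intro i b; cases b <;> simp [bern, hp0 i, hp1 i]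
  sum_one := by intro i; simp [bern]

lemma bern_av (hp0 : ∀ i, 0 ≤ p i) (hp1 : ∀ i, p i ≤ 1) (i : ι) (f : (ι → Bool) → ℝ) :
    psEx (bern p) f = psEx (bern p) (fun ω => p i * f (Function.update ω i true)
      + (1 - p i) * f (Function.update ω i false)) := by
  rw [psEx_av (bern_prob hp0 hp1) i]
  simp [bern]

lemma exp_quad {z : ℝ} (hz : |z| ≤ 1) : Real.exp z ≤ 1 + z + z ^ 2 := by
  have := abs_le.mp (Real.abs_exp_sub_one_sub_id_le hz)
  linarith [this.2]

lemma exp_two {z : ℝ} (h0 : 0 ≤ z) (hz : z ≤ 1) : Real.exp z ≤ 1 + 2 * z := by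
  have := exp_quad (z := z) (by rw [abs_of_nonneg h0]; exact hz)
  nlinarith

theorem bern_mgf (hp0 : ∀ i, 0 ≤ p i) (hp1 : ∀ i, p i ≤ 1) (e : ι → ℝ) (he : ∀ i, 0 ≤ e i)
    (lam : ℝ) (hlam : 0 ≤ lam) (hle : ∀ i, lam * e i ≤ 1) (S : Finset ι) :
    ∀ f : (ι → Bool) → ℝ, DependsOn f (S : Set ι) →
      (∀ i, p i ≠ 0 → ∀ ω, |f (Function.update ω i true) - f (Function.update ω i false)| ≤ e i) →
      psEx (bern p) (fun ω => Real.exp (lam * f ω)) ≤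
        Real.exp (lam * psEx (bern p) f + lam ^ 2 * ∑ i ∈ S, p i * e i ^ 2) := by
  have hμ := bern_prob hp0 hp1
  induction S using Finset.induction_on with
  | empty =>
    intro f hf _
    have hf' : f = fun _ => f (fun _ => false) := funext fun ω => hf (by simp)
    rw [hf', psEx_const hμ, psEx_const hμ]; simp
  | insert i S hi ih =>
    intro f hf hL
    rw [bern_av hp0 hp1 i (fun ω => Real.exp (lam * f ω)), bern_av hp0 hp1 i f]
    set g : (ι → Bool) → ℝ := fun ω => p i * f (Function.update ω i true)
      + (1 - p i) * f (Function.update ω i false) with hg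
    have hgd : DependsOn g (S : Set ι) := by
      intro x y hxy
      have : ∀ b, f (Function.update x i b) = f (Function.update y i b) := by
        intro b
        apply hf
        intro j hj
        by_cases hji : j = i
        · subst hji; simp
        · rw [Function.update_of_ne hji, Function.update_of_ne hji]
          apply hxy
          simpa [hji] using hj
      simp only [hg, this]
    have hgL : ∀ j, p j ≠ 0 → ∀ ω,
        |g (Function.update ω j true) - g (Function.update ω j false)| ≤ e j := by
      intro j hj ω
      by_cases hji : j = i
      · subst hji
        simp [hg, he j]
      · have h1 := hL j hj (Function.update ω i true)
        have h2 := hL j hj (Function.update ω i false)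
        simp only [hg]
        rw [Function.update_comm hji, Function.update_comm hji,
          Function.update_comm hji, Function.update_comm hji]
        rw [abs_le] at h1 h2 ⊢
        have := hp0 i
        have := hp1 i
        constructor <;> nlinarith [h1.1, h1.2, h2.1, h2.2]
    have hpt : ∀ ω, p i * Real.exp (lam * f (Function.update ω i true))
        + (1 - p i) * Real.exp (lam * f (Function.update ω i false)) ≤
        Real.exp (lam * g ω) * Real.exp (lam ^ 2 * (p i * e i ^ 2)) := by
      intro ω
      set f1 := f (Function.update ω i true)
      set f0 := f (Function.update ω i false)
      by_cases hpi : p i = 0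
      · simp only [hg, hpi]; simp [f0]
      have h1 : |f1 - f0| ≤ e i := hL i hpi ω
      have hz : |lam * (f1 - f0)| ≤ 1 := by
        rw [abs_mul, abs_of_nonneg hlam]
        exact (mul_le_mul_of_nonneg_left h1 hlam).trans (hle i)
      have h2 := exp_quad hz
      have h3 : (f1 - f0) ^ 2 ≤ e i ^ 2 := by
        rw [← sq_abs]; gcongr
      rw [← Real.exp_add]
      have e1 : Real.exp (lam * f1) = Real.exp (lam * f0) * Real.exp (lam * (f1 - f0)) := by
        rw [← Real.exp_add]; ring_nf
      have e2 : lam * g ω + lam ^ 2 * (p i * e i ^ 2) = lam * f0 + (p i * (lam * (f1 - f0))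
          + lam ^ 2 * (p i * e i ^ 2)) := by
        simp only [hg]; ring
      rw [e1, e2, Real.exp_add]
      have h4 := Real.add_one_le_exp (p i * (lam * (f1 - f0)) + lam ^ 2 * (p i * e i ^ 2))
      have h5 : p i * (lam ^ 2 * (f1 - f0) ^ 2) ≤ lam ^ 2 * (p i * e i ^ 2) := by
        have := mul_le_mul_of_nonneg_left h3 (mul_nonneg (hp0 i) (sq_nonneg lam))
        nlinarith
      have h6 : 1 - p i + p i * Real.exp (lam * (f1 - f0)) ≤
          Real.exp (p i * (lam * (f1 - f0)) + lam ^ 2 * (p i * e i ^ 2)) := by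
        have := mul_le_mul_of_nonneg_left h2 (hp0 i)
        nlinarith
      have := mul_le_mul_of_nonneg_left h6 (Real.exp_pos (lam * f0)).le
      nlinarith
    refine (psEx_mono hμ hpt).trans ?_
    rw [psEx_mul_right]
    have h7 := ih g hgd hgL
    refine (mul_le_mul_of_nonneg_right h7 (Real.exp_pos _).le).trans ?_
    rw [← Real.exp_add, Finset.sum_insert hi]
    apply le_of_eq
    ring_nf

lemma psPr_markov {ι β : Type} [Fintype ι] [Fintype β] {μ : ι → β → ℝ} (hμ : PsProb μ)
    (A : (ι → β) → Prop) (F : (ι → β) → ℝ) (hF : ∀ ω, 0 ≤ F ω) (a : ℝ)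
    (h : ∀ ω, A ω → Real.exp a ≤ F ω) : psPr μ A ≤ Real.exp (-a) * psEx μ F := by
  unfold psPr
  rw [← psEx_mul_left]
  refine psEx_mono hμ fun ω => ?_
  split_ifs with hA
  · have := mul_le_mul_of_nonneg_left (h ω hA) (Real.exp_pos (-a)).le
    rwa [← Real.exp_add, neg_add_cancel, Real.exp_zero] at this
  · exact mul_nonneg (Real.exp_pos _).le (hF ω)

/-- Indicator that nothing in `X` is picked. -/
def nop {ι : Type} (X : Finset ι) (ω : ι → Bool) : ℝ := ∏ c ∈ X, if ω c then (0 : ℝ) else 1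

lemma nop_eq (X : Finset ι) (ω : ι → Bool) :
    nop X ω = if (∀ c ∈ X, ω c = false) then 1 else 0 := by
  unfold nop
  split_ifs with h
  · exact Finset.prod_eq_one fun c hc => by simp [h c hc]
  · push Not at h
    obtain ⟨c, hc, h⟩ := h
    exact Finset.prod_eq_zero hc (by simp [Bool.eq_true_of_not_eq_false h])

lemma nop_nonneg (X : Finset ι) (ω : ι → Bool) : 0 ≤ nop X ω := by
  rw [nop_eq]; split_ifs <;> norm_num

lemma nop_le_one (X : Finset ι) (ω : ι → Bool) : nop X ω ≤ 1 := by
  rw [nop_eq]; split_ifs <;> norm_num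

lemma psEx_nop (hp0 : ∀ i, 0 ≤ p i) (hp1 : ∀ i, p i ≤ 1) (X : Finset ι) :
    psEx (bern p) (nop X) = ∏ c ∈ X, (1 - p c) := by
  have := psEx_prod (bern_prob hp0 hp1) X (fun _ b => if b then (0 : ℝ) else 1)
  unfold nop
  rw [this]
  refine Finset.prod_congr rfl fun c _ => by simp [bern]

lemma nop_update (X : Finset ι) (ω : ι → Bool) (i : ι) :
    |nop X (Function.update ω i true) - nop X (Function.update ω i false)| ≤
      if i ∈ X then 1 else 0 := by
  split_ifs with h
  · have h1 := nop_nonneg X (Function.update ω i true)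
    have h2 := nop_nonneg X (Function.update ω i false)
    have h3 := nop_le_one X (Function.update ω i true)
    have h4 := nop_le_one X (Function.update ω i false)
    rw [abs_le]; constructor <;> linarith
  · have : nop X (Function.update ω i true) = nop X (Function.update ω i false) := by
      unfold nop
      refine Finset.prod_congr rfl fun c hc => ?_
      have : c ≠ i := by rintro rfl; exact h hc
      rw [Function.update_of_ne this, Function.update_of_ne this]
    simp [this]

theorem tail_nop (hp0 : ∀ i, 0 ≤ p i) (hp1 : ∀ i, p i ≤ 1) {J : Type} (F : Finset J)
    (g : J → ℝ) (X : J → Finset ι) (E R lam t : ℝ) (hE0 : 0 ≤ E)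
    (hE : ∀ c, p c ≠ 0 → ∑ j ∈ F with c ∈ X j, |g j| ≤ E)
    (hR : ∑ j ∈ F, |g j| * ∑ c ∈ X j, p c ≤ R) (hlam : 0 ≤ lam) (h1 : lam * E ≤ 1)
    (h2 : lam * E * R ≤ t / 2) :
    psPr (bern p) (fun ω => psEx (bern p) (fun ω => ∑ j ∈ F, g j * nop (X j) ω) + t ≤
      ∑ j ∈ F, g j * nop (X j) ω) ≤ Real.exp (-(lam * t / 2)) := by
  have hμ := bern_prob hp0 hp1
  set f : (ι → Bool) → ℝ := fun ω => ∑ j ∈ F, g j * nop (X j) ω with hf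
  set e : ι → ℝ := fun c => if p c = 0 then 0 else ∑ j ∈ F with c ∈ X j, |g j| with he
  have he0 : ∀ c, 0 ≤ e c := by
    intro c; simp only [he]; split_ifs
    · exact le_rfl
    · exact Finset.sum_nonneg fun j _ => abs_nonneg _
  have heE : ∀ c, e c ≤ E := by
    intro c; simp only [he]; split_ifs with h
    · exact hE0
    · exact hE c h
  have hmgf := bern_mgf hp0 hp1 e he0 lam hlam
    (fun c => (mul_le_mul_of_nonneg_left (heE c) hlam).trans h1) univ f
    (by intro x y hxy
        have : x = y := funext fun i => hxy i (by simp)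
        rw [this])
    (by intro i hi ω
        simp only [hf, he, hi, if_false]
        rw [← Finset.sum_sub_distrib]
        refine (Finset.abs_sum_le_sum_abs _ _).trans ?_
        rw [Finset.sum_filter]
        refine Finset.sum_le_sum fun j _ => ?_
        rw [← mul_sub, abs_mul]
        refine (mul_le_mul_of_nonneg_left (nop_update _ _ _) (abs_nonneg _)).trans ?_
        split_ifs <;> simp)
  have hvar : ∑ i, p i * e i ^ 2 ≤ E * R := by
    calc ∑ i, p i * e i ^ 2 ≤ ∑ i, E * (p i * ∑ j ∈ F with i ∈ X j, |g j|) := by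
          refine Finset.sum_le_sum fun i _ => ?_
          by_cases h : p i = 0
          · simp [h]
          · have h3 := heE i
            have h4 := he0 i
            have h5 : e i = ∑ j ∈ F with i ∈ X j, |g j| := by simp [he, h]
            rw [← h5]
            have := mul_le_mul_of_nonneg_left h3 (mul_nonneg (hp0 i) h4)
            nlinarith
      _ = E * ∑ j ∈ F, |g j| * ∑ c ∈ X j, p c := by
          rw [← Finset.mul_sum]
          congr 1
          simp only [Finset.mul_sum, Finset.sum_filter]
          rw [Finset.sum_comm]
          refine Finset.sum_congr rfl fun j _ => ?_
          simp only [mul_ite, mul_zero]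
          rw [← Finset.sum_filter, Finset.filter_mem_eq_inter, Finset.univ_inter]
          exact Finset.sum_congr rfl fun c _ => mul_comm _ _
      _ ≤ E * R := mul_le_mul_of_nonneg_left hR hE0
  refine (psPr_markov hμ _ (fun ω => Real.exp (lam * f ω)) (fun ω => (Real.exp_pos _).le)
    (lam * (psEx (bern p) f + t)) (fun ω h => Real.exp_le_exp.mpr
      (mul_le_mul_of_nonneg_left h hlam))).trans ?_
  refine (mul_le_mul_of_nonneg_left hmgf (Real.exp_pos _).le).trans ?_
  rw [← Real.exp_add, Real.exp_le_exp]
  have : lam ^ 2 * ∑ i, p i * e i ^ 2 ≤ lam * (t / 2) := by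
    have h3 := mul_le_mul_of_nonneg_left hvar (sq_nonneg lam)
    have h4 := mul_le_mul_of_nonneg_left h2 hlam
    nlinarith
  nlinarith

/-- Integrating out picked coordinates. -/
theorem bern_lin (hp0 : ∀ i, 0 ≤ p i) (hp1 : ∀ i, p i ≤ 1) (a : ι → (ι → Bool) → ℝ)
    (ha0 : ∀ i ω, 0 ≤ a i ω) (ha1 : ∀ i, p i ≠ 0 → ∀ ω, a i ω ≤ 1) (S : Finset ι) :
    ∀ (g : (ι → Bool) → ℝ), (∀ ω, 0 ≤ g ω) → DependsOn g ((S : Set ι)ᶜ) →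
      (∀ i ∈ S, DependsOn (a i) ((S : Set ι)ᶜ)) →
      psEx (bern p) (fun ω => g ω * Real.exp (∑ i ∈ S, if ω i then a i ω else 0)) ≤
      psEx (bern p) (fun ω => g ω * Real.exp (∑ i ∈ S, 2 * p i * a i ω)) := by
  have hμ := bern_prob hp0 hp1
  induction S using Finset.induction_on with
  | empty => intro g _ _ _; simp
  | insert i S hi ih =>
    intro g hg hgd had
    have hupd : ∀ (h : (ι → Bool) → ℝ), DependsOn h (((insert i S : Finset ι) : Set ι)ᶜ) →
        ∀ ω b, h (Function.update ω i b) = h ω := by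
      intro h hd ω b
      apply hd
      intro j hj
      rw [Function.update_of_ne]
      rintro rfl; simp at hj
    have hS : ∀ (ω : ι → Bool) (b : Bool), (∑ j ∈ S, if (Function.update ω i b) j then a j (Function.update ω i b) else 0)
        = ∑ j ∈ S, if ω j then a j ω else 0 := by
      intro ω b
      refine Finset.sum_congr rfl fun j hj => ?_
      have : j ≠ i := by rintro rfl; exact hi hj
      rw [Function.update_of_ne this, hupd _ (had j (by simp [hj]))]
    have hsub : (((insert i S : Finset ι) : Set ι)ᶜ) ⊆ ((S : Set ι)ᶜ) := by
      intro j; simp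
    rw [bern_av hp0 hp1 i]
    have hih := ih (fun ω => g ω * Real.exp (2 * p i * a i ω))
      (fun ω => mul_nonneg (hg ω) (Real.exp_pos _).le)
      (by intro x y hxy
          have h1 := hgd (fun j hj => hxy j (hsub hj))
          have h2 := had i (by simp) (fun j hj => hxy j (hsub hj))
          simp only [h1, h2])
      (by intro j hj x y hxy
          exact had j (by simp [hj]) (fun j hj => hxy j (hsub hj)))
    refine le_trans (psEx_mono hμ fun ω => ?_) (hih.trans (le_of_eq ?_))
    · simp only [Finset.sum_insert hi, hS, hupd g hgd, Function.update_self,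
        hupd _ (had i (Finset.mem_insert_self i S)), if_true, Bool.false_eq_true, if_false, zero_add]
      rw [Real.exp_add]
      have h3 : p i * Real.exp (a i ω) + (1 - p i) ≤ Real.exp (2 * p i * a i ω) := by
        by_cases h : p i = 0
        · simp [h]
        · have h4 := exp_two (ha0 i ω) (ha1 i h ω)
          have h5 := Real.add_one_le_exp (2 * p i * a i ω)
          have := mul_le_mul_of_nonneg_left h4 (hp0 i)
          nlinarith
      have := mul_le_mul_of_nonneg_left h3 (mul_nonneg (hg ω)
        (Real.exp_pos (∑ j ∈ S, if ω j then a j ω else 0)).le)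
      nlinarith
    · congr 1; ext ω
      rw [Finset.sum_insert hi, Real.exp_add]; ring

lemma psEx_jensen {ι β : Type} [Fintype ι] [Fintype β] {μ : ι → β → ℝ} (hμ : PsProb μ)
    (f : (ι → β) → ℝ) : Real.exp (psEx μ f) ≤ psEx μ (fun ω => Real.exp (f ω)) := by
  have h : ∀ ω, Real.exp (psEx μ f) * (1 - psEx μ f) + Real.exp (psEx μ f) * f ω ≤
      Real.exp (f ω) := by
    intro ω
    have h1 := Real.add_one_le_exp (f ω - psEx μ f)
    have h2 := mul_le_mul_of_nonneg_left h1 (Real.exp_pos (psEx μ f)).le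
    rw [← Real.exp_add] at h2
    ring_nf at h2 ⊢
    linarith
  have := psEx_mono hμ h
  rw [psEx_add, psEx_const hμ, psEx_mul_left] at this
  linarith

/-- Upper tail of a quadratic form, on the event that linear forms are bounded. -/
theorem tail_quad (hp0 : ∀ i, 0 ≤ p i) (hp1 : ∀ i, p i ≤ 1) (wt : ι → ι → ℝ)
    (hw0 : ∀ i j, 0 ≤ wt i j) (hwd : ∀ i, wt i i = 0) (lam t K : ℝ) (hK : 0 ≤ K)
    (hlam : 0 ≤ lam) (h1 : 4 * lam * K ≤ 1)
    (h2 : ∀ i, p i ≠ 0 → 8 * lam * ∑ j, wt i j * p j ≤ 1)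
    (h3 : 32 * ∑ i, ∑ j, wt i j * p i * p j ≤ t) :
    psPr (bern p) (fun ω => t ≤ (∑ i, ∑ j, if ω i ∧ ω j then wt i j else 0) ∧
      ∀ j, ω j = true → (∑ i, if ω i then wt i j else 0) ≤ K) ≤ Real.exp (-(lam * t / 2)) := by
  have hμ := bern_prob hp0 hp1
  have hh : PsProb (bern (fun _ : ι => (1 / 2 : ℝ))) :=
    bern_prob (fun _ => by norm_num) (fun _ => by norm_num)
  set cond : (ι → Bool) → Prop := fun ω =>
    ∀ j, ω j = true → (∑ i, if ω i then wt i j else 0) ≤ K with hcond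
  set f : (ι → Bool) → ℝ := fun ω => ∑ i, ∑ j, if ω i ∧ ω j then wt i j else 0 with hf
  set fT : (ι → Bool) → (ι → Bool) → ℝ := fun T ω =>
    ∑ i, ∑ j, (if ω i ∧ ω j then wt i j else 0) * ((if T i then 1 else 0) * (if T j then 0 else 1))
    with hfT
  have hav : ∀ ω, psEx (bern (fun _ : ι => (1 / 2 : ℝ))) (fun T => 4 * lam * fT T ω)
      = lam * f ω := by
    intro ω
    rw [psEx_mul_left]
    simp only [hfT, hf]
    rw [psEx_sum, mul_assoc, mul_left_comm, Finset.mul_sum]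
    congr 1
    refine Finset.sum_congr rfl fun i _ => ?_
    rw [psEx_sum, Finset.mul_sum]
    refine Finset.sum_congr rfl fun j _ => ?_
    rw [psEx_mul_left]
    by_cases hij : i = j
    · subst hij; simp [hwd]
    · have := psEx_prod hh {i, j} (fun c b => if c = i then (if b then (1 : ℝ) else 0) else
        (if b then 0 else 1))
      rw [Finset.prod_pair hij] at this
      simp only [Finset.prod_pair hij, if_true, if_neg (Ne.symm hij)] at this
      rw [this]
      simp [bern]; ring_nf
  -- for every T
  set E0 := ∑ i, ∑ j, wt i j * p i * p j with hE0
  have hT : ∀ T : ι → Bool, psEx (bern p) (fun ω => if cond ω then Real.exp (4 * lam * fT T ω) else 0)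
      ≤ Real.exp (16 * lam * E0) := by
    intro T
    set a : ι → (ι → Bool) → ℝ := fun j ω =>
      4 * lam * min (∑ i, if (ω i ∧ T i) then wt i j else 0) K with ha
    have ha0 : ∀ j ω, 0 ≤ a j ω := by
      intro j ω
      refine mul_nonneg (by linarith) (le_min (Finset.sum_nonneg fun i _ => ?_) hK)
      split_ifs; exacts [hw0 _ _, le_rfl]
    have ha1 : ∀ j ω, a j ω ≤ 1 := fun j ω =>
      (mul_le_mul_of_nonneg_left (min_le_right _ _) (by linarith)).trans h1
    set S := univ.filter (fun i => T i = false) with hS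
    have step1 := bern_lin hp0 hp1 a ha0 (fun j _ => ha1 j) S (fun _ => 1) (fun _ => zero_le_one)
      (fun _ _ _ => rfl) (by
        intro j _ x y hxy
        have : ∀ i, (if (x i ∧ T i) then wt i j else 0) = (if (y i ∧ T i) then wt i j else 0) := by
          intro i
          cases hTi : T i
          · simp
          · rw [hxy i (by simp [hS, hTi])]
        simp only [ha, this])
    have step2 := bern_lin hp0 hp1 (fun i _ => 8 * lam * ∑ j, wt i j * p j)
      (fun i _ => mul_nonneg (by linarith) (Finset.sum_nonneg fun j _ => mul_nonneg (hw0 _ _) (hp0 _)))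
      (fun i hi _ => h2 i hi) (univ.filter (fun i => T i = true)) (fun _ => 1)
      (fun _ => zero_le_one) (fun _ _ _ => rfl) (fun _ _ _ _ _ => rfl)
    simp only [one_mul] at step1 step2
    calc psEx (bern p) (fun ω => if cond ω then Real.exp (4 * lam * fT T ω) else 0)
        ≤ psEx (bern p) (fun ω => Real.exp (∑ i ∈ S, if ω i then a i ω else 0)) := by
          refine psEx_mono hμ fun ω => ?_
          split_ifs with hc
          · rw [Real.exp_le_exp]
            simp only [hfT]
            rw [Finset.sum_comm, Finset.mul_sum, hS, Finset.sum_filter]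
            refine Finset.sum_le_sum fun j _ => ?_
            cases hTj : T j
            · by_cases hj : ω j = true
              · have hm : (∑ i, if (ω i ∧ T i) then wt i j else 0) ≤ K := by
                  refine le_trans (Finset.sum_le_sum fun i _ => ?_) (hc j hj)
                  have := hw0 i j
                  by_cases h5 : ω i = true <;> by_cases h6 : T i = true <;> simp [h5, h6, this]
                simp only [ha, min_eq_left hm, hj]
                simp only [and_true, if_true]
                refine mul_le_mul_of_nonneg_left (le_of_eq ?_) (by linarith)
                refine Finset.sum_congr rfl fun i _ => ?_
                by_cases h5 : ω i = true <;> by_cases h6 : T i = true <;> simp [h5, h6]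
              · simp [hj]
            · simp
          · exact (Real.exp_pos _).le
      _ ≤ psEx (bern p) (fun ω => Real.exp (∑ i ∈ S, 2 * p i * a i ω)) := step1
      _ ≤ psEx (bern p) (fun ω => Real.exp (∑ i ∈ univ.filter (fun i => T i = true),
            if ω i then 8 * lam * ∑ j, wt i j * p j else 0)) := by
          refine psEx_mono hμ fun ω => ?_
          rw [Real.exp_le_exp]
          calc ∑ j ∈ S, 2 * p j * a j ω
              ≤ ∑ j, 2 * p j * a j ω := Finset.sum_le_sum_of_subset_of_nonneg
                (Finset.subset_univ _) (fun j _ _ => mul_nonneg (by linarith [hp0 j]) (ha0 j ω))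
            _ ≤ ∑ j, 2 * p j * (4 * lam * ∑ i, if (ω i ∧ T i) then wt i j else 0) := by
                refine Finset.sum_le_sum fun j _ => ?_
                refine mul_le_mul_of_nonneg_left ?_ (by linarith [hp0 j])
                exact mul_le_mul_of_nonneg_left (min_le_left _ _) (by linarith)
            _ = _ := by
                simp only [Finset.mul_sum]
                rw [Finset.sum_comm, Finset.sum_filter]
                refine Finset.sum_congr rfl fun i _ => ?_
                by_cases h5 : ω i = true <;> by_cases h6 : T i = true <;> simp [h5, h6]
                refine Finset.sum_congr rfl fun j _ => by ring
      _ ≤ psEx (bern p) (fun ω => Real.exp (∑ i ∈ univ.filter (fun i => T i = true),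
            2 * p i * (8 * lam * ∑ j, wt i j * p j))) := step2
      _ = Real.exp (∑ i ∈ univ.filter (fun i => T i = true),
            2 * p i * (8 * lam * ∑ j, wt i j * p j)) := psEx_const hμ _
      _ ≤ Real.exp (16 * lam * E0) := by
          rw [Real.exp_le_exp]
          refine le_trans (Finset.sum_le_sum_of_subset_of_nonneg (Finset.subset_univ _)
            (fun i _ _ => mul_nonneg (by linarith [hp0 i]) (mul_nonneg (by linarith)
              (Finset.sum_nonneg fun j _ => mul_nonneg (hw0 _ _) (hp0 _))))) (le_of_eq ?_)
          simp only [hE0, Finset.mul_sum]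
          refine Finset.sum_congr rfl fun i _ => Finset.sum_congr rfl fun j _ => by ring
  have hmain : psEx (bern p) (fun ω => if cond ω then Real.exp (lam * f ω) else 0) ≤
      Real.exp (16 * lam * E0) := by
    calc psEx (bern p) (fun ω => if cond ω then Real.exp (lam * f ω) else 0)
        ≤ psEx (bern p) (fun ω => psEx (bern (fun _ : ι => (1 / 2 : ℝ)))
            (fun T => if cond ω then Real.exp (4 * lam * fT T ω) else 0)) := by
          refine psEx_mono hμ fun ω => ?_
          split_ifs with hc
          · rw [← hav]; exact psEx_jensen hh _
          · rw [psEx_const hh]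
      _ = psEx (bern (fun _ : ι => (1 / 2 : ℝ))) (fun T => psEx (bern p)
            (fun ω => if cond ω then Real.exp (4 * lam * fT T ω) else 0)) := by
          simp only [psEx, Finset.mul_sum]
          rw [Finset.sum_comm]
          exact Finset.sum_congr rfl fun _ _ => Finset.sum_congr rfl fun _ _ => by ring
      _ ≤ psEx (bern (fun _ : ι => (1 / 2 : ℝ))) (fun _ => Real.exp (16 * lam * E0)) :=
          psEx_mono hh hT
      _ = _ := psEx_const hh _
  refine (psPr_markov hμ _ (fun ω => if cond ω then Real.exp (lam * f ω) else 0)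
    (fun ω => by split_ifs; exacts [(Real.exp_pos _).le, le_rfl]) (lam * t) (fun ω h => by
      rw [if_pos h.2]
      exact Real.exp_le_exp.mpr (mul_le_mul_of_nonneg_left h.1 hlam))).trans ?_
  refine (mul_le_mul_of_nonneg_left hmain (Real.exp_pos _).le).trans ?_
  rw [← Real.exp_add, Real.exp_le_exp]
  have := mul_le_mul_of_nonneg_left h3 hlam
  linarith

lemma tail_count (hp0 : ∀ i, 0 ≤ p i) (hp1 : ∀ i, p i ≤ 1) (N : Finset ι)
    (hN : ∑ i ∈ N, p i ≤ 1) (K : ℝ) :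
    psPr (bern p) (fun ω => K ≤ ∑ i ∈ N, if ω i then (1 : ℝ) else 0) ≤ Real.exp (2 - K) := by
  have hμ := bern_prob hp0 hp1
  have := bern_lin hp0 hp1 (fun _ _ => 1) (fun _ _ => zero_le_one) (fun _ _ _ => le_rfl) N
    (fun _ => 1) (fun _ => zero_le_one) (fun _ _ _ => rfl) (fun _ _ _ _ _ => rfl)
  simp only [one_mul, mul_one] at this
  rw [psEx_const hμ] at this
  refine (psPr_markov hμ _ _ (fun ω => (Real.exp_pos _).le) K
    (fun ω h => Real.exp_le_exp.mpr h)).trans ?_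
  refine (mul_le_mul_of_nonneg_left this (Real.exp_pos _).le).trans ?_
  rw [← Real.exp_add, Real.exp_le_exp, ← Finset.mul_sum]
  linarith

end Bernoulli

section Weights

variable {V C : Type} [Fintype V] [Fintype C]

/-- Neighbours of a color. -/
def nb (H : SimpleGraph C) (c : C) : Finset C := univ.filter (fun c' => H.Adj c c')

/-- The list of a vertex. -/
def fib (π : C → V) (v : V) : Finset C := univ.filter (fun c => π c = v)

/-- Weighted color degree. -/
def wA (H : SimpleGraph C) (x : C → ℝ) (c : C) : ℝ := ∑ c' ∈ nb H c, x c'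

/-- Total weight of a vertex. -/
def wW (π : C → V) (x : C → ℝ) (v : V) : ℝ := ∑ c ∈ fib π v, x c

/-- Weighted conflict count. -/
def wQ (π : C → V) (H : SimpleGraph C) (x : C → ℝ) (v : V) : ℝ := ∑ c ∈ fib π v, x c * wA H x c

/-- Weighted entropy. -/
def wJ (π : C → V) (l Lam : ℝ) (x : C → ℝ) (v : V) : ℝ :=
  ∑ c ∈ fib π v, x c * (1 - Real.log (l * x c) / Lam)

/-- Survival probability of a color. -/
def kp (H : SimpleGraph C) (η : ℝ) (x : C → ℝ) (c : C) : ℝ := ∏ c' ∈ nb H c, (1 - η * x c')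

/-- Rescaled weight. -/
def sc (H : SimpleGraph C) (η : ℝ) (x : C → ℝ) (c : C) : ℝ := x c / kp H η x c

/-- Abstract cover. -/
structure Cov (π : C → V) (G : SimpleGraph V) (H : SimpleGraph C) (Δ : ℕ) (k : ℝ) : Prop where
  adj : ∀ c c', H.Adj c c' → G.Adj (π c) (π c')
  mat : ∀ c c1 c2, H.Adj c c1 → H.Adj c c2 → π c1 = π c2 → c1 = c2
  deg : ∀ v, (univ.filter (fun u => G.Adj v u)).card ≤ Δ
  tri : ∀ c, ((∑ c1 ∈ nb H c, (nb H c ∩ nb H c1).card : ℕ) : ℝ) ≤ 2 * k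

/-- Conditions on weights before a step. -/
structure Wt (π : C → V) (H : SimpleGraph C) (x : C → ℝ) (η p M l Qm : ℝ) : Prop where
  nn : ∀ c, 0 ≤ x c
  le : ∀ c, x c ≤ p
  low : ∀ c, x c ≠ 0 → 1 ≤ l * x c
  A : ∀ c, x c ≠ 0 → wA H x c ≤ M
  w2 : ∀ v, wW π x v ≤ 2
  w12 : ∀ c, x c ≠ 0 → 1 / 2 ≤ wW π x (π c)
  Q : ∀ v, wQ π H x v ≤ Qm
  η0 : 0 < η
  η1 : η ≤ 1 / 8
  p1 : p ≤ 1
  M1 : 1 ≤ M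
  ηM : η * M ≤ 1 / 2

@[simp] lemma mem_nb {H : SimpleGraph C} {c c' : C} : c' ∈ nb H c ↔ H.Adj c c' := by simp [nb]
@[simp] lemma mem_fib {π : C → V} {v : V} {c : C} : c ∈ fib π v ↔ π c = v := by simp [fib]

lemma one_sub_sum_le_prod {ι : Type} (S : Finset ι) (z : ι → ℝ) (h0 : ∀ i, 0 ≤ z i)
    (h1 : ∀ i, z i ≤ 1) : 1 - ∑ i ∈ S, z i ≤ ∏ i ∈ S, (1 - z i) := by
  induction S using Finset.induction_on with
  | empty => simp
  | insert i S hi ih =>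
    rw [Finset.sum_insert hi, Finset.prod_insert hi]
    have h2 : ∏ i ∈ S, (1 - z i) ≤ 1 := Finset.prod_le_one
      (fun j _ => by linarith [h1 j]) (fun j _ => by linarith [h0 j])
    nlinarith [h0 i, h1 i]

variable {π : C → V} {G : SimpleGraph V} {H : SimpleGraph C} {Δ : ℕ} {k : ℝ}
  {x : C → ℝ} {η p M l Qm : ℝ}

/-- At most one neighbor in each fiber. -/
lemma Cov.sum_le (hc : Cov π G H Δ k) (c : C) (v : V) (f : C → ℝ) (B : ℝ) (hB : 0 ≤ B)
    (hf : ∀ c, f c ≤ B) : ∑ c' ∈ fib π v with H.Adj c c', f c' ≤ B := by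
  have hcard : ((fib π v).filter (fun c' => H.Adj c c')).card ≤ 1 := by
    rw [Finset.card_le_one]
    intro a ha b hb
    simp only [Finset.mem_filter, mem_fib] at ha hb
    exact hc.mat c a b ha.2 hb.2 (ha.1.trans hb.1.symm)
  calc ∑ c' ∈ fib π v with H.Adj c c', f c' ≤ ((fib π v).filter (fun c' => H.Adj c c')).card • B :=
        Finset.sum_le_card_nsmul _ _ _ fun c _ => hf c
    _ ≤ 1 • B := nsmul_le_nsmul_left hB hcard
    _ = B := one_nsmul B

namespace Wt

variable (hx : Wt π H x η p M l Qm)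
include hx

lemma ηx0 (c : C) : 0 ≤ η * x c := mul_nonneg hx.η0.le (hx.nn c)

lemma ηx1 (c : C) : η * x c ≤ 1 / 2 := by
  have := hx.le c; have := hx.p1; have := hx.η0; have := hx.η1; have := hx.nn c
  nlinarith

lemma ηx1' (c : C) : η * x c ≤ 1 := by linarith [hx.ηx1 c]

lemma p0 (c : C) : 0 ≤ p := (hx.nn c).trans (hx.le c)

lemma A0 (c : C) : 0 ≤ wA H x c := Finset.sum_nonneg fun c _ => hx.nn c

lemma W0 (v : V) : 0 ≤ wW π x v := Finset.sum_nonneg fun c _ => hx.nn c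

lemma Q0 (v : V) : 0 ≤ wQ π H x v := Finset.sum_nonneg fun c _ => mul_nonneg (hx.nn c) (hx.A0 c)

lemma kp_pos (c : C) : 0 < kp H η x c :=
  Finset.prod_pos fun c' _ => by linarith [hx.ηx1 c']

lemma kp_le (c : C) : kp H η x c ≤ 1 :=
  Finset.prod_le_one (fun c' _ => by linarith [hx.ηx1 c']) (fun c' _ => by linarith [hx.ηx0 c'])

lemma kp_half (c : C) (h : x c ≠ 0) : 1 / 2 ≤ kp H η x c := by
  have h1 := one_sub_sum_le_prod (nb H c) (fun c => η * x c) hx.ηx0 hx.ηx1'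
  rw [← Finset.mul_sum] at h1
  have h2 := mul_le_mul_of_nonneg_left (hx.A c h) hx.η0.le
  have := hx.ηM
  unfold kp
  unfold wA at h2
  linarith

lemma sc_zero (c : C) (h : x c = 0) : sc H η x c = 0 := by simp [sc, h]

lemma sc_nn (c : C) : 0 ≤ sc H η x c := div_nonneg (hx.nn c) (hx.kp_pos c).le

lemma sc_ge (c : C) : x c ≤ sc H η x c := by
  rw [sc, le_div_iff₀ (hx.kp_pos c)]
  nlinarith [hx.kp_le c, hx.nn c]

lemma sc_le (c : C) : sc H η x c ≤ 2 * x c := by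
  by_cases h : x c = 0
  · rw [hx.sc_zero c h, h]; simp
  · rw [sc, div_le_iff₀ (hx.kp_pos c)]
    nlinarith [hx.kp_half c h, hx.nn c]

lemma sc_le_p (c : C) : sc H η x c ≤ 2 * p := by linarith [hx.sc_le c, hx.le c]

lemma sc_mul_kp (c : C) : sc H η x c * kp H η x c = x c :=
  div_mul_cancel₀ _ (hx.kp_pos c).ne'

end Wt

/-- Ordered conflicting pairs at `v`. -/
def prs (π : C → V) (H : SimpleGraph C) (v : V) : Finset (C × C) :=
  univ.filter (fun z => π z.1 = v ∧ H.Adj z.1 z.2)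

lemma sum_prs (v : V) (f : C → C → ℝ) :
    ∑ z ∈ prs π H v, f z.1 z.2 = ∑ c ∈ fib π v, ∑ c' ∈ nb H c, f c c' := by
  unfold prs fib nb
  rw [Finset.sum_filter, Fintype.sum_prod_type, Finset.sum_filter]
  refine Finset.sum_congr rfl fun c _ => ?_
  rw [Finset.sum_filter]
  by_cases h : π c = v <;> simp [h]

lemma sum_prs_x (v : V) : ∑ z ∈ prs π H v, x z.1 * x z.2 = wQ π H x v := by
  rw [sum_prs v (fun c c' => x c * x c')]
  simp only [wQ, wA, Finset.mul_sum]

/-- Mass of pairs from `v` to `u`. -/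
def mU (π : C → V) (H : SimpleGraph C) (η : ℝ) (x : C → ℝ) (v u : V) : ℝ :=
  ∑ z ∈ prs π H v with π z.2 = u, sc H η x z.1 * sc H η x z.2

section
variable (hx : Wt π H x η p M l Qm)
include hx

lemma sum_sc_le (v : V) : ∑ c ∈ fib π v, sc H η x c ≤ 4 := by
  have : ∑ c ∈ fib π v, sc H η x c ≤ ∑ c ∈ fib π v, 2 * x c :=
    Finset.sum_le_sum fun c _ => hx.sc_le c
  rw [← Finset.mul_sum] at this
  have h2 := hx.w2 v
  unfold wW at h2
  linarith

lemma sum_sc_nb_le (c : C) : ∑ c' ∈ nb H c, sc H η x c' ≤ 2 * wA H x c := by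
  have : ∑ c' ∈ nb H c, sc H η x c' ≤ ∑ c' ∈ nb H c, 2 * x c' :=
    Finset.sum_le_sum fun c _ => hx.sc_le c
  rwa [← Finset.mul_sum] at this

lemma mU_nonneg (v u : V) : 0 ≤ mU π H η x v u :=
  Finset.sum_nonneg fun z _ => mul_nonneg (hx.sc_nn _) (hx.sc_nn _)

lemma mU_le (hc : Cov π G H Δ k) (hp : 0 ≤ p) (v u : V) : mU π H η x v u ≤ 8 * p := by
  unfold mU
  rw [Finset.sum_filter, sum_prs v (fun c c' => if π c' = u then sc H η x c * sc H η x c' else 0)]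
  calc ∑ c ∈ fib π v, ∑ c' ∈ nb H c, (if π c' = u then sc H η x c * sc H η x c' else 0)
      ≤ ∑ c ∈ fib π v, sc H η x c * (2 * p) := by
        refine Finset.sum_le_sum fun c _ => ?_
        have := hc.sum_le c u (sc H η x) (2 * p) (by linarith) hx.sc_le_p
        refine le_trans (le_of_eq ?_) (mul_le_mul_of_nonneg_left this (hx.sc_nn c))
        rw [Finset.mul_sum, ← Finset.sum_filter]
        refine Finset.sum_congr ?_ fun _ _ => rfl
        ext c'; simp [and_comm]
    _ ≤ 4 * (2 * p) := by
        rw [← Finset.sum_mul]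
        exact mul_le_mul_of_nonneg_right (sum_sc_le hx v) (by linarith)
    _ = 8 * p := by ring

lemma sum_scsc (v : V) : ∑ z ∈ prs π H v, sc H η x z.1 * sc H η x z.2 ≤ 4 * wQ π H x v := by
  rw [← sum_prs_x, Finset.mul_sum]
  refine Finset.sum_le_sum fun z _ => ?_
  have h1 := hx.sc_le z.1
  have h2 := hx.sc_le z.2
  have h3 := hx.sc_nn z.1
  have h4 := hx.sc_nn z.2
  have h5 := hx.nn z.1
  have := mul_le_mul h1 h2 h4 (by linarith)
  linarith

lemma sum_mU (v : V) : ∑ u, mU π H η x v u ≤ 4 * wQ π H x v := by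
  refine le_trans (le_of_eq ?_) (sum_scsc hx v)
  unfold mU
  exact Finset.sum_fiberwise _ _ _

lemma ex_kp_pos : (∀ c, 0 ≤ η * x c) ∧ (∀ c, η * x c ≤ 1) := ⟨hx.ηx0, hx.ηx1'⟩

/-- Expectation of surviving weight. -/
lemma ex_sc (c : C) : psEx (bern (fun c => η * x c)) (nop (nb H c)) = kp H η x c :=
  psEx_nop hx.ηx0 hx.ηx1' _

lemma lip_one (hc : Cov π G H Δ k) (hp : 0 ≤ p) (v : V) (g : C → ℝ)
    (hg : ∀ c, |g c| ≤ sc H η x c) (c0 : C) :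
    ∑ c ∈ fib π v with c0 ∈ nb H c, |g c| ≤ 16 * p * M := by
  have := hc.sum_le c0 v (fun c => |g c|) (2 * p) (by linarith)
    (fun c => (hg c).trans (hx.sc_le_p c))
  refine le_trans (le_of_eq ?_) (this.trans ?_)
  · refine Finset.sum_congr ?_ fun _ _ => rfl
    ext c; simp [H.adj_comm]
  · nlinarith [hx.M1]

lemma var_one (v : V) (g : C → ℝ) (hg : ∀ c, |g c| ≤ sc H η x c) :
    ∑ c ∈ fib π v, |g c| * ∑ c' ∈ nb H c, η * x c' ≤ 16 * η * Qm * M := by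
  have h1 : ∑ c ∈ fib π v, |g c| * ∑ c' ∈ nb H c, η * x c' ≤ 2 * η * wQ π H x v := by
    unfold wQ
    rw [Finset.mul_sum]
    refine Finset.sum_le_sum fun c _ => ?_
    rw [← Finset.mul_sum]
    have h2 : |g c| ≤ 2 * x c := (hg c).trans (hx.sc_le c)
    have h3 : 0 ≤ η * wA H x c := mul_nonneg hx.η0.le (hx.A0 c)
    have := mul_le_mul_of_nonneg_right h2 h3
    unfold wA at this ⊢
    linarith
  have h2 := hx.Q v
  have h3 := hx.Q0 v
  have h4 := hx.M1
  have h5 := hx.η0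
  have h6 : η * wQ π H x v ≤ η * Qm := mul_le_mul_of_nonneg_left h2 h5.le
  have h7 : 0 ≤ η * Qm := (mul_nonneg h5.le h3).trans h6
  nlinarith

/-- Blocking set for a pair. -/
def blk (π : C → V) (H : SimpleGraph C) (z : C × C) : Finset C :=
  nb H z.1 ∪ nb H z.2 ∪ fib π (π z.2)

lemma lip_two (hc : Cov π G H Δ k) (hp : 0 ≤ p) (v : V) (c0 : C) (h0 : x c0 ≠ 0) :
    ∑ z ∈ prs π H v with c0 ∈ blk π H z, |sc H η x z.1 * sc H η x z.2| ≤ 16 * p * M := by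
  set f : C × C → ℝ := fun z => sc H η x z.1 * sc H η x z.2 with hf
  have hf0 : ∀ z, 0 ≤ f z := fun z => mul_nonneg (hx.sc_nn _) (hx.sc_nn _)
  have hM := hx.M1
  have h1 : ∑ z ∈ prs π H v with c0 ∈ nb H z.1, f z ≤ 4 * p * M := by
    rw [Finset.sum_filter, sum_prs v (fun c c' => if c0 ∈ nb H c then f (c, c') else 0)]
    calc _ = ∑ c ∈ fib π v with H.Adj c0 c, sc H η x c * ∑ c' ∈ nb H c, sc H η x c' := by
          rw [Finset.sum_filter]
          refine Finset.sum_congr rfl fun c _ => ?_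
          rw [Finset.mul_sum]
          by_cases h : H.Adj c c0
          · simp [h, h.symm, hf]
          · have h' : ¬ H.Adj c0 c := fun h2 => h h2.symm
            simp [h, h']
      _ ≤ 2 * p * (2 * M) := by
          refine hc.sum_le c0 v (fun c => sc H η x c * ∑ c' ∈ nb H c, sc H η x c') _
            (mul_nonneg (by linarith) (by linarith)) fun c => ?_
          by_cases h : x c = 0
          · rw [hx.sc_zero c h, zero_mul]; exact mul_nonneg (by linarith) (by linarith)
          · exact mul_le_mul (hx.sc_le_p c) ((sum_sc_nb_le hx c).trans (by linarith [hx.A c h]))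
              (Finset.sum_nonneg fun c _ => hx.sc_nn c) (by linarith)
      _ = _ := by ring
  have h2 : ∑ z ∈ prs π H v with c0 ∈ nb H z.2, f z ≤ 4 * p * M := by
    rw [Finset.sum_filter, sum_prs v (fun c c' => if c0 ∈ nb H c' then f (c, c') else 0)]
    calc _ = ∑ c' ∈ nb H c0, sc H η x c' * ∑ c ∈ fib π v with H.Adj c' c, sc H η x c := by
          have : ∀ c ∈ fib π v, ∑ c' ∈ nb H c, (if c0 ∈ nb H c' then f (c, c') else 0)
              = ∑ c' ∈ nb H c0, if H.Adj c' c then sc H η x c' * sc H η x c else 0 := by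
            intro c _
            rw [← Finset.sum_filter, ← Finset.sum_filter]
            refine Finset.sum_congr ?_ fun c' _ => by simp [hf, mul_comm]
            ext c'
            simp only [Finset.mem_filter, mem_nb]
            exact ⟨fun h => ⟨h.2.symm, h.1.symm⟩, fun h => ⟨h.2.symm, h.1.symm⟩⟩
          rw [Finset.sum_congr rfl this, Finset.sum_comm]
          refine Finset.sum_congr rfl fun c' _ => ?_
          rw [Finset.mul_sum, Finset.sum_filter]
      _ ≤ ∑ c' ∈ nb H c0, sc H η x c' * (2 * p) := by
          refine Finset.sum_le_sum fun c' _ => mul_le_mul_of_nonneg_left ?_ (hx.sc_nn c')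
          exact hc.sum_le c' v _ _ (by linarith) hx.sc_le_p
      _ ≤ 2 * M * (2 * p) := by
          rw [← Finset.sum_mul]
          exact mul_le_mul_of_nonneg_right ((sum_sc_nb_le hx c0).trans (by linarith [hx.A c0 h0]))
            (by linarith)
      _ = _ := by ring
  have h3 : ∑ z ∈ prs π H v with π z.2 = π c0, f z ≤ 8 * p := mU_le hx hc hp v (π c0)
  have h4 : ∑ z ∈ prs π H v with c0 ∈ blk π H z, |f z| ≤
      ∑ z ∈ prs π H v with c0 ∈ nb H z.1, f z + ∑ z ∈ prs π H v with c0 ∈ nb H z.2, f z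
      + ∑ z ∈ prs π H v with π z.2 = π c0, f z := by
    simp only [Finset.sum_filter]
    rw [← Finset.sum_add_distrib, ← Finset.sum_add_distrib]
    refine Finset.sum_le_sum fun z _ => ?_
    have := hf0 z
    rw [abs_of_nonneg this]
    simp only [blk, Finset.mem_union, mem_fib, eq_comm (a := π c0)]
    by_cases q1 : c0 ∈ nb H z.1 <;> by_cases q2 : c0 ∈ nb H z.2 <;> by_cases q3 : π z.2 = π c0 <;>
      simp [q1, q2, q3] <;> linarith
  refine h4.trans ?_
  nlinarith

lemma var_two (v : V) :
    ∑ z ∈ prs π H v, |sc H η x z.1 * sc H η x z.2| * ∑ c ∈ blk π H z, η * x c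
      ≤ 16 * η * Qm * M := by
  have hη := hx.η0
  have hM := hx.M1
  have key : ∀ z ∈ prs π H v, |sc H η x z.1 * sc H η x z.2| * ∑ c ∈ blk π H z, η * x c ≤
      (sc H η x z.1 * sc H η x z.2) * (η * (2 * M + 2)) := by
    intro z _
    rw [abs_of_nonneg (mul_nonneg (hx.sc_nn _) (hx.sc_nn _))]
    by_cases h1 : x z.1 = 0
    · simp [hx.sc_zero _ h1]
    by_cases h2 : x z.2 = 0
    · simp [hx.sc_zero _ h2]
    refine mul_le_mul_of_nonneg_left ?_ (mul_nonneg (hx.sc_nn _) (hx.sc_nn _))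
    rw [← Finset.mul_sum]
    refine mul_le_mul_of_nonneg_left ?_ hη.le
    have a1 := hx.A _ h1
    have a2 := hx.A _ h2
    have a3 := hx.w2 (π z.2)
    have a4 : ∑ c ∈ blk π H z, x c ≤ wA H x z.1 + wA H x z.2 + wW π x (π z.2) := by
      unfold blk wA wW
      have e1 := Finset.sum_union_inter (s₁ := nb H z.1 ∪ nb H z.2) (s₂ := fib π (π z.2)) (f := x)
      have e2 := Finset.sum_union_inter (s₁ := nb H z.1) (s₂ := nb H z.2) (f := x)
      have p1 : 0 ≤ ∑ c ∈ (nb H z.1 ∪ nb H z.2) ∩ fib π (π z.2), x c :=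
        Finset.sum_nonneg fun c _ => hx.nn c
      have p2 : 0 ≤ ∑ c ∈ nb H z.1 ∩ nb H z.2, x c := Finset.sum_nonneg fun c _ => hx.nn c
      linarith
    linarith
  refine (Finset.sum_le_sum key).trans ?_
  rw [← Finset.sum_mul]
  have h1 := sum_scsc hx v
  have h2 := hx.Q v
  have h3 := hx.Q0 v
  have h5 : 0 ≤ η * (2 * M + 2) := mul_nonneg hη.le (by linarith)
  calc _ ≤ (4 * Qm) * (η * (2 * M + 2)) := mul_le_mul_of_nonneg_right (by linarith) h5
    _ ≤ (4 * Qm) * (η * (4 * M)) := by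
        refine mul_le_mul_of_nonneg_left ?_ (by linarith)
        exact mul_le_mul_of_nonneg_left (by linarith) hη.le
    _ = _ := by ring

/-- Expectation for a pair. -/
lemma ex_pair (hc : Cov π G H Δ k) (z : C × C) (hz : H.Adj z.1 z.2) :
    sc H η x z.1 * sc H η x z.2 * psEx (bern (fun c => η * x c)) (nop (blk π H z)) ≤
      Real.exp (-(η / 2) + η * p) * (x z.1 * x z.2 *
        (1 + 2 * η * ∑ c ∈ nb H z.1 ∩ nb H z.2, x c)) := by
  obtain ⟨c, c'⟩ := z
  simp only at hz ⊢
  have hη := hx.η0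
  by_cases h1 : x c = 0
  · simp [hx.sc_zero _ h1, h1]
  by_cases h2 : x c' = 0
  · simp [hx.sc_zero _ h2, h2]
  rw [psEx_nop hx.ηx0 hx.ηx1']
  set P : Finset C → ℝ := fun S => ∏ c ∈ S, (1 - η * x c) with hP
  have hPpos : ∀ S, 0 < P S := fun S => Finset.prod_pos fun c _ => by linarith [hx.ηx1 c]
  have hX : blk π H (c, c') = (nb H c ∪ nb H c') ∪ (fib π (π c')).erase c' := by
    ext y
    simp only [blk, Finset.mem_union, mem_nb, mem_fib, Finset.mem_erase]
    by_cases hy : y = c'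
    · subst hy; simp [hz]
    · simp [hy]
  have hdis : Disjoint (nb H c ∪ nb H c') ((fib π (π c')).erase c') := by
    rw [Finset.disjoint_left]
    intro y hy1 hy2
    simp only [Finset.mem_union, mem_nb, Finset.mem_erase, mem_fib] at hy1 hy2
    rcases hy1 with h | h
    · exact hy2.1 (hc.mat c y c' h hz hy2.2)
    · exact (hc.adj _ _ h).ne hy2.2.symm
  have e1 : P (blk π H (c, c')) = P (nb H c ∪ nb H c') * P ((fib π (π c')).erase c') := by
    rw [hX]; exact Finset.prod_union hdis
  have e2 : P (nb H c ∪ nb H c') * P (nb H c ∩ nb H c') = kp H η x c * kp H η x c' :=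
    Finset.prod_union_inter
  have e3 : P ((fib π (π c')).erase c') ≤ Real.exp (-(η / 2) + η * p) := by
    calc P ((fib π (π c')).erase c') ≤ ∏ y ∈ (fib π (π c')).erase c', Real.exp (-(η * x y)) := by
          refine Finset.prod_le_prod (fun y _ => by linarith [hx.ηx1 y]) fun y _ => ?_
          linarith [Real.add_one_le_exp (-(η * x y))]
      _ = Real.exp (∑ y ∈ (fib π (π c')).erase c', -(η * x y)) := (Real.exp_sum _ _).symm
      _ ≤ _ := by
          rw [Real.exp_le_exp, Finset.sum_neg_distrib, ← Finset.mul_sum]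
          have s1 := Finset.sum_erase_add (fib π (π c')) x (a := c') (by simp)
          have s2 := hx.w12 c' h2
          unfold wW at s2
          have s3 := hx.le c'
          nlinarith
  set S := ∑ y ∈ nb H c ∩ nb H c', x y with hS
  have hS0 : 0 ≤ S := Finset.sum_nonneg fun y _ => hx.nn y
  have e4 : 1 ≤ (1 + 2 * η * S) * P (nb H c ∩ nb H c') := by
    have q1 := one_sub_sum_le_prod (nb H c ∩ nb H c') (fun c => η * x c) hx.ηx0 hx.ηx1'
    rw [← Finset.mul_sum] at q1
    have q2 : S ≤ wA H x c := Finset.sum_le_sum_of_subset_of_nonneg Finset.inter_subset_left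
      fun y _ _ => hx.nn y
    have q3 := hx.A c h1
    have q4 : η * S ≤ 1 / 2 := (mul_le_mul_of_nonneg_left (q2.trans q3) hη.le).trans hx.ηM
    have q5 : 0 ≤ η * S := mul_nonneg hη.le hS0
    have q6 : 1 ≤ (1 + 2 * η * S) * (1 - η * S) := by nlinarith
    exact q6.trans (mul_le_mul_of_nonneg_left q1 (by nlinarith))
  have e5 : sc H η x c * sc H η x c' * P (nb H c ∪ nb H c') ≤ x c * x c' * (1 + 2 * η * S) := by
    have r1 : sc H η x c * sc H η x c' * (P (nb H c ∪ nb H c') * P (nb H c ∩ nb H c')) = x c * x c' := by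
      rw [e2, ← hx.sc_mul_kp c, ← hx.sc_mul_kp c', hx.sc_mul_kp c, hx.sc_mul_kp c']
      have := hx.sc_mul_kp c
      have := hx.sc_mul_kp c'
      calc _ = (sc H η x c * kp H η x c) * (sc H η x c' * kp H η x c') := by ring
        _ = _ := by rw [hx.sc_mul_kp c, hx.sc_mul_kp c']
    have r2 : 0 ≤ sc H η x c * sc H η x c' * P (nb H c ∪ nb H c') :=
      mul_nonneg (mul_nonneg (hx.sc_nn _) (hx.sc_nn _)) (hPpos _).le
    calc _ ≤ (sc H η x c * sc H η x c' * P (nb H c ∪ nb H c')) *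
          ((1 + 2 * η * S) * P (nb H c ∩ nb H c')) := le_mul_of_one_le_right r2 e4
      _ = (sc H η x c * sc H η x c' * (P (nb H c ∪ nb H c') * P (nb H c ∩ nb H c'))) *
          (1 + 2 * η * S) := by ring
      _ = _ := by rw [r1]
  change sc H η x c * sc H η x c' * P (blk π H (c, c')) ≤ _
  rw [e1]
  have r2 : 0 ≤ sc H η x c * sc H η x c' * P (nb H c ∪ nb H c') :=
    mul_nonneg (mul_nonneg (hx.sc_nn _) (hx.sc_nn _)) (hPpos _).le
  calc _ = (sc H η x c * sc H η x c' * P (nb H c ∪ nb H c')) * P ((fib π (π c')).erase c') := by ring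
    _ ≤ (x c * x c' * (1 + 2 * η * S)) * Real.exp (-(η / 2) + η * p) :=
        mul_le_mul e5 e3 (hPpos _).le (r2.trans e5)
    _ = _ := by ring

lemma sum_tri (hc : Cov π G H Δ k) (hk : 0 ≤ k) (v : V) :
    ∑ z ∈ prs π H v, x z.1 * x z.2 * ∑ c ∈ nb H z.1 ∩ nb H z.2, x c ≤ 4 * k * p ^ 2 := by
  rw [sum_prs v (fun c c' => x c * x c' * ∑ y ∈ nb H c ∩ nb H c', x y)]
  have h1 : ∀ c ∈ fib π v, ∑ c' ∈ nb H c, x c * x c' * ∑ y ∈ nb H c ∩ nb H c', x y ≤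
      x c * (p ^ 2 * (2 * k)) := by
    intro c _
    have hp := hx.p0 c
    calc ∑ c' ∈ nb H c, x c * x c' * ∑ y ∈ nb H c ∩ nb H c', x y
        ≤ ∑ c' ∈ nb H c, x c * (p ^ 2 * ((nb H c ∩ nb H c').card : ℝ)) := by
          refine Finset.sum_le_sum fun c' _ => ?_
          rw [mul_assoc]
          refine mul_le_mul_of_nonneg_left ?_ (hx.nn c)
          have : ∑ y ∈ nb H c ∩ nb H c', x y ≤ ((nb H c ∩ nb H c').card : ℝ) * p := by
            rw [← nsmul_eq_mul]; exact Finset.sum_le_card_nsmul _ _ _ fun y _ => hx.le y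
          calc _ ≤ p * (((nb H c ∩ nb H c').card : ℝ) * p) :=
                mul_le_mul (hx.le c') this (Finset.sum_nonneg fun y _ => hx.nn y) hp
            _ = _ := by ring
      _ = x c * (p ^ 2 * ((∑ c' ∈ nb H c, (nb H c ∩ nb H c').card : ℕ) : ℝ)) := by
          push_cast; rw [Finset.mul_sum, Finset.mul_sum]
      _ ≤ _ := by
          refine mul_le_mul_of_nonneg_left (mul_le_mul_of_nonneg_left (hc.tri c) (sq_nonneg p))
            (hx.nn c)
  refine (Finset.sum_le_sum h1).trans ?_
  rw [← Finset.sum_mul]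
  rcases (fib π v).eq_empty_or_nonempty with he | ⟨c, hcv⟩
  · rw [he]; simp; positivity
  · have hk : 0 ≤ 2 * k := by linarith
    have := mul_le_mul_of_nonneg_right (hx.w2 v) (mul_nonneg (sq_nonneg p) hk)
    unfold wW at this
    linarith

lemma ex_f1 (hc : Cov π G H Δ k) (hk : 0 ≤ k) (hp : 0 ≤ p) (v : V) :
    psEx (bern (fun c => η * x c)) (fun ω => ∑ z ∈ prs π H v,
      sc H η x z.1 * sc H η x z.2 * nop (blk π H z) ω) ≤
    (1 - η / 2) * wQ π H x v + (η * p + η ^ 2) * Qm + 16 * η * k * p ^ 2 := by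
  rw [psEx_sum]
  simp only [psEx_mul_left]
  have h1 : ∑ z ∈ prs π H v, sc H η x z.1 * sc H η x z.2 *
      psEx (bern (fun c => η * x c)) (fun ω => nop (blk π H z) ω) ≤
      ∑ z ∈ prs π H v, Real.exp (-(η / 2) + η * p) * (x z.1 * x z.2 *
        (1 + 2 * η * ∑ c ∈ nb H z.1 ∩ nb H z.2, x c)) := by
    refine Finset.sum_le_sum fun z hz => ex_pair hx hc z ?_
    simp only [prs, Finset.mem_filter] at hz
    exact hz.2.2
  refine h1.trans ?_
  rw [← Finset.mul_sum]
  have h2 : ∑ z ∈ prs π H v, (x z.1 * x z.2 * (1 + 2 * η * ∑ c ∈ nb H z.1 ∩ nb H z.2, x c))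
      = wQ π H x v + 2 * η * ∑ z ∈ prs π H v, x z.1 * x z.2 * ∑ c ∈ nb H z.1 ∩ nb H z.2, x c := by
    rw [← sum_prs_x, Finset.mul_sum, ← Finset.sum_add_distrib]
    exact Finset.sum_congr rfl fun z _ => by ring
  rw [h2]
  have h3 := sum_tri hx hc hk v
  have hη := hx.η0
  have hη1 := hx.η1
  have hp1 := hx.p1
  have q1 : η * p ≤ η := mul_le_of_le_one_right hη.le hp1
  have q0 : 0 ≤ η * p := mul_nonneg hη.le hp
  have hz : |-(η / 2) + η * p| ≤ η := by rw [abs_le]; constructor <;> linarith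
  have h4 := exp_quad (hz.trans (by linarith))
  have h5 : (-(η / 2) + η * p) ^ 2 ≤ η ^ 2 := by rw [← sq_abs]; gcongr
  have h6 : Real.exp (-(η / 2) + η * p) ≤ 1 - η / 2 + (η * p + η ^ 2) := by linarith
  have h7 : Real.exp (-(η / 2) + η * p) ≤ 2 := by nlinarith
  have hQ := hx.Q v
  have hQ0 := hx.Q0 v
  have h8 : 2 * η * ∑ z ∈ prs π H v, x z.1 * x z.2 * ∑ c ∈ nb H z.1 ∩ nb H z.2, x c ≤
    2 * η * (4 * k * p ^ 2) := mul_le_mul_of_nonneg_left h3 (by linarith)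
  have h9 : (0 : ℝ) ≤ 2 * η * (4 * k * p ^ 2) := by positivity
  rw [mul_add]
  have a1 := mul_le_mul_of_nonneg_right h6 hQ0
  have a2 := mul_le_mul h7 h8 (mul_nonneg (by linarith) (Finset.sum_nonneg fun z _ =>
    mul_nonneg (mul_nonneg (hx.nn _) (hx.nn _)) (Finset.sum_nonneg fun c _ => hx.nn c)))
    (by norm_num)
  have a3 := mul_le_mul_of_nonneg_left hQ (show 0 ≤ η * p + η ^ 2 by positivity)
  nlinarith

end

end Weights

section Step

variable {V C : Type} [Fintype V] [Fintype C]
variable {π : C → V} {G : SimpleGraph V} {H : SimpleGraph C} {Δ : ℕ} {k : ℝ}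
  {x : C → ℝ} {η p M l Qm : ℝ}

/-- Closed neighborhood. -/
def cnb (G : SimpleGraph V) (v : V) : Finset V := univ.filter (fun u => u = v ∨ G.Adj v u)

lemma self_cnb (v : V) : v ∈ cnb G v := by simp [cnb]
lemma adj_cnb {v u : V} (h : G.Adj v u) : u ∈ cnb G v := by simp [cnb, h]
lemma cnb_symm {v u : V} (h : u ∈ cnb G v) : v ∈ cnb G u := by
  simp only [cnb, Finset.mem_filter, Finset.mem_univ, true_and] at h ⊢
  rcases h with h | h
  · exact Or.inl h.symm
  · exact Or.inr h.symm

/-- Ball of radius two. -/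
def ball2 (G : SimpleGraph V) (v : V) : Finset V := (cnb G v).biUnion (cnb G)

lemma mem_ball2 {v w : V} : w ∈ ball2 G v ↔ ∃ u ∈ cnb G v, w ∈ cnb G u := by
  simp [ball2]

lemma ball2_symm {v u : V} (h : u ∈ ball2 G v) : v ∈ ball2 G u := by
  rw [mem_ball2] at h ⊢
  obtain ⟨y, h1, h2⟩ := h
  exact ⟨y, cnb_symm h2, cnb_symm h1⟩

lemma cnb_card (hc : Cov π G H Δ k) (v : V) : (cnb G v).card ≤ Δ + 1 := by
  have : cnb G v = insert v (univ.filter (fun u => G.Adj v u)) := by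
    ext u; simp [cnb]
  rw [this]
  exact (Finset.card_insert_le _ _).trans (Nat.add_le_add_right (hc.deg v) 1)

lemma ball2_card (hc : Cov π G H Δ k) (v : V) : (ball2 G v).card ≤ (Δ + 1) ^ 2 := by
  rw [sq]
  exact (Finset.card_biUnion_le_card_mul _ _ _ fun u _ => cnb_card hc u).trans
    (Nat.mul_le_mul_right _ (cnb_card hc v))

lemma ball4_card (hc : Cov π G H Δ k) (v : V) :
    ((ball2 G v).biUnion (ball2 G)).card ≤ (Δ + 1) ^ 4 := by
  refine (Finset.card_biUnion_le_card_mul _ _ _ fun u _ => ball2_card hc u).trans ?_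
  refine (Nat.mul_le_mul_right _ (ball2_card hc v)).trans (le_of_eq (by ring))

/-- Quadratic weights. -/
def qwt (π : C → V) (H : SimpleGraph C) (η : ℝ) (x : C → ℝ) (v : V) (i j : C) : ℝ :=
  if H.Adj i j then mU π H η x v (π i) else 0

lemma mU_adj (hc : Cov π G H Δ k) (v u : V) (h : mU π H η x v u ≠ 0) : G.Adj v u := by
  obtain ⟨z, hz, -⟩ := Finset.exists_ne_zero_of_sum_ne_zero h
  simp only [prs, Finset.mem_filter, Finset.mem_univ, true_and] at hz
  have := hc.adj _ _ hz.1.2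
  rwa [hz.1.1, hz.2] at this

lemma qwt_ne (hc : Cov π G H Δ k) (v : V) (i j : C) (h : qwt π H η x v i j ≠ 0) :
    π i ∈ ball2 G v ∧ π j ∈ ball2 G v := by
  unfold qwt at h
  split_ifs at h with hij
  · have h1 := mU_adj hc v _ h
    exact ⟨mem_ball2.mpr ⟨_, adj_cnb h1, self_cnb _⟩,
      mem_ball2.mpr ⟨_, adj_cnb h1, adj_cnb (hc.adj _ _ hij)⟩⟩
  · exact absurd rfl h

lemma nop_congr {X : Finset C} {a b : C → Bool} (h : ∀ c ∈ X, a c = b c) : nop X a = nop X b :=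
  Finset.prod_congr rfl fun c hc => by rw [h c hc]

lemma nb_ball (hc : Cov π G H Δ k) {c y : C} (h : y ∈ nb H c) : π y ∈ ball2 G (π c) :=
  mem_ball2.mpr ⟨_, self_cnb _, adj_cnb (hc.adj _ _ (mem_nb.mp h))⟩

lemma blk_ball (hc : Cov π G H Δ k) {v : V} {z : C × C} (hz : z ∈ prs π H v) {y : C}
    (h : y ∈ blk π H z) : π y ∈ ball2 G v := by
  simp only [prs, Finset.mem_filter, Finset.mem_univ, true_and] at hz
  have h1 := hc.adj _ _ hz.2
  rw [hz.1] at h1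
  simp only [blk, Finset.mem_union, mem_fib] at h
  rcases h with (h | h) | h
  · rw [← hz.1]; exact nb_ball hc h
  · exact mem_ball2.mpr ⟨_, adj_cnb h1, adj_cnb (hc.adj _ _ (mem_nb.mp h))⟩
  · rw [h]; exact mem_ball2.mpr ⟨_, adj_cnb h1, self_cnb _⟩

section
variable (hx : Wt π H x η p M l Qm)
include hx

lemma E0_le (v : V) :
    ∑ i, ∑ j, qwt π H η x v i j * (η * x i) * (η * x j) ≤ 4 * η ^ 2 * Qm ^ 2 := by
  have h1 : ∑ i, ∑ j, qwt π H η x v i j * (η * x i) * (η * x j) =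
      η ^ 2 * ∑ u, mU π H η x v u * wQ π H x u := by
    have : ∀ i, ∑ j, qwt π H η x v i j * (η * x i) * (η * x j)
        = η ^ 2 * (mU π H η x v (π i) * (x i * wA H x i)) := by
      intro i
      simp only [qwt, wA, nb, Finset.sum_filter, Finset.mul_sum]
      refine Finset.sum_congr rfl fun j _ => ?_
      by_cases h : H.Adj i j <;> simp [h]
      ring
    rw [Finset.sum_congr rfl fun i _ => this i, ← Finset.mul_sum]
    congr 1
    rw [← Finset.sum_fiberwise univ π]
    refine Finset.sum_congr rfl fun u _ => ?_
    rw [wQ, Finset.mul_sum]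
    refine Finset.sum_congr rfl fun i hi => ?_
    rw [mem_fib] at hi
    rw [hi]
  rw [h1]
  have h2 : ∑ u, mU π H η x v u * wQ π H x u ≤ 4 * Qm ^ 2 := by
    calc _ ≤ ∑ u, mU π H η x v u * Qm :=
          Finset.sum_le_sum fun u _ => mul_le_mul_of_nonneg_left (hx.Q u) (mU_nonneg hx v u)
      _ ≤ 4 * Qm * Qm := by
          rw [← Finset.sum_mul]
          have := hx.Q v
          have := hx.Q0 v
          exact mul_le_mul_of_nonneg_right ((sum_mU hx v).trans (by linarith)) (by linarith)
      _ = _ := by ring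
  have := mul_le_mul_of_nonneg_left h2 (sq_nonneg η)
  linarith

lemma card_alive (v : V) (hl : 0 < l) : (((fib π v).filter (fun c => x c ≠ 0)).card : ℝ) ≤ 2 * l := by
  have h1 : (((fib π v).filter (fun c => x c ≠ 0)).card : ℝ) =
      ∑ c ∈ (fib π v).filter (fun c => x c ≠ 0), (1 : ℝ) := by simp
  rw [h1]
  calc _ ≤ ∑ c ∈ (fib π v).filter (fun c => x c ≠ 0), l * x c := by
        refine Finset.sum_le_sum fun c hc => hx.low c (Finset.mem_filter.mp hc).2
    _ ≤ ∑ c ∈ fib π v, l * x c := Finset.sum_le_sum_of_subset_of_nonneg (Finset.filter_subset _ _)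
        fun c _ _ => mul_nonneg hl.le (hx.nn c)
    _ ≤ _ := by
        rw [← Finset.mul_sum]
        have := mul_le_mul_of_nonneg_left (hx.w2 v) hl.le
        unfold wW at this
        linarith

/-- Coefficients of entropy. -/
lemma coefJ (Lam : ℝ) (hl : 0 < l) (hp : 0 < p) (hLam : Lam = Real.log (l * p)) (h1 : 1 ≤ Lam)
    (c : C) : |-(sc H η x c * (1 - Real.log (l * sc H η x c) / Lam))| ≤ sc H η x c := by
  by_cases h : x c = 0
  · simp [hx.sc_zero c h]
  rw [abs_neg, abs_mul, abs_of_nonneg (hx.sc_nn c)]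
  refine mul_le_of_le_one_right (hx.sc_nn c) ?_
  have a1 : 1 ≤ l * sc H η x c := (hx.low c h).trans (mul_le_mul_of_nonneg_left (hx.sc_ge c) hl.le)
  have a2 : 0 ≤ Real.log (l * sc H η x c) := Real.log_nonneg a1
  have a3 : Real.log (l * sc H η x c) ≤ Real.log 2 + Lam := by
    rw [hLam, ← Real.log_mul (by norm_num) (by positivity)]
    refine Real.log_le_log (by linarith) ?_
    have := mul_le_mul_of_nonneg_left (hx.sc_le_p c) hl.le
    linarith
  have a4 : Real.log 2 ≤ 1 := by linarith [Real.log_two_lt_d9]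
  have a5 : Real.log (l * sc H η x c) / Lam ≤ 2 := by
    rw [div_le_iff₀ (by linarith)]; linarith
  have a6 : 0 ≤ Real.log (l * sc H η x c) / Lam := div_nonneg a2 (by linarith)
  rw [abs_le]; constructor <;> linarith

lemma log_kp (c : C) : -((1 + 2 * η) * η * wA H x c) ≤ Real.log (kp H η x c) := by
  unfold kp wA
  rw [Real.log_prod (fun c' _ => by linarith [hx.ηx1 c']), Finset.mul_sum, ← Finset.sum_neg_distrib]
  refine Finset.sum_le_sum fun c' _ => ?_
  have h0 := hx.ηx0 c'
  have h1 := hx.ηx1 c'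
  set y := η * x c' with hy
  have hyη : y ≤ η := by
    have := hx.le c'; have := hx.p1; have := hx.η0
    rw [hy]; nlinarith
  have h2 : Real.exp (-(y + 2 * η * y)) ≤ 1 - y := by
    have hz : |-(y + 2 * η * y)| ≤ 1 := by
      have := hx.η1; have := hx.η0
      rw [abs_le]; constructor <;> nlinarith
    have h3 := exp_quad hz
    have hη := hx.η0
    have hη1 := hx.η1
    have h4 : (y + 2 * η * y) ^ 2 ≤ 2 * η * y := by
      have e1 : (y + 2 * η * y) ^ 2 = (y * y) * (1 + 2 * η) ^ 2 := by ring
      have e2 : y * y ≤ η * y := mul_le_mul_of_nonneg_right hyη h0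
      have e3 : (1 + 2 * η) ^ 2 ≤ 2 := by nlinarith
      have e4 := mul_le_mul e2 e3 (sq_nonneg _) (mul_nonneg hη.le h0)
      linarith
    nlinarith
  have h5 := Real.log_le_log (Real.exp_pos _) h2
  rw [Real.log_exp] at h5
  linarith

end

end Step

section Step2

variable {V C : Type} [Fintype V] [Fintype C]
variable {π : C → V} {G : SimpleGraph V} {H : SimpleGraph C} {Δ : ℕ} {k : ℝ}
  {x : C → ℝ} {η p M l Qm : ℝ}

/-- Numerical conditions for a step. -/
structure StepNum (Δ : ℕ) (η p M l Qm Lam lam t κ : ℝ) : Prop where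
  hp : 0 < p
  hl : 0 < l
  hLam : Lam = Real.log (l * p)
  hLam1 : 1 ≤ Lam
  hlam : 0 ≤ lam
  hκ : 0 ≤ κ
  n1 : lam * (16 * p * M) ≤ 1
  n2 : lam * (16 * p * M) * (16 * η * Qm * M) ≤ t / 2
  n3 : 4 * lam * (8 * p * κ) ≤ 1
  n4 : 8 * lam * (8 * p * (η * M)) ≤ 1
  n5 : 32 * (4 * η ^ 2 * Qm ^ 2) ≤ t
  n6 : ((Δ : ℝ) + 1) ^ 4 * (4 * Real.exp (-(lam * t / 2)) + 2 * l * Real.exp (2 - κ)) ≤ 1 / 4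

/-- Newly colored vertices. -/
def colored (π : C → V) (H : SimpleGraph C) (b : C → Bool) (u : V) : Prop :=
  ∃ c, π c = u ∧ b c = true ∧ ∀ c' ∈ nb H c, b c' = false

/-- Quadratic pick count. -/
def qf (π : C → V) (H : SimpleGraph C) (η : ℝ) (x : C → ℝ) (v : V) (ω : C → Bool) : ℝ :=
  ∑ i, ∑ j, if ω i ∧ ω j then qwt π H η x v i j else 0

lemma qf_bound (hx : Wt π H x η p M l Qm) (v : V) (b : C → Bool) :
    ∑ z ∈ prs π H v, sc H η x z.1 * sc H η x z.2 * (nop (nb H z.1) b * nop (nb H z.2) b *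
      (if colored π H b (π z.2) then 0 else 1)) ≤
    ∑ z ∈ prs π H v, sc H η x z.1 * sc H η x z.2 * nop (blk π H z) b + qf π H η x v b := by
  set cnt : V → ℝ := fun u => ∑ i ∈ fib π u, ∑ j ∈ nb H i, if b i ∧ b j then 1 else 0 with hcnt
  have h1 : qf π H η x v b = ∑ z ∈ prs π H v, sc H η x z.1 * sc H η x z.2 * cnt (π z.2) := by
    have e1 : ∀ i, ∑ j, (if b i ∧ b j then qwt π H η x v i j else 0) =
        mU π H η x v (π i) * ∑ j ∈ nb H i, if b i ∧ b j then 1 else 0 := by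
      intro i
      simp only [qwt, nb, Finset.sum_filter, Finset.mul_sum]
      refine Finset.sum_congr rfl fun j _ => ?_
      by_cases h : H.Adj i j <;> simp [h]
    unfold qf
    rw [Finset.sum_congr rfl fun i _ => e1 i, ← Finset.sum_fiberwise univ π]
    have e2 : ∀ u, ∑ i with π i = u, mU π H η x v (π i) *
        (∑ j ∈ nb H i, if b i ∧ b j then (1 : ℝ) else 0) = mU π H η x v u * cnt u := by
      intro u
      rw [hcnt, Finset.mul_sum]
      refine Finset.sum_congr rfl fun i hi => ?_
      have hi2 := (Finset.mem_filter.1 hi).2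
      rw [hi2]
    rw [Finset.sum_congr rfl fun u _ => e2 u, ← Finset.sum_fiberwise (prs π H v) (fun z => π z.2)]
    refine Finset.sum_congr rfl fun u _ => ?_
    unfold mU
    rw [Finset.sum_mul]
    refine Finset.sum_congr rfl fun z hz => ?_
    rw [Finset.mem_filter] at hz
    rw [hz.2]
  rw [h1, ← Finset.sum_add_distrib]
  refine Finset.sum_le_sum fun z hz => ?_
  rw [← mul_add]
  refine mul_le_mul_of_nonneg_left ?_ (mul_nonneg (hx.sc_nn _) (hx.sc_nn _))
  have hcnt0 : 0 ≤ cnt (π z.2) := Finset.sum_nonneg fun i _ => Finset.sum_nonneg fun j _ => by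
    split_ifs <;> norm_num
  have hn := nop_nonneg (blk π H z) b
  by_cases hcol : colored π H b (π z.2)
  · simp [hcol]; linarith
  have hle1 : nop (nb H z.1) b * nop (nb H z.2) b ≤ 1 :=
    mul_le_one₀ (nop_le_one _ _) (nop_nonneg _ _) (nop_le_one _ _)
  simp only [hcol, if_false, mul_one]
  by_cases hpk : ∃ i, π i = π z.2 ∧ b i = true
  · obtain ⟨i, hi, hb⟩ := hpk
    have : ∃ j ∈ nb H i, b j = true := by
      by_contra hcon
      push Not at hcon
      exact hcol ⟨i, hi, hb, fun c' hc' => by simpa using hcon c' hc'⟩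
    obtain ⟨j, hj, hbj⟩ := this
    have : 1 ≤ cnt (π z.2) := by
      have s1 := Finset.single_le_sum (f := fun j => if b i = true ∧ b j = true then (1 : ℝ) else 0)
        (fun j _ => by split_ifs <;> norm_num) hj
      have s2 := Finset.single_le_sum (f := fun i => ∑ j ∈ nb H i,
        if b i = true ∧ b j = true then (1 : ℝ) else 0)
        (fun i _ => Finset.sum_nonneg fun j _ => by split_ifs <;> norm_num) (mem_fib.mpr hi)
      simp only [hb, hbj, and_self, if_true] at s1
      simp only [hb] at s2
      exact s1.trans s2
    linarith
  · push Not at hpk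
    have : nop (nb H z.1) b * nop (nb H z.2) b ≤ nop (blk π H z) b := by
      have h0 := nop_eq (blk π H z) b
      by_cases h3 : ∀ c ∈ nb H z.1, b c = false
      · by_cases h4 : ∀ c ∈ nb H z.2, b c = false
        · rw [if_pos] at h0
          · rw [h0]; exact hle1
          · intro c hc
            simp only [blk, Finset.mem_union, mem_fib] at hc
            rcases hc with (hc | hc) | hc
            · exact h3 c hc
            · exact h4 c hc
            · simpa using hpk c hc
        · have h5 := nop_eq (nb H z.2) b
          rw [if_neg h4] at h5
          rw [h5]; simpa using hn
      · have h5 := nop_eq (nb H z.1) b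
        rw [if_neg h3] at h5
        rw [h5]; simpa using hn
    linarith

/-- Bad events. -/
def badEv (π : C → V) (H : SimpleGraph C) (η : ℝ) (x : C → ℝ) (l Lam t κ p : ℝ) (v : V)
    (ω : C → Bool) : Prop :=
  (psEx (bern (fun c => η * x c)) (fun ω => ∑ c ∈ fib π v, sc H η x c * nop (nb H c) ω) + t ≤
    ∑ c ∈ fib π v, sc H η x c * nop (nb H c) ω) ∨
  (psEx (bern (fun c => η * x c)) (fun ω => ∑ c ∈ fib π v,
      -(sc H η x c * (1 - Real.log (l * sc H η x c) / Lam)) * nop (nb H c) ω) + t ≤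
    ∑ c ∈ fib π v, -(sc H η x c * (1 - Real.log (l * sc H η x c) / Lam)) * nop (nb H c) ω) ∨
  (psEx (bern (fun c => η * x c)) (fun ω => ∑ z ∈ prs π H v,
      sc H η x z.1 * sc H η x z.2 * nop (blk π H z) ω) + t ≤
    ∑ z ∈ prs π H v, sc H η x z.1 * sc H η x z.2 * nop (blk π H z) ω) ∨
  (t ≤ (∑ i, ∑ j, if ω i ∧ ω j then qwt π H η x v i j else 0) ∧
      ∀ j, ω j = true → (∑ i, if ω i then qwt π H η x v i j else 0) ≤ 8 * p * κ) ∨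
  (∃ c ∈ (fib π v).filter (fun c => x c ≠ 0), κ ≤ ∑ i ∈ nb H c, if ω i then (1 : ℝ) else 0)

lemma badEv_dep (hc : Cov π G H Δ k) (l Lam t κ p : ℝ) (hpκ : 0 ≤ p * κ) (v : V) :
    DependsOn (badEv π H η x l Lam t κ p v) {c | π c ∈ ball2 G v} := by
  intro a b hab
  have hab' : ∀ c, π c ∈ ball2 G v → a c = b c := fun c h => hab c h
  have e1 : ∀ c ∈ fib π v, nop (nb H c) a = nop (nb H c) b := by
    intro c hcv
    rw [mem_fib] at hcv
    exact nop_congr fun y hy => hab' y (hcv ▸ nb_ball hc hy)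
  have e2 : ∀ z ∈ prs π H v, nop (blk π H z) a = nop (blk π H z) b :=
    fun z hz => nop_congr fun y hy => hab' y (blk_ball hc hz hy)
  have s1 : ∀ g : C → ℝ, ∑ c ∈ fib π v, g c * nop (nb H c) a = ∑ c ∈ fib π v, g c * nop (nb H c) b :=
    fun g => Finset.sum_congr rfl fun c h => by rw [e1 c h]
  have s2 : ∀ g : C × C → ℝ, ∑ z ∈ prs π H v, g z * nop (blk π H z) a =
      ∑ z ∈ prs π H v, g z * nop (blk π H z) b :=
    fun g => Finset.sum_congr rfl fun c h => by rw [e2 c h]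
  have s3 : ∀ i j, (if a i = true ∧ a j = true then qwt π H η x v i j else 0) =
      if b i = true ∧ b j = true then qwt π H η x v i j else 0 := by
    intro i j
    by_cases h : qwt π H η x v i j = 0
    · simp [h]
    · obtain ⟨h1, h2⟩ := qwt_ne hc v i j h
      rw [hab' i h1, hab' j h2]
  have s4 : ∀ i j, (if a i = true then qwt π H η x v i j else 0) =
      if b i = true then qwt π H η x v i j else 0 := by
    intro i j
    by_cases h : qwt π H η x v i j = 0
    · simp [h]
    · obtain ⟨h1, h2⟩ := qwt_ne hc v i j h
      rw [hab' i h1]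
  have s5 : (∀ j, a j = true → (∑ i, if a i then qwt π H η x v i j else 0) ≤ 8 * p * κ) ↔
      (∀ j, b j = true → (∑ i, if b i then qwt π H η x v i j else 0) ≤ 8 * p * κ) := by
    refine forall_congr' fun j => ?_
    simp only [s4]
    by_cases h : π j ∈ ball2 G v
    · rw [hab' j h]
    · have : (∑ i, if b i then qwt π H η x v i j else 0) ≤ 8 * p * κ := by
        rw [Finset.sum_eq_zero]
        · linarith
        · intro i _
          have : qwt π H η x v i j = 0 := by
            by_contra h2; exact h (qwt_ne hc v i j h2).2
          simp [this]
      simp [this]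
  have s6 : ∀ c ∈ (fib π v).filter (fun c => x c ≠ 0),
      (∑ i ∈ nb H c, if a i then (1 : ℝ) else 0) = ∑ i ∈ nb H c, if b i then (1 : ℝ) else 0 := by
    intro c hcv
    rw [Finset.mem_filter, mem_fib] at hcv
    refine Finset.sum_congr rfl fun y hy => ?_
    rw [hab' y (hcv.1 ▸ nb_ball hc hy)]
  unfold badEv
  rw [s1 (fun c => sc H η x c), s1 (fun c => -(sc H η x c * (1 - Real.log (l * sc H η x c) / Lam))),
    s2 (fun z => sc H η x z.1 * sc H η x z.2)]
  simp only [s3]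
  rw [eq_iff_iff]
  refine or_congr Iff.rfl (or_congr Iff.rfl (or_congr Iff.rfl (or_congr (and_congr Iff.rfl s5) ?_)))
  refine exists_congr fun c => and_congr_right fun h => ?_
  rw [s6 c h]

lemma badEv_pr (hc : Cov π G H Δ k) (hx : Wt π H x η p M l Qm) {Lam lam t κ : ℝ}
    (hn : StepNum Δ η p M l Qm Lam lam t κ) (v : V) :
    psPr (bern (fun c => η * x c)) (badEv π H η x l Lam t κ p v) ≤
      4 * Real.exp (-(lam * t / 2)) + 2 * l * Real.exp (2 - κ) := by
  have hμ := bern_prob hx.ηx0 hx.ηx1'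
  have hp := hn.hp
  have hη := hx.η0
  have hM := hx.M1
  have hE : 0 ≤ 16 * p * M := by positivity
  have hxc : ∀ c, η * x c ≠ 0 → x c ≠ 0 := fun c h h2 => h (by simp [h2])
  have t1 := tail_nop hx.ηx0 hx.ηx1' (fib π v) (fun c => sc H η x c) (fun c => nb H c)
    (16 * p * M) (16 * η * Qm * M) lam t hE
    (fun c0 _ => lip_one hx hc hp.le v _ (fun c => by rw [abs_of_nonneg (hx.sc_nn c)]) c0)
    (var_one hx v _ (fun c => by rw [abs_of_nonneg (hx.sc_nn c)])) hn.hlam hn.n1 hn.n2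
  have hcJ := coefJ hx Lam hn.hl hp hn.hLam hn.hLam1
  have t2 := tail_nop hx.ηx0 hx.ηx1' (fib π v)
    (fun c => -(sc H η x c * (1 - Real.log (l * sc H η x c) / Lam))) (fun c => nb H c)
    (16 * p * M) (16 * η * Qm * M) lam t hE
    (fun c0 _ => lip_one hx hc hp.le v _ hcJ c0)
    (var_one hx v _ hcJ) hn.hlam hn.n1 hn.n2
  have t3 := tail_nop hx.ηx0 hx.ηx1' (prs π H v) (fun z => sc H η x z.1 * sc H η x z.2)
    (fun z => blk π H z) (16 * p * M) (16 * η * Qm * M) lam t hE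
    (fun c0 h0 => lip_two hx hc hp.le v c0 (hxc c0 h0)) (var_two hx v) hn.hlam hn.n1 hn.n2
  have t4 := tail_quad hx.ηx0 hx.ηx1' (qwt π H η x v)
    (fun i j => by unfold qwt; split_ifs; exacts [mU_nonneg hx v _, le_rfl])
    (fun i => by simp [qwt]) lam t (8 * p * κ)
    (mul_nonneg (by linarith) hn.hκ) hn.hlam hn.n3
    (by
      intro i hi
      have hi' := hxc i hi
      have e1 : ∑ j, qwt π H η x v i j * (η * x j) = mU π H η x v (π i) * (η * wA H x i) := by
        simp only [qwt, wA, nb, Finset.sum_filter, Finset.mul_sum]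
        refine Finset.sum_congr rfl fun j _ => ?_
        by_cases h : H.Adj i j <;> simp [h]
      rw [e1]
      refine le_trans ?_ hn.n4
      refine mul_le_mul_of_nonneg_left ?_ (by linarith [hn.hlam])
      exact mul_le_mul (mU_le hx hc hp.le v _) (mul_le_mul_of_nonneg_left (hx.A i hi') hη.le)
        (mul_nonneg hη.le (hx.A0 i)) (by linarith))
    (by
      refine le_trans ?_ hn.n5
      exact mul_le_mul_of_nonneg_left (E0_le hx v) (by norm_num))
  have t5 : psPr (bern (fun c => η * x c)) (fun ω => ∃ c ∈ (fib π v).filter (fun c => x c ≠ 0),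
      κ ≤ ∑ i ∈ nb H c, if ω i then (1 : ℝ) else 0) ≤ 2 * l * Real.exp (2 - κ) := by
    refine (psPr_exists hμ _ _).trans ?_
    have : ∀ c ∈ (fib π v).filter (fun c => x c ≠ 0), psPr (bern (fun c => η * x c))
        (fun ω => κ ≤ ∑ i ∈ nb H c, if ω i then (1 : ℝ) else 0) ≤ Real.exp (2 - κ) := by
      intro c hcv
      rw [Finset.mem_filter] at hcv
      refine tail_count hx.ηx0 hx.ηx1' _ ?_ κ
      rw [← Finset.mul_sum]
      have := mul_le_mul_of_nonneg_left (hx.A c hcv.2) hη.le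
      have := hx.ηM
      unfold wA at *
      linarith
    refine (Finset.sum_le_card_nsmul _ _ _ this).trans ?_
    rw [nsmul_eq_mul]
    exact mul_le_mul_of_nonneg_right (card_alive hx v hn.hl) (Real.exp_pos _).le
  unfold badEv
  refine (psPr_or hμ _ _).trans ?_
  refine (add_le_add t1 ((psPr_or hμ _ _).trans (add_le_add t2 ((psPr_or hμ _ _).trans
    (add_le_add t3 ((psPr_or hμ _ _).trans (add_le_add t4 t5))))))).trans ?_
  linarith

theorem nibble_step (hc : Cov π G H Δ k) (hx : Wt π H x η p M l Qm) {Lam lam t κ : ℝ}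
    (hn : StepNum Δ η p M l Qm Lam lam t κ) (hk : 0 ≤ k) :
    ∃ b : C → Bool, (∀ c, b c = true → x c ≠ 0) ∧ ∀ v,
      (∑ c ∈ fib π v, sc H η x c * nop (nb H c) b ≤ wW π x v + t) ∧
      (wJ π l Lam x v - (1 + 2 * η) * η * wQ π H x v / Lam - t ≤
        ∑ c ∈ fib π v, sc H η x c * (1 - Real.log (l * sc H η x c) / Lam) * nop (nb H c) b) ∧
      (∑ z ∈ prs π H v, sc H η x z.1 * sc H η x z.2 * (nop (nb H z.1) b * nop (nb H z.2) b *
        (if colored π H b (π z.2) then 0 else 1)) ≤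
        (1 - η / 2) * wQ π H x v + (η * p + η ^ 2) * Qm + 16 * η * k * p ^ 2 + 2 * t) := by
  have hμ := bern_prob hx.ηx0 hx.ηx1'
  have hη := hx.η0
  have hL := hn.hLam1
  have hlll := ps_LLL hμ (fun v => badEv π H η x l Lam t κ p v) (fun v => {c | π c ∈ ball2 G v})
    (fun v => badEv_dep hc l Lam t κ p (mul_nonneg hn.hp.le hn.hκ) v) (by
      intro v
      have hsub : (univ.filter (fun v' => v' = v ∨ ¬ Disjoint {c | π c ∈ ball2 G v}
          {c | π c ∈ ball2 G v'})) ⊆ (ball2 G v).biUnion (ball2 G) := by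
        intro v' hv'
        simp only [Finset.mem_filter, Finset.mem_univ, true_and] at hv'
        rw [Finset.mem_biUnion]
        rcases hv' with rfl | h
        · exact ⟨v', mem_ball2.mpr ⟨_, self_cnb _, self_cnb _⟩, mem_ball2.mpr ⟨_, self_cnb _, self_cnb _⟩⟩
        · rw [Set.not_disjoint_iff] at h
          obtain ⟨c, h1, h2⟩ := h
          exact ⟨π c, h1, ball2_symm h2⟩
      refine (Finset.sum_le_card_nsmul _ _ _ fun v' _ => badEv_pr hc hx hn v').trans ?_
      rw [nsmul_eq_mul]
      refine le_trans ?_ hn.n6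
      refine mul_le_mul_of_nonneg_right ?_ ?_
      · have := (Finset.card_le_card hsub).trans (ball4_card hc v)
        exact_mod_cast this
      · have := hn.hl
        positivity)
  obtain ⟨b, hb, hbad⟩ := hlll
  have hpick : ∀ c, b c = true → x c ≠ 0 := by
    intro c hbc h0
    have : ∏ i, bern (fun c => η * x c) i (b i) = 0 :=
      Finset.prod_eq_zero (Finset.mem_univ c) (by simp [bern, hbc, h0])
    linarith
  refine ⟨b, hpick, fun v => ?_⟩
  have hv := hbad v
  unfold badEv at hv
  push Not at hv
  obtain ⟨a1, a2, a3, a4, a5⟩ := hv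
  refine ⟨?_, ?_, ?_⟩
  · rw [psEx_sum] at a1
    simp only [psEx_mul_left] at a1
    have e : ∀ c, psEx (bern fun c => η * x c) (fun ω => nop (nb H c) ω) = kp H η x c := ex_sc hx
    simp only [e, hx.sc_mul_kp] at a1
    exact a1.le
  · rw [psEx_sum] at a2
    simp only [psEx_mul_left] at a2
    have e : ∀ c, psEx (bern fun c => η * x c) (fun ω => nop (nb H c) ω) = kp H η x c := ex_sc hx
    simp only [e, neg_mul, Finset.sum_neg_distrib] at a2
    have key : wJ π l Lam x v - (1 + 2 * η) * η * wQ π H x v / Lam ≤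
        ∑ c ∈ fib π v, sc H η x c * (1 - Real.log (l * sc H η x c) / Lam) * kp H η x c := by
      unfold wJ wQ
      rw [Finset.mul_sum, Finset.sum_div, ← Finset.sum_sub_distrib]
      refine Finset.sum_le_sum fun c _ => ?_
      by_cases h0 : x c = 0
      · simp [h0, hx.sc_zero]
      have e2 : sc H η x c * (1 - Real.log (l * sc H η x c) / Lam) * kp H η x c =
          x c * (1 - Real.log (l * sc H η x c) / Lam) := by
        rw [mul_right_comm, hx.sc_mul_kp]
      have hxpos : 0 < x c := lt_of_le_of_ne (hx.nn c) (Ne.symm h0)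
      have hkpos := hx.kp_pos c
      have e3 : Real.log (l * sc H η x c) = Real.log (l * x c) - Real.log (kp H η x c) := by
        unfold sc
        rw [← Real.log_div (mul_pos hn.hl hxpos).ne' hkpos.ne', mul_div_assoc]
      rw [e2, e3]
      have e4 := log_kp hx c
      have e5 : -((1 + 2 * η) * η * wA H x c) / Lam ≤ Real.log (kp H η x c) / Lam :=
        div_le_div_of_nonneg_right e4 (by linarith)
      have e6 := mul_le_mul_of_nonneg_left e5 hxpos.le
      have e7 : x c * (-((1 + 2 * η) * η * wA H x c) / Lam) =
        -((1 + 2 * η) * η * (x c * wA H x c) / Lam) := by ring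
      rw [e7] at e6
      rw [sub_div]
      linarith
    linarith
  · have h1 := qf_bound hx v b
    have h2 := ex_f1 hx hc hk hn.hp.le v
    have h3 : qf π H η x v b < t := by
      by_contra hcon
      push Not at hcon
      obtain ⟨j, hj, hj2⟩ := a4 hcon
      have hxj := hpick j hj
      have h5 := (hbad (π j))
      unfold badEv at h5
      push Not at h5
      have h6 := h5.2.2.2.2 j (by simp [hxj])
      have h7 : (∑ i, if b i then qwt π H η x v i j else 0) ≤
          8 * p * ∑ i ∈ nb H j, if b i then (1 : ℝ) else 0 := by
        rw [Finset.mul_sum, nb, Finset.sum_filter]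
        refine Finset.sum_le_sum fun i _ => ?_
        have hm := mU_le hx hc hn.hp.le v (π i)
        have hpp := hn.hp
        by_cases h8 : H.Adj i j
        · by_cases h9 : b i = true <;> simp [qwt, h8, h8.symm, h9, hm]
        · have h8' : ¬ H.Adj j i := fun h => h8 h.symm
          simp [qwt, h8, h8']
      have h8 := mul_le_mul_of_nonneg_left h6.le (show 0 ≤ 8 * p by linarith [hn.hp])
      linarith
    linarith

end Step2

section Final

variable {V C : Type} [Fintype V] [Fintype C]
variable {π : C → V} {G : SimpleGraph V} {H : SimpleGraph C} {Δ : ℕ} {k : ℝ}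
  {x : C → ℝ}

/-- Distribution for the final step. -/
def fmu (π : C → V) (x : C → ℝ) (U : Set V) (φ : V → C) (v : V) (b : C) : ℝ :=
  if v ∈ U then (if π b = v then x b / wW π x v else 0) else if b = φ v then 1 else 0

lemma fmu_prob (U : Set V) (φ : V → C) (hnn : ∀ c, 0 ≤ x c)
    (hw : ∀ v ∈ U, 1 / 2 ≤ wW π x v) : PsProb (fmu π x U φ) := by
  refine ⟨fun v b => ?_, fun v => ?_⟩
  · unfold fmu
    split_ifs with h1 h2 h3
    · exact div_nonneg (hnn b) (by linarith [hw v h1])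
    all_goals norm_num
  · unfold fmu
    by_cases h : v ∈ U
    · simp only [h, if_true]
      rw [← Finset.sum_filter]
      change ∑ c ∈ fib π v, x c / wW π x v = 1
      rw [← Finset.sum_div]
      exact div_self (by have := hw v h; unfold wW at *; linarith)
    · simp [h]

lemma fmu_pair (hc : Cov π G H Δ k) (U : Set V) (φ : V → C) (hnn : ∀ c, 0 ≤ x c)
    (hw : ∀ v ∈ U, 1 / 2 ≤ wW π x v) (c c' : C) :
    psPr (fmu π x U φ) (fun ω => H.Adj c c' ∧ π c ∈ U ∧ π c' ∈ U ∧ ω (π c) = c ∧ ω (π c') = c')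
      ≤ if H.Adj c c' then 4 * (x c * x c') else 0 := by
  have hμ := fmu_prob U φ hnn hw
  by_cases h : H.Adj c c' ∧ π c ∈ U ∧ π c' ∈ U
  · obtain ⟨h1, h2, h3⟩ := h
    have hne : π c ≠ π c' := (hc.adj _ _ h1).ne
    have e := psEx_prod hμ {π c, π c'} (fun i b => if i = π c then (if b = c then 1 else 0)
      else (if b = c' then (1:ℝ) else 0))
    simp only [Finset.prod_pair hne, hne.symm, if_true, if_false, mul_ite, mul_one, mul_zero,
      Finset.sum_ite_eq', Finset.mem_univ] at e
    have e2 : psPr (fmu π x U φ)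
        (fun ω => H.Adj c c' ∧ π c ∈ U ∧ π c' ∈ U ∧ ω (π c) = c ∧ ω (π c') = c') =
        fmu π x U φ (π c) c * fmu π x U φ (π c') c' := by
      rw [← e]
      unfold psPr
      congr 1
      funext ω
      simp only [h1, h2, h3, true_and]
      by_cases a : ω (π c) = c <;> by_cases b : ω (π c') = c' <;> simp [a, b]
    rw [e2, if_pos h1]
    have hb : ∀ c, π c ∈ U → fmu π x U φ (π c) c ≤ 2 * x c := by
      intro c hcU
      unfold fmu
      rw [if_pos hcU, if_pos rfl, div_le_iff₀ (by linarith [hw _ hcU])]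
      nlinarith [hw _ hcU, hnn c]
    calc _ ≤ (2 * x c) * (2 * x c') :=
          mul_le_mul (hb c h2) (hb c' h3) (hμ.nonneg _ _) (by linarith [hnn c])
      _ = _ := by ring
  · have e : psPr (fmu π x U φ)
        (fun ω => H.Adj c c' ∧ π c ∈ U ∧ π c' ∈ U ∧ ω (π c) = c ∧ ω (π c') = c') = 0 := by
      unfold psPr
      refine Eq.trans ?_ (psEx_const hμ 0)
      congr 1
      funext ω
      rw [if_neg]
      rintro ⟨a, b, d, _⟩
      exact h ⟨a, b, d⟩
    rw [e]
    split_ifs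
    · exact mul_nonneg (by norm_num) (mul_nonneg (hnn c) (hnn c'))
    · exact le_rfl

theorem final_color (hc : Cov π G H Δ k) (U : Set V) (φ : V → C) (hnn : ∀ c, 0 ≤ x c)
    (hw : ∀ v ∈ U, 1 / 2 ≤ wW π x v) (hQ : ∀ v, wQ π H x v ≤ 1 / 64) :
    ∃ ψ : V → C, (∀ v, v ∉ U → ψ v = φ v) ∧ (∀ v ∈ U, π (ψ v) = v ∧ x (ψ v) ≠ 0) ∧
      ∀ u ∈ U, ∀ v ∈ U, ¬ H.Adj (ψ u) (ψ v) := by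
  have hμ := fmu_prob U φ hnn hw
  set f : C × C → ℝ := fun j => if H.Adj j.1 j.2 then 4 * (x j.1 * x j.2) else 0 with hf
  have hf0 : ∀ j, 0 ≤ f j := by
    intro j
    simp only [hf]
    split_ifs
    · exact mul_nonneg (by norm_num) (mul_nonneg (hnn _) (hnn _))
    · exact le_rfl
  have s1 : ∀ a, ∑ j : C × C, (if π j.1 = a then f j else 0) = 4 * wQ π H x a := by
    intro a
    rw [Fintype.sum_prod_type]
    simp only [wQ, wA, fib, nb, Finset.mul_sum, Finset.sum_filter, hf]
    refine Finset.sum_congr rfl fun c _ => ?_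
    by_cases h : π c = a <;> simp [h, Finset.mul_sum]
  have s2 : ∀ a, ∑ j : C × C, (if π j.2 = a then f j else 0) = 4 * wQ π H x a := by
    intro a
    rw [← s1 a, ← Equiv.sum_comp (Equiv.prodComm C C)]
    refine Finset.sum_congr rfl fun j _ => ?_
    simp [hf, SimpleGraph.adj_comm, mul_comm]
  obtain ⟨ω, hω, hA⟩ := ps_LLL hμ (J := C × C)
    (fun j ω => H.Adj j.1 j.2 ∧ π j.1 ∈ U ∧ π j.2 ∈ U ∧ ω (π j.1) = j.1 ∧ ω (π j.2) = j.2)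
    (fun j => {π j.1, π j.2})
    (by
      intro j ω ω' h
      simp only [h (π j.1) (by simp), h (π j.2) (by simp)])
    (by
      intro j
      refine le_trans (Finset.sum_le_sum fun j' _ => fmu_pair hc U φ hnn hw j'.1 j'.2) ?_
      rw [Finset.sum_filter]
      calc _ ≤ ∑ j' : C × C, (((if π j'.1 = π j.1 then f j' else 0) +
              (if π j'.2 = π j.1 then f j' else 0)) + ((if π j'.1 = π j.2 then f j' else 0) +
              (if π j'.2 = π j.2 then f j' else 0))) := by
            refine Finset.sum_le_sum fun j' _ => ?_
            have h0 := hf0 j'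
            have hor : (j' = j ∨ ¬ Disjoint ({π j.1, π j.2} : Set V) {π j'.1, π j'.2}) →
                π j'.1 = π j.1 ∨ π j'.2 = π j.1 ∨ π j'.1 = π j.2 ∨ π j'.2 = π j.2 := by
              intro h
              rcases h with h | h
              · left; rw [h]
              · rw [Set.not_disjoint_iff] at h
                obtain ⟨a, ha, hb⟩ := h
                simp only [Set.mem_insert_iff, Set.mem_singleton_iff] at ha hb
                rcases ha with ha | ha <;> rcases hb with hb | hb <;> rw [← ha, ← hb] <;> tauto
            have hval : (if H.Adj j'.1 j'.2 then 4 * (x j'.1 * x j'.2) else 0) = f j' := rfl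
            rw [hval]
            have nn1 : ∀ P : Prop, 0 ≤ if P then f j' else 0 := by
              intro P; split_ifs <;> [exact h0; exact le_rfl]
            have n1 := nn1 (π j'.1 = π j.1)
            have n2 := nn1 (π j'.2 = π j.1)
            have n3 := nn1 (π j'.1 = π j.2)
            have n4 := nn1 (π j'.2 = π j.2)
            by_cases h : (j' = j ∨ ¬ Disjoint ({π j.1, π j.2} : Set V) {π j'.1, π j'.2})
            · rw [if_pos h]
              rcases hor h with h | h | h | h
              · rw [if_pos h] at n1 ⊢; linarith
              · rw [if_pos h] at n2 ⊢; linarith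
              · rw [if_pos h] at n3 ⊢; linarith
              · rw [if_pos h] at n4 ⊢; linarith
            · rw [if_neg h]; linarith
        _ ≤ 1 / 4 := by
            simp only [Finset.sum_add_distrib, s1, s2]
            linarith [hQ (π j.1), hQ (π j.2)])
  have hpos : ∀ v, fmu π x U φ v (ω v) ≠ 0 := by
    intro v h
    rw [Finset.prod_eq_zero (Finset.mem_univ v) h] at hω
    exact lt_irrefl _ hω
  have hU : ∀ v ∈ U, π (ω v) = v ∧ x (ω v) ≠ 0 := by
    intro v hv
    have h := hpos v
    unfold fmu at h
    rw [if_pos hv] at h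
    by_cases h2 : π (ω v) = v
    · rw [if_pos h2] at h
      exact ⟨h2, fun h3 => h (by simp [h3])⟩
    · rw [if_neg h2] at h; exact absurd rfl h
  refine ⟨ω, fun v hv => ?_, hU, fun u hu v hv hadj => ?_⟩
  · have h := hpos v
    unfold fmu at h
    rw [if_neg hv] at h
    by_contra h2
    rw [if_neg h2] at h
    exact h rfl
  · apply hA (ω u, ω v)
    have h1 := (hU u hu).1
    have h2 := (hU v hv).1
    exact ⟨hadj, by simpa [h1] using hu, by simpa [h2] using hv, by simp [h1], by simp [h2]⟩

end Final

section Iterate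

variable {V C : Type} [Fintype V] [Fintype C]
variable {π : C → V} {G : SimpleGraph V} {H : SimpleGraph C} {Δ : ℕ} {k : ℝ}
  {x : C → ℝ} {η p M l Qm : ℝ} {T : Finset C} {U : Set V} {φ : V → C}

/-- Partial coloring state. -/
structure St (π : C → V) (H : SimpleGraph C) (T : Finset C) (l : ℝ) (U : Set V) (φ : V → C)
    (x : C → ℝ) : Prop where
  nn : ∀ c, 0 ≤ x c
  low : ∀ c, x c ≠ 0 → 1 ≤ l * x c
  memT : ∀ c, x c ≠ 0 → c ∈ T
  memU : ∀ c, x c ≠ 0 → π c ∈ U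
  colT : ∀ v, v ∉ U → φ v ∈ T
  colπ : ∀ v, v ∉ U → π (φ v) = v
  pr : ∀ u v, u ∉ U → v ∉ U → ¬ H.Adj (φ u) (φ v)
  blk : ∀ v, v ∉ U → ∀ c, H.Adj (φ v) c → x c = 0

/-- Quantitative invariant. -/
structure Iv (π : C → V) (H : SimpleGraph C) (l Lam M : ℝ) (U : Set V) (x : C → ℝ)
    (wB QB JB : ℝ) : Prop where
  w : ∀ v ∈ U, wW π x v ≤ wB
  Q : ∀ v ∈ U, wQ π H x v ≤ QB
  J : ∀ v ∈ U, JB ≤ wJ π l Lam x v - wQ π H x v / M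

lemma St.A0 (h : St π H T l U φ x) (c : C) : 0 ≤ wA H x c := Finset.sum_nonneg fun c _ => h.nn c

lemma St.Q0 (h : St π H T l U φ x) (v : V) : 0 ≤ wQ π H x v :=
  Finset.sum_nonneg fun c _ => mul_nonneg (h.nn c) (h.A0 c)

lemma St.zero (h : St π H T l U φ x) {v : V} (hv : v ∉ U) (c : C) (hc : c ∈ fib π v) : x c = 0 := by
  by_contra h0
  rw [mem_fib] at hc
  exact hv (hc ▸ h.memU c h0)

lemma St.J_le_W (h : St π H T l U φ x) {Lam : ℝ} (hL : 0 < Lam) (v : V) :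
    wJ π l Lam x v ≤ wW π x v := by
  refine Finset.sum_le_sum fun c _ => ?_
  by_cases h0 : x c = 0
  · simp [h0]
  · have := div_nonneg (Real.log_nonneg (h.low c h0)) hL.le
    nlinarith [h.nn c]

lemma St.W_half (h : St π H T l U φ x) {Lam wB QB JB : ℝ} (hL : 0 < Lam) (hM : 0 < M)
    (hI : Iv π H l Lam M U x wB QB JB) (hJ : 1 / 2 ≤ JB) (v : V) (hv : v ∈ U) :
    1 / 2 ≤ wW π x v := by
  have h1 := h.J_le_W hL v
  have h2 := hI.J v hv
  have h3 := div_nonneg (h.Q0 v) hM.le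
  linarith

/-- Removing heavy or crowded colors. -/
lemma St.normalize (h : St π H T l U φ x) {Lam wB QB JB : ℝ} (hp : 0 < p) (hl : 0 < l)
    (hLam : Lam = Real.log (l * p)) (hL : 0 < Lam) (hM : 0 < M)
    (hI : Iv π H l Lam M U x wB QB JB) :
    ∃ y, St π H T l U φ y ∧ Iv π H l Lam M U y wB QB JB ∧ (∀ c, y c ≤ p) ∧
      ∀ c, y c ≠ 0 → wA H y c ≤ M := by
  set y : C → ℝ := fun c => if x c ≤ p ∧ wA H x c ≤ M then x c else 0 with hy
  have hyx : ∀ c, y c ≤ x c := by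
    intro c; simp only [hy]; split_ifs
    · exact le_rfl
    · exact h.nn c
  have hy0 : ∀ c, 0 ≤ y c := by
    intro c; simp only [hy]; split_ifs
    · exact h.nn c
    · exact le_rfl
  have hyne : ∀ c, y c ≠ 0 → y c = x c ∧ x c ≤ p ∧ wA H x c ≤ M := by
    intro c hc
    simp only [hy] at hc ⊢
    split_ifs at hc ⊢ with h1
    · exact ⟨rfl, h1⟩
    · exact absurd rfl hc
  have hxne : ∀ c, y c ≠ 0 → x c ≠ 0 := fun c hc h0 => hc ((hyne c hc).1.trans h0)
  have hAy : ∀ c, wA H y c ≤ wA H x c := fun c => Finset.sum_le_sum fun c _ => hyx c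
  have hyA0 : ∀ c, 0 ≤ wA H y c := fun c => Finset.sum_nonneg fun c _ => hy0 c
  refine ⟨y, ⟨hy0, ?_, fun c hc => h.memT c (hxne c hc), fun c hc => h.memU c (hxne c hc),
    h.colT, h.colπ, h.pr, ?_⟩, ⟨?_, ?_, ?_⟩, ?_, ?_⟩
  · intro c hc
    rw [(hyne c hc).1]; exact h.low c (hxne c hc)
  · intro v hv c hc
    have := h.blk v hv c hc
    have := hyx c
    have := hy0 c
    linarith
  · intro v hv
    exact (Finset.sum_le_sum fun c _ => hyx c).trans (hI.w v hv)
  · intro v hv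
    exact (Finset.sum_le_sum fun c _ => mul_le_mul (hyx c) (hAy c) (hyA0 c) (h.nn c)).trans
      (hI.Q v hv)
  · intro v hv
    refine (hI.J v hv).trans ?_
    unfold wJ wQ
    rw [Finset.sum_div, Finset.sum_div, ← Finset.sum_sub_distrib, ← Finset.sum_sub_distrib]
    refine Finset.sum_le_sum fun c _ => ?_
    by_cases hg : x c ≤ p ∧ wA H x c ≤ M
    · have e : y c = x c := by simp only [hy, if_pos hg]
      rw [e]
      have := div_le_div_of_nonneg_right (mul_le_mul_of_nonneg_left (hAy c) (h.nn c)) hM.le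
      linarith
    · have e : y c = 0 := by simp only [hy, if_neg hg]
      rw [e]
      simp only [zero_mul, zero_div, sub_zero]
      have hxc := h.nn c
      by_cases h0 : x c = 0
      · simp [h0]
      by_cases hxp : x c ≤ p
      · have hAM : M < wA H x c := by
          by_contra h2; exact hg ⟨hxp, not_lt.1 h2⟩
        have h1 : x c ≤ x c * wA H x c / M := by
          rw [le_div_iff₀ hM]; exact mul_le_mul_of_nonneg_left hAM.le hxc
        have h2 := div_nonneg (Real.log_nonneg (h.low c h0)) hL.le
        nlinarith
      · push Not at hxp
        have h1 : Lam ≤ Real.log (l * x c) := by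
          rw [hLam]
          exact Real.log_le_log (mul_pos hl hp) (mul_le_mul_of_nonneg_left hxp.le hl.le)
        have h2 : 1 ≤ Real.log (l * x c) / Lam := by rwa [le_div_iff₀ hL, one_mul]
        have h3 : 0 ≤ x c * wA H x c / M := div_nonneg (mul_nonneg hxc (h.A0 c)) hM.le
        nlinarith
  · intro c
    by_cases h0 : y c = 0
    · rw [h0]; exact hp.le
    · rw [(hyne c h0).1]; exact (hyne c h0).2.1
  · intro c hc
    exact (hAy c).trans (hyne c hc).2.2

/-- One full iteration. -/
lemma St.step (h : St π H T l U φ x) (hc : Cov π G H Δ k) {Lam wB QB JB lam t κ : ℝ}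
    (hn : StepNum Δ η p M l Qm Lam lam t κ) (hk : 0 ≤ k) (hη0 : 0 < η) (hη1 : η ≤ 1 / 8)
    (hp1 : p ≤ 1) (hM1 : 1 ≤ M) (hηM : η * M ≤ 1 / 2) (hQm : 0 ≤ Qm)
    (hI : Iv π H l Lam M U x wB QB JB) (hwB : wB ≤ 2) (hQB : QB ≤ Qm) (hJB : 1 / 2 ≤ JB)
    {e : ℝ} (he : (η * p + η ^ 2) * Qm + 16 * η * k * p ^ 2 + 2 * t ≤ e) :
    ∃ U' φ' x', St π H T l U' φ' x' ∧ Iv π H l Lam M U' x' (wB + t) ((1 - η / 2) * QB + e)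
      (JB - (1 + 2 * η) * η * QB / Lam - e / M - t) := by
  have hL : 0 < Lam := by linarith [hn.hLam1]
  have hM : 0 < M := by linarith
  obtain ⟨y, hS, hI, hyp, hyA⟩ := h.normalize hn.hp hn.hl hn.hLam hL hM hI
  have hwz : ∀ v, v ∉ U → wW π y v = 0 := fun v hv => Finset.sum_eq_zero fun c hc => hS.zero hv c hc
  have hqz : ∀ v, v ∉ U → wQ π H y v = 0 := fun v hv => Finset.sum_eq_zero fun c hc => by
    rw [hS.zero hv c hc, zero_mul]
  have hW : Wt π H y η p M l Qm := by
    refine ⟨hS.nn, hyp, hS.low, hyA, fun v => ?_, fun c hc => ?_, fun v => ?_, hη0, hη1, hp1, hM1,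
      hηM⟩
    · by_cases hv : v ∈ U
      · exact (hI.w v hv).trans hwB
      · rw [hwz v hv]; norm_num
    · exact hS.W_half hL hM hI hJB _ (hS.memU c hc)
    · by_cases hv : v ∈ U
      · exact (hI.Q v hv).trans hQB
      · rw [hqz v hv]; exact hQm
  obtain ⟨b, hb, hv⟩ := nibble_step hc hW hn hk
  set U' : Set V := {v | v ∈ U ∧ ¬ colored π H b v} with hU'
  have hch : ∀ v, ∃ c, colored π H b v → (π c = v ∧ b c = true ∧ ∀ c' ∈ nb H c, b c' = false) := by
    intro v
    by_cases hcv : colored π H b v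
    · obtain ⟨c, h1⟩ := hcv
      exact ⟨c, fun _ => h1⟩
    · exact ⟨φ v, fun h => absurd h hcv⟩
  choose g hg using hch
  set φ' : V → C := fun v => if colored π H b v then g v else φ v with hφ'
  set y' : C → ℝ := fun c => sc H η y c * nop (nb H c) b *
    (if colored π H b (π c) then 0 else 1) with hy'
  have hnop : ∀ c, nop (nb H c) b ≠ 0 → ∀ c' ∈ nb H c, b c' = false := by
    intro c hc
    rw [nop_eq] at hc
    by_contra h2
    rw [if_neg h2] at hc
    exact hc rfl
  have hne : ∀ c, y' c ≠ 0 → y c ≠ 0 ∧ (∀ c' ∈ nb H c, b c' = false) ∧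
      ¬ colored π H b (π c) ∧ y' c = sc H η y c := by
    intro c hc
    have h1 : sc H η y c ≠ 0 := fun h0 => hc (by simp [hy', h0])
    have h2 : nop (nb H c) b ≠ 0 := fun h0 => hc (by simp [hy', h0])
    have h3 : ¬ colored π H b (π c) := fun h0 => hc (by simp [hy', h0])
    have h4 := hnop c h2
    refine ⟨fun h0 => h1 (hW.sc_zero c h0), h4, h3, ?_⟩
    simp only [hy', if_neg h3, nop_eq, if_pos h4, mul_one]
  have hcases : ∀ v, v ∉ U' → colored π H b v ∨ (v ∉ U ∧ ¬ colored π H b v) := by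
    intro v hv
    by_cases h1 : colored π H b v
    · exact Or.inl h1
    · right; exact ⟨fun h2 => hv ⟨h2, h1⟩, h1⟩
  have hgU : ∀ v, colored π H b v → y (g v) ≠ 0 := fun v h1 => hb _ (hg v h1).2.1
  refine ⟨U', φ', y', ⟨?_, ?_, ?_, ?_, ?_, ?_, ?_, ?_⟩, ?_⟩
  · intro c
    refine mul_nonneg (mul_nonneg (hW.sc_nn c) (nop_nonneg _ _)) ?_
    split_ifs <;> norm_num
  · intro c hc
    obtain ⟨h1, h2, h3, h4⟩ := hne c hc
    rw [h4]
    exact (hS.low c h1).trans (mul_le_mul_of_nonneg_left (hW.sc_ge c) hn.hl.le)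
  · intro c hc; exact hS.memT c (hne c hc).1
  · intro c hc; exact ⟨hS.memU c (hne c hc).1, (hne c hc).2.2.1⟩
  · intro v hv
    rcases hcases v hv with h1 | ⟨h1, h2⟩
    · simp only [hφ', if_pos h1]; exact hS.memT _ (hgU v h1)
    · simp only [hφ', if_neg h2]; exact hS.colT v h1
  · intro v hv
    rcases hcases v hv with h1 | ⟨h1, h2⟩
    · simp only [hφ', if_pos h1]; exact (hg v h1).1
    · simp only [hφ', if_neg h2]; exact hS.colπ v h1
  · intro u v hu hv hadj
    rcases hcases u hu with h1 | ⟨h1, h2⟩ <;> rcases hcases v hv with h3 | ⟨h3, h4⟩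
    · simp only [hφ', if_pos h1, if_pos h3] at hadj
      have := (hg u h1).2.2 (g v) (mem_nb.2 hadj)
      rw [(hg v h3).2.1] at this
      cases this
    · simp only [hφ', if_pos h1, if_neg h4] at hadj
      exact hgU u h1 (hS.blk v h3 _ hadj.symm)
    · simp only [hφ', if_neg h2, if_pos h3] at hadj
      exact hgU v h3 (hS.blk u h1 _ hadj)
    · simp only [hφ', if_neg h2, if_neg h4] at hadj
      exact hS.pr u v h1 h3 hadj
  · intro v hv c hadj
    by_contra h0
    obtain ⟨k1, k2, k3, k4⟩ := hne c h0
    rcases hcases v hv with h1 | ⟨h1, h2⟩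
    · simp only [hφ', if_pos h1] at hadj
      have := k2 (g v) (mem_nb.2 hadj.symm)
      rw [(hg v h1).2.1] at this
      cases this
    · simp only [hφ', if_neg h2] at hadj
      exact k1 (hS.blk v h1 c hadj)
  · have hQ' : ∀ v ∈ U', wQ π H y' v ≤ (1 - η / 2) * wQ π H y v + e := by
      intro v hvU
      have h3 := (hv v).2.2
      have e1 : wQ π H y' v = ∑ z ∈ prs π H v, sc H η y z.1 * sc H η y z.2 *
          (nop (nb H z.1) b * nop (nb H z.2) b * (if colored π H b (π z.2) then 0 else 1)) := by
        rw [← sum_prs_x]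
        refine Finset.sum_congr rfl fun z hz => ?_
        have hz1 : π z.1 = v := by
          have := hz
          simp only [prs, Finset.mem_filter] at this
          tauto
        simp only [hy', hz1, if_neg hvU.2]
        ring
      rw [e1]
      linarith
    refine ⟨fun v hvU => ?_, fun v hvU => ?_, fun v hvU => ?_⟩
    · have h1 := (hv v).1
      have e1 : wW π y' v = ∑ c ∈ fib π v, sc H η y c * nop (nb H c) b := by
        refine Finset.sum_congr rfl fun c hc => ?_
        rw [mem_fib] at hc
        simp only [hy', hc, if_neg hvU.2, mul_one]
      rw [e1]
      linarith [hI.w v hvU.1]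
    · have h1 := hQ' v hvU
      have h2 := hI.Q v hvU.1
      nlinarith
    · have h1 := hQ' v hvU
      have h2 := hI.Q v hvU.1
      have h3 := (hv v).2.1
      have h4 := hI.J v hvU.1
      have e1 : wJ π l Lam y' v = ∑ c ∈ fib π v,
          sc H η y c * (1 - Real.log (l * sc H η y c) / Lam) * nop (nb H c) b := by
        refine Finset.sum_congr rfl fun c hc => ?_
        rw [mem_fib] at hc
        simp only [hy', hc, if_neg hvU.2, mul_one]
        rw [nop_eq]
        split_ifs <;> simp
      rw [← e1] at h3
      have h5 : wQ π H y' v / M ≤ wQ π H y v / M + e / M := by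
        rw [← add_div]
        refine div_le_div_of_nonneg_right ?_ hM.le
        nlinarith [hS.Q0 v]
      have h6 : (1 + 2 * η) * η * wQ π H y v / Lam ≤ (1 + 2 * η) * η * QB / Lam := by
        refine div_le_div_of_nonneg_right ?_ hL.le
        exact mul_le_mul_of_nonneg_left h2 (by positivity)
      linarith

theorem nibble_all (hc : Cov π G H Δ k) {Lam lam t κ : ℝ} (ℓ : ℕ) (T : Finset C) (r0 ξ : ℝ) (N : ℕ)
    (φ0 : V → C)
    (hT : ∀ v, (univ.filter (fun c => c ∈ T ∧ π c = v)).card = ℓ)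
    (hD : ∀ c ∈ T, ((univ.filter (fun c' => c' ∈ T ∧ H.Adj c c')).card : ℝ) ≤ r0 * ℓ)
    (hr0 : 0 ≤ r0) (hξ : 0 ≤ ξ)
    (hn : StepNum Δ η p M ℓ (r0 + 2 * ξ) Lam lam t κ) (hk : 0 ≤ k) (hη0 : 0 < η) (hη1 : η ≤ 1 / 8)
    (hp1 : p ≤ 1) (hM1 : 1 ≤ M) (hηM : η * M ≤ 1 / 2) (ht : t ≤ η * ξ / 10) (ht0 : 0 ≤ t)
    (he : (η * p + η ^ 2) * (r0 + 2 * ξ) + 16 * η * k * p ^ 2 + 2 * t ≤ η * ξ)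
    (hN : N * (η * ξ) ≤ 1)
    (hJ : 2 * (1 + 2 * η) * r0 / Lam + r0 / M + 4 * (N * (η * ξ)) ≤ 1 / 2)
    (hQ : r0 * (1 - η / 2) ^ N + 2 * ξ ≤ 1 / 64) :
    ∃ φ : V → C, (∀ v, π (φ v) = v) ∧ (∀ v, φ v ∈ T) ∧ ∀ u v, ¬ H.Adj (φ u) (φ v) := by
  have hl := hn.hl
  have hL : 0 < Lam := by linarith [hn.hLam1]
  have hM : 0 < M := by linarith
  set a : ℝ := 1 - η / 2 with ha
  have ha0 : 0 ≤ a := by rw [ha]; linarith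
  have ha1 : a ≤ 1 := by rw [ha]; linarith
  set Qi : ℕ → ℝ := fun i => r0 * a ^ i + 2 * ξ * (1 - a ^ i) with hQi
  have hai : ∀ i, 0 ≤ a ^ i ∧ a ^ i ≤ 1 := fun i => ⟨pow_nonneg ha0 i, pow_le_one₀ ha0 ha1⟩
  have hQi0 : ∀ i, 0 ≤ Qi i := fun i => by
    have := hai i
    have h1 := mul_nonneg hr0 this.1
    have h2 := mul_nonneg hξ (sub_nonneg.2 this.2)
    simp only [hQi]; linarith
  have hQim : ∀ i, Qi i ≤ r0 + 2 * ξ := fun i => by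
    have := hai i
    have h1 := mul_nonneg hr0 (sub_nonneg.2 this.2)
    have h2 := mul_nonneg hξ this.1
    simp only [hQi]; linarith
  have hrec : ∀ i, Qi (i + 1) = (1 - η / 2) * Qi i + η * ξ := fun i => by
    simp only [hQi, pow_succ, ha]; ring
  set Ji : ℕ → ℝ := fun i => 1 - r0 / M - 2 * (1 + 2 * η) * (r0 - Qi i) / Lam - 4 * (i * (η * ξ))
    with hJi
  have hJi2 : ∀ i, i ≤ N → 1 / 2 ≤ Ji i := by
    intro i hi
    simp only [hJi]
    have h1 : 2 * (1 + 2 * η) * (r0 - Qi i) / Lam ≤ 2 * (1 + 2 * η) * r0 / Lam := by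
      refine div_le_div_of_nonneg_right ?_ hL.le
      exact mul_le_mul_of_nonneg_left (by linarith [hQi0 i]) (by positivity)
    have h2 : (i : ℝ) * (η * ξ) ≤ N * (η * ξ) :=
      mul_le_mul_of_nonneg_right (by exact_mod_cast hi) (by positivity)
    linarith
  have main : ∀ i, i ≤ N → ∃ U φ x, St π H T ℓ U φ x ∧
      Iv π H ℓ Lam M U x (1 + i * t) (Qi i) (Ji i) := by
    intro i
    induction i with
    | zero =>
      intro _
      set x : C → ℝ := fun c => if c ∈ T then 1 / (ℓ : ℝ) else 0 with hx
      have hlx : ∀ c, x c ≠ 0 → (ℓ : ℝ) * x c = 1 ∧ c ∈ T := by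
        intro c hc
        simp only [hx] at hc ⊢
        split_ifs at hc ⊢ with h1
        · exact ⟨mul_one_div_cancel hl.ne', h1⟩
        · exact absurd rfl hc
      have hx0 : ∀ c, 0 ≤ x c := by
        intro c; simp only [hx]; split_ifs <;> positivity
      have hw : ∀ v, wW π x v = 1 := by
        intro v
        have : wW π x v = ∑ c ∈ univ.filter (fun c => c ∈ T ∧ π c = v), 1 / (ℓ : ℝ) := by
          unfold wW fib
          rw [Finset.sum_filter, Finset.sum_filter]
          refine Finset.sum_congr rfl fun c _ => ?_
          by_cases h1 : π c = v <;> by_cases h2 : c ∈ T <;> simp [hx, h1, h2]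
        rw [this, Finset.sum_const, hT v, nsmul_eq_mul, mul_one_div_cancel hl.ne']
      have hA : ∀ c, c ∈ T → wA H x c ≤ r0 := by
        intro c hcT
        have : wA H x c = ∑ c' ∈ univ.filter (fun c' => c' ∈ T ∧ H.Adj c c'), 1 / (ℓ : ℝ) := by
          unfold wA nb
          rw [Finset.sum_filter, Finset.sum_filter]
          refine Finset.sum_congr rfl fun c' _ => ?_
          by_cases h1 : H.Adj c c' <;> by_cases h2 : c' ∈ T <;> simp [hx, h1, h2]
        rw [this, Finset.sum_const, nsmul_eq_mul, mul_one_div, div_le_iff₀ hl]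
        exact hD c hcT
      have hq : ∀ v, wQ π H x v ≤ r0 := by
        intro v
        calc wQ π H x v ≤ ∑ c ∈ fib π v, x c * r0 := by
              refine Finset.sum_le_sum fun c _ => ?_
              by_cases h0 : x c = 0
              · simp [h0]
              · exact mul_le_mul_of_nonneg_left (hA c (hlx c h0).2) (hx0 c)
          _ = wW π x v * r0 := by rw [wW, Finset.sum_mul]
          _ = r0 := by rw [hw, one_mul]
      have hj : ∀ v, wJ π ℓ Lam x v = 1 := by
        intro v
        rw [← hw v]
        refine Finset.sum_congr rfl fun c _ => ?_
        by_cases h0 : x c = 0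
        · simp [h0]
        · rw [(hlx c h0).1]; simp
      refine ⟨Set.univ, φ0, x, ⟨hx0, fun c hc => (hlx c hc).1.ge, fun c hc => (hlx c hc).2,
        fun _ _ => trivial, fun v hv => absurd trivial hv, fun v hv => absurd trivial hv,
        fun u v hu => absurd trivial hu, fun v hv => absurd trivial hv⟩, ⟨?_, ?_, ?_⟩⟩
      · intro v _; rw [hw]; simp
      · intro v _; simp only [hQi, pow_zero]; linarith [hq v]
      · intro v _
        rw [hj]
        simp only [hJi, hQi, pow_zero]
        have := div_le_div_of_nonneg_right (hq v) hM.le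
        have e : 2 * (1 + 2 * η) * (r0 - (r0 * 1 + 2 * ξ * (1 - 1))) / Lam = 0 := by
          rw [show r0 - (r0 * 1 + 2 * ξ * (1 - 1)) = 0 by ring]; simp
        rw [e]
        push_cast
        linarith
    | succ i ih =>
      intro hi
      obtain ⟨U, φ, x, hS, hI⟩ := ih (by omega)
      have hit : (i : ℝ) * t ≤ 1 := by
        have h1 : (i : ℝ) ≤ N := by exact_mod_cast (by omega : i ≤ N)
        have h2 : (i : ℝ) * t ≤ N * (η * ξ) :=
          mul_le_mul h1 (by nlinarith [mul_nonneg hη0.le hξ]) ht0 (by positivity)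
        linarith
      obtain ⟨U', φ', x', hS', hI'⟩ := hS.step hc hn hk hη0 hη1 hp1 hM1 hηM
        (by linarith) hI (by linarith) (hQim i) (hJi2 i (by omega)) he
      refine ⟨U', φ', x', hS', ⟨fun v hv => ?_, fun v hv => ?_, fun v hv => ?_⟩⟩
      · refine (hI'.w v hv).trans (le_of_eq ?_)
        push_cast; ring
      · rw [hrec]; exact hI'.Q v hv
      · refine le_trans ?_ (hI'.J v hv)
        have hb := mul_nonneg hη0.le hξ
        have e1 : η * Qi i = 2 * (Qi i - Qi (i + 1)) + 2 * (η * ξ) := by rw [hrec]; ring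
        have e2 : (1 + 2 * η) * η * Qi i / Lam =
            2 * (1 + 2 * η) * (Qi i - Qi (i + 1)) / Lam + 2 * (1 + 2 * η) * (η * ξ) / Lam := by
          rw [mul_assoc, e1]; ring
        have e3 : 2 * (1 + 2 * η) * (η * ξ) / Lam ≤ 2.5 * (η * ξ) := by
          rw [div_le_iff₀ hL]
          have := mul_le_mul_of_nonneg_left hn.hLam1 hb
          nlinarith
        have e4 : η * ξ / M ≤ η * ξ := div_le_self hb hM1
        have e5 : 2 * (1 + 2 * η) * (r0 - Qi (i + 1)) / Lam =
            2 * (1 + 2 * η) * (r0 - Qi i) / Lam + 2 * (1 + 2 * η) * (Qi i - Qi (i + 1)) / Lam := by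
          ring
        simp only [hJi]
        rw [e2, e5]
        push_cast
        linarith
  obtain ⟨U, φ, x, hS, hI⟩ := main N le_rfl
  have hQN : Qi N ≤ 1 / 64 := by
    have := hai N
    have h2 := mul_nonneg hξ this.1
    simp only [hQi]; linarith
  obtain ⟨ψ, h1, h2, h3⟩ := final_color hc U φ hS.nn
    (hS.W_half hL hM hI (hJi2 N le_rfl)) (fun v => by
      by_cases hv : v ∈ U
      · exact (hI.Q v hv).trans hQN
      · have : wQ π H x v = 0 := Finset.sum_eq_zero fun c hc => by rw [hS.zero hv c hc, zero_mul]
        rw [this]; norm_num)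
  refine ⟨ψ, fun v => ?_, fun v => ?_, fun u v hadj => ?_⟩
  · by_cases hv : v ∈ U
    · exact (h2 v hv).1
    · rw [h1 v hv]; exact hS.colπ v hv
  · by_cases hv : v ∈ U
    · exact hS.memT _ (h2 v hv).2
    · rw [h1 v hv]; exact hS.colT v hv
  · by_cases hu : u ∈ U <;> by_cases hv : v ∈ U
    · exact h3 u hu v hv hadj
    · rw [h1 v hv] at hadj
      exact (h2 u hu).2 (hS.blk v hv _ hadj.symm)
    · rw [h1 u hu] at hadj
      exact (h2 v hv).2 (hS.blk u hu _ hadj)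
    · rw [h1 u hu, h1 v hv] at hadj
      exact hS.pr u v hu hv hadj

end Iterate

section Numerics

lemma num_pow {z : ℝ} (h0 : 0 ≤ z) (h1 : z ≤ 1 / 2000) (a m : ℕ) :
    z ^ (m + a) ≤ (1 / 2000) ^ a * z ^ m := by
  rw [pow_add, mul_comm]
  exact mul_le_mul_of_nonneg_right (pow_le_pow_left₀ h0 h1 a) (pow_nonneg h0 m)

lemma num_step (Δ : ℕ) (y b k r0 Lam : ℝ) (ℓ : ℕ) (hΔ : 1 ≤ Δ) (hy : y = Real.log Δ)
    (hy0 : 2000 ≤ y) (hE : 20 * y ^ 29 ≤ Real.exp (b * y)) (hk : 1 ≤ k) (hℓ0 : 0 < ℓ)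
    (hℓ : (ℓ : ℝ) ≤ (Δ : ℝ) ^ 2) (hr0 : 0 ≤ r0) (hr : r0 ≤ y / 2)
    (hLam : Lam = Real.log (ℓ * (Real.exp (-(b * y)) / √k))) (hLam1 : 1 ≤ Lam) :
    StepNum Δ (y⁻¹ ^ 5) (Real.exp (-(b * y)) / √k) (y ^ 2) ℓ (r0 + 2 * y⁻¹ ^ 2) Lam
      (y⁻¹ ^ 20 / (Real.exp (-(b * y)) / √k)) (y⁻¹ ^ 7 / 10) (y ^ 2) := by
  set z := y⁻¹ with hz
  have hyp : 0 < y := by linarith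
  have hzp : 0 < z := inv_pos.2 hyp
  have hyz : y * z = 1 := mul_inv_cancel₀ hyp.ne'
  have hz1 : z ≤ 1 / 2000 := by
    rw [hz, inv_eq_one_div]; exact one_div_le_one_div_of_le (by norm_num) hy0
  have hk1 : 1 ≤ √k := Real.one_le_sqrt.2 hk
  set p := Real.exp (-(b * y)) / √k with hp
  have hp0 : 0 < p := div_pos (Real.exp_pos _) (by linarith)
  have hlp : z ^ 20 / p * p = z ^ 20 := div_mul_cancel₀ _ hp0.ne'
  have hQm : r0 + 2 * z ^ 2 ≤ y := by
    have : z ^ 2 ≤ 1 := pow_le_one₀ hzp.le (by linarith)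
    linarith
  have hQm0 : 0 ≤ r0 + 2 * z ^ 2 := by positivity
  have hpw : ∀ m, z ^ m ≤ 1 := fun m => pow_le_one₀ hzp.le (by linarith)
  have hpos : ∀ m, 0 ≤ z ^ m := fun m => pow_nonneg hzp.le m
  have P := fun a m => num_pow hzp.le hz1 a m
  refine ⟨hp0, by exact_mod_cast hℓ0, hLam, hLam1, by positivity, by positivity, ?_, ?_, ?_, ?_,
    ?_, ?_⟩
  · have : z ^ 20 / p * (16 * p * y ^ 2) = 16 * z ^ 18 := by
      calc _ = 16 * (z ^ 20 / p * p) * y ^ 2 := by ring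
        _ = 16 * z ^ 18 * (y * z) ^ 2 := by rw [hlp]; ring
        _ = _ := by rw [hyz]; ring
    rw [this]
    have := P 18 0
    norm_num at this ⊢
    linarith
  · have e1 : z ^ 20 / p * (16 * p * y ^ 2) = 16 * z ^ 18 := by
      calc _ = 16 * (z ^ 20 / p * p) * y ^ 2 := by ring
        _ = 16 * z ^ 18 * (y * z) ^ 2 := by rw [hlp]; ring
        _ = _ := by rw [hyz]; ring
    rw [e1]
    calc _ ≤ 16 * z ^ 18 * (16 * z ^ 5 * y * y ^ 2) := by gcongr
      _ = 256 * z ^ 20 * (y * z) ^ 3 := by ring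
      _ = 256 * z ^ (7 + 13) := by rw [hyz]; ring
      _ ≤ 256 * ((1 / 2000) ^ 13 * z ^ 7) := by linarith [P 13 7]
      _ ≤ _ := by have := hpos 7; norm_num; linarith
  · have : 4 * (z ^ 20 / p) * (8 * p * y ^ 2) = 32 * z ^ 18 := by
      calc _ = 32 * (z ^ 20 / p * p) * y ^ 2 := by ring
        _ = 32 * z ^ 18 * (y * z) ^ 2 := by rw [hlp]; ring
        _ = _ := by rw [hyz]; ring
    rw [this]
    have := P 18 0
    norm_num at this ⊢
    linarith
  · have : 8 * (z ^ 20 / p) * (8 * p * (z ^ 5 * y ^ 2)) = 64 * z ^ 23 := by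
      calc _ = 64 * (z ^ 20 / p * p) * z ^ 5 * y ^ 2 := by ring
        _ = 64 * z ^ 23 * (y * z) ^ 2 := by rw [hlp]; ring
        _ = _ := by rw [hyz]; ring
    rw [this]
    have := P 23 0
    norm_num at this ⊢
    linarith
  · calc _ ≤ 32 * (4 * (z ^ 5) ^ 2 * y ^ 2) := by gcongr
      _ = 128 * z ^ 8 * (y * z) ^ 2 := by ring
      _ = 128 * z ^ (7 + 1) := by rw [hyz]; ring
      _ ≤ 128 * ((1 / 2000) ^ 1 * z ^ 7) := by linarith [P 1 7]
      _ ≤ _ := by have := hpos 7; norm_num; linarith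
  · have hΔ1 : (1 : ℝ) ≤ Δ := by exact_mod_cast hΔ
    have hexp : Real.exp y = Δ := by rw [hy, Real.exp_log (by linarith)]
    have h1 : ((Δ : ℝ) + 1) ^ 4 ≤ 16 * Real.exp (4 * y) := by
      have : Real.exp (4 * y) = (Δ : ℝ) ^ 4 := by
        rw [← hexp, ← Real.exp_nat_mul]; norm_num
      rw [this]
      calc ((Δ : ℝ) + 1) ^ 4 ≤ (2 * Δ) ^ 4 := by gcongr; linarith
        _ = _ := by ring
    have h2 : (ℓ : ℝ) ≤ Real.exp (2 * y) := by
      have : Real.exp (2 * y) = (Δ : ℝ) ^ 2 := by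
        rw [← hexp, ← Real.exp_nat_mul]; norm_num
      rw [this]; exact hℓ
    have h3 : y ^ 2 ≤ z ^ 20 / p * (z ^ 7 / 10) / 2 := by
      have e1 : Real.exp (b * y) ≤ 1 / p := by
        rw [hp, Real.exp_neg, one_div_div, le_div_iff₀ (by positivity)]
        rw [mul_inv_cancel₀ (Real.exp_pos _).ne']
        exact hk1
      have e2 : z ^ 20 / p * (z ^ 7 / 10) / 2 = z ^ 27 / 20 * (1 / p) := by
        rw [div_eq_mul_one_div (z ^ 20) p]; ring
      rw [e2]
      calc y ^ 2 = y ^ 2 * (y * z) ^ 27 := by rw [hyz]; ring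
        _ = z ^ 27 / 20 * (20 * y ^ 29) := by ring
        _ ≤ z ^ 27 / 20 * (1 / p) :=
          mul_le_mul_of_nonneg_left (hE.trans e1) (by have := hpos 27; linarith)
    have h4 : Real.exp (-(z ^ 20 / p * (z ^ 7 / 10) / 2)) ≤ Real.exp (2 * y + 2 - y ^ 2) := by
      apply Real.exp_le_exp.2; linarith
    have h5 : 2 * (ℓ : ℝ) * Real.exp (2 - y ^ 2) ≤ 2 * Real.exp (2 * y + 2 - y ^ 2) := by
      have : Real.exp (2 * y + 2 - y ^ 2) = Real.exp (2 * y) * Real.exp (2 - y ^ 2) := by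
        rw [← Real.exp_add]; congr 1; ring
      rw [this]
      rw [mul_assoc]
      exact mul_le_mul_of_nonneg_left (mul_le_mul_of_nonneg_right h2 (Real.exp_pos _).le)
        (by norm_num)
    have h6 : 384 * Real.exp (6 * y + 2 - y ^ 2) ≤ 1 := by
      have a1 := Real.add_one_le_exp (y ^ 2 - 6 * y - 2)
      have a2 : 384 ≤ Real.exp (y ^ 2 - 6 * y - 2) := by
        have : 2000 * y ≤ y ^ 2 := by rw [pow_two]; exact mul_le_mul_of_nonneg_right hy0 hyp.le
        linarith
      have a3 : Real.exp (y ^ 2 - 6 * y - 2) * Real.exp (6 * y + 2 - y ^ 2) = 1 := by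
        rw [← Real.exp_add, ← Real.exp_zero]; congr 1; ring
      rw [← a3]
      exact mul_le_mul_of_nonneg_right a2 (Real.exp_pos _).le
    calc _ ≤ 16 * Real.exp (4 * y) * (4 * Real.exp (2 * y + 2 - y ^ 2) +
          2 * Real.exp (2 * y + 2 - y ^ 2)) := by
          apply mul_le_mul h1 (by linarith) (by positivity) (by positivity)
      _ = 96 * (Real.exp (4 * y) * Real.exp (2 * y + 2 - y ^ 2)) := by ring
      _ = 96 * Real.exp (6 * y + 2 - y ^ 2) := by
          rw [← Real.exp_add]; congr 2; ring
      _ ≤ _ := by linarith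

theorem thmB_core (Δ : ℕ) (y b k r0 Lam ε' : ℝ) (ℓ : ℕ) (hΔ : 1 ≤ Δ) (hy : y = Real.log Δ)
    (hy0 : 2000 ≤ y) (hE : 20 * y ^ 29 ≤ Real.exp (b * y)) (hk : 1 ≤ k) (hℓ0 : 0 < ℓ)
    (hb : 0 ≤ b)
    (hℓ : (ℓ : ℝ) ≤ (Δ : ℝ) ^ 2) (hr0 : 0 ≤ r0) (hr : r0 ≤ y / 2)
    (hLam : Lam = Real.log (ℓ * (Real.exp (-(b * y)) / √k))) (hLam1 : 1 ≤ Lam)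
    (hε : 0 < ε') (hε1 : 40 / ε' ≤ y) (hrL : 2 * r0 / Lam ≤ (1 - ε' / 2) / 2)
    {V C : Type} [Fintype V] [Fintype C] (π : C → V) (G : SimpleGraph V) (H : SimpleGraph C)
    (hc : Cov π G H Δ k) (T : Finset C) (φ0 : V → C)
    (hT : ∀ v, (univ.filter (fun c => c ∈ T ∧ π c = v)).card = ℓ)
    (hD : ∀ c ∈ T, ((univ.filter (fun c' => c' ∈ T ∧ H.Adj c c')).card : ℝ) ≤ r0 * ℓ) :
    ∃ φ : V → C, (∀ v, π (φ v) = v) ∧ (∀ v, φ v ∈ T) ∧ ∀ u v, ¬ H.Adj (φ u) (φ v) := by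
  have hn := num_step Δ y b k r0 Lam ℓ hΔ hy hy0 hE hk hℓ0 hℓ hr0 hr hLam hLam1
  set z := y⁻¹ with hz
  have hyp : 0 < y := by linarith
  have hzp : 0 < z := inv_pos.2 hyp
  have hyz : y * z = 1 := mul_inv_cancel₀ hyp.ne'
  have hz1 : z ≤ 1 / 2000 := by
    rw [hz, inv_eq_one_div]; exact one_div_le_one_div_of_le (by norm_num) hy0
  have hk1 : 1 ≤ √k := Real.one_le_sqrt.2 hk
  set p := Real.exp (-(b * y)) / √k with hp
  have hp0 : 0 < p := hn.hp
  have hQm : r0 + 2 * z ^ 2 ≤ y := by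
    have : z ^ 2 ≤ 1 := pow_le_one₀ hzp.le (by linarith)
    linarith
  have hQm0 : 0 ≤ r0 + 2 * z ^ 2 := by positivity
  have hpw : ∀ m, z ^ m ≤ 1 := fun m => pow_le_one₀ hzp.le (by linarith)
  have hpos : ∀ m, 0 ≤ z ^ m := fun m => pow_nonneg hzp.le m
  have P := fun a m => num_pow hzp.le hz1 a m
  have hez : Real.exp (-(b * y)) ≤ z ^ 4 := by
    rw [Real.exp_neg, hz, inv_pow]
    refine inv_anti₀ (by positivity) (le_trans ?_ hE)
    have : y ^ 4 ≤ y ^ 29 := pow_le_pow_right₀ (by linarith) (by norm_num)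
    linarith [pow_pos hyp 29]
  have hpe : p ≤ z ^ 4 := (div_le_self (Real.exp_pos _).le hk1).trans hez
  have hkp : k * p ^ 2 ≤ z ^ 8 := by
    have : k * p ^ 2 = Real.exp (-(b * y)) ^ 2 := by
      rw [hp, div_pow, Real.sq_sqrt (by linarith)]
      field_simp
    rw [this]
    calc _ ≤ (z ^ 4) ^ 2 := by gcongr
      _ = z ^ 8 := by ring
  set N := ⌈y ^ 6⌉₊ with hN
  have hN1 : y ^ 6 ≤ N := Nat.le_ceil _
  have hN2 : (N : ℝ) ≤ y ^ 6 + 1 := (Nat.ceil_lt_add_one (by positivity)).le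
  have hNz : N * (z ^ 5 * z ^ 2) ≤ 2 * z := by
    calc _ ≤ (y ^ 6 + 1) * (z ^ 5 * z ^ 2) := by gcongr
      _ = z * (y * z) ^ 6 + z ^ 7 := by ring
      _ ≤ _ := by rw [hyz]; have := P 6 1; norm_num at this ⊢; linarith
  have hz5 : z ^ 5 ≤ z / 2000 := by have := P 4 1; norm_num at this; linarith
  refine nibble_all hc ℓ T r0 (z ^ 2) N φ0 hT hD hr0 (by positivity) hn (by linarith)
    (by positivity) (by linarith) (hpe.trans (hpw 4)) (one_le_pow₀ (by linarith)) ?_ ?_ (by positivity)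
    ?_ (by linarith) ?_ ?_
  · calc z ^ 5 * y ^ 2 = z ^ 3 * (y * z) ^ 2 := by ring
      _ = z ^ 3 := by rw [hyz]; ring
      _ ≤ _ := by have := P 3 0; norm_num at this; linarith
  · apply le_of_eq; ring
  · calc _ ≤ (z ^ 5 * z ^ 4 + (z ^ 5) ^ 2) * y + 16 * z ^ 5 * (z ^ 8) + 2 * (z ^ 7 / 10) := by
          have e1 : (z ^ 5 * p + (z ^ 5) ^ 2) * (r0 + 2 * z ^ 2) ≤
              (z ^ 5 * z ^ 4 + (z ^ 5) ^ 2) * y := by gcongr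
          have e2 : 16 * z ^ 5 * k * p ^ 2 ≤ 16 * z ^ 5 * (z ^ 8) := by
            rw [mul_assoc _ k]; gcongr
          linarith
      _ = z ^ 8 * (y * z) + z ^ 9 * (y * z) + 16 * z ^ 13 + z ^ 7 / 5 := by ring
      _ ≤ z ^ 7 := by
          rw [hyz]
          have a1 := P 1 7
          have a2 := P 2 7
          have a3 := P 6 7
          have := hpos 7
          norm_num at a1 a2 a3
          linarith
      _ = _ := by ring
  · have e1 : 2 * (1 + 2 * z ^ 5) * r0 / Lam = (1 + 2 * z ^ 5) * (2 * r0 / Lam) := by ring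
    have e2 : (1 + 2 * z ^ 5) * (2 * r0 / Lam) ≤ (1 + 2 * z ^ 5) * ((1 - ε' / 2) / 2) := by gcongr
    have e3 : r0 / y ^ 2 ≤ z := by
      rw [div_le_iff₀ (by positivity)]
      calc r0 ≤ y := by linarith
        _ = z * y ^ 2 := by rw [pow_two, ← mul_assoc, mul_comm z, hyz, one_mul]
    have e4 : 40 * z ≤ ε' := by
      rw [div_le_iff₀ hε] at hε1
      calc 40 * z ≤ y * ε' * z := by gcongr
        _ = ε' * (y * z) := by ring
        _ = ε' := by rw [hyz, mul_one]
    have e5 : 0 ≤ z ^ 5 * ε' := by positivity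
    rw [e1]
    have e6 : (1 + 2 * z ^ 5) * ((1 - ε' / 2) / 2) ≤ 1 / 2 - ε' / 4 + z ^ 5 := by
      ring_nf
      ring_nf at e5
      linarith
    linarith
  · have e1 : (1 - z ^ 5 / 2) ^ N ≤ Real.exp (-(y / 2)) := by
      have a1 : 1 - z ^ 5 / 2 ≤ Real.exp (-(z ^ 5 / 2)) := by
        have := Real.add_one_le_exp (-(z ^ 5 / 2)); linarith
      have a0 : 0 ≤ 1 - z ^ 5 / 2 := by linarith
      calc _ ≤ Real.exp (-(z ^ 5 / 2)) ^ N := pow_le_pow_left₀ a0 a1 N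
        _ = Real.exp (N * (-(z ^ 5 / 2))) := by rw [← Real.exp_nat_mul]
        _ ≤ _ := by
          apply Real.exp_le_exp.2
          have : y ≤ N * z ^ 5 := by
            calc y = y ^ 6 * z ^ 5 := by
                  calc y = y * (y * z) ^ 5 := by rw [hyz]; ring
                    _ = _ := by ring
              _ ≤ N * z ^ 5 := by gcongr
          linarith
    have e2 : Real.exp (-(y / 2)) ≤ 8 * z ^ 2 := by
      rw [Real.exp_neg]
      have : y ^ 2 / 8 ≤ Real.exp (y / 2) := by
        have := Real.quadratic_le_exp_of_nonneg (show 0 ≤ y / 2 by linarith)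
        linarith [show 1 + y / 2 + (y / 2) ^ 2 / 2 = 1 + y / 2 + y ^ 2 / 8 by ring]
      calc _ ≤ (y ^ 2 / 8)⁻¹ := inv_anti₀ (by positivity) this
        _ = 8 * (y⁻¹) ^ 2 := by rw [inv_div, inv_pow, div_eq_mul_inv]
    calc r0 * (1 - z ^ 5 / 2) ^ N + 2 * z ^ 2 ≤ y * (8 * z ^ 2) + 2 * z ^ 2 := by
          have : r0 * (1 - z ^ 5 / 2) ^ N ≤ y * (8 * z ^ 2) := by
            apply mul_le_mul (by linarith) (e1.trans e2) (pow_nonneg (by linarith) _) hyp.le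
          linarith
      _ = 8 * z * (y * z) + 2 * z ^ 2 := by ring
      _ ≤ _ := by
        rw [hyz]
        have := P 1 1
        norm_num at this
        linarith

end Numerics

section ThmB

/-- Elementary bounds on the logarithmic parameter. -/
lemma R_bounds (α γ k : ℝ) (Δ : ℕ) (hΔ : 1 ≤ Δ) (hk : 1 ≤ k) (hk2 : k ≤ (Δ : ℝ) ^ (2 * α * γ)) :
    Real.log ((Δ : ℝ) ^ α / √k) = α * Real.log Δ - Real.log √k ∧
    (1 - γ) * (α * Real.log Δ) ≤ Real.log ((Δ : ℝ) ^ α / √k) ∧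
    Real.log ((Δ : ℝ) ^ α / √k) ≤ α * Real.log Δ := by
  have hΔ0 : (0 : ℝ) < Δ := by exact_mod_cast hΔ
  have hk1 : 1 ≤ √k := Real.one_le_sqrt.2 hk
  have e : Real.log ((Δ : ℝ) ^ α / √k) = α * Real.log Δ - Real.log √k := by
    rw [Real.log_div (Real.rpow_pos_of_pos hΔ0 α).ne' (by linarith), Real.log_rpow hΔ0]
  have h1 : 0 ≤ Real.log √k := Real.log_nonneg hk1
  have h2 : Real.log k ≤ 2 * α * γ * Real.log Δ := by
    rw [← Real.log_rpow hΔ0]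
    exact Real.log_le_log (by linarith) hk2
  rw [Real.log_sqrt (by linarith)] at *
  refine ⟨e, ?_, ?_⟩
  · rw [e]; linarith
  · rw [e]; linarith

theorem thmB (α γ ε' : ℝ) (hα : 0 < α) (hα1 : α < 1) (hγ : 0 < γ) (hγ1 : γ < 1) (hε : 0 < ε')
    (hε1 : ε' < 1) : ∃ Y : ℝ, ∀ Δ : ℕ, Y ≤ Real.log Δ → ∀ (k r0 : ℝ) (ℓ : ℕ), 1 ≤ k →
    k ≤ (Δ : ℝ) ^ (2 * α * γ) → (Δ : ℝ) ^ α / 2 ≤ ℓ → (ℓ : ℝ) ≤ (Δ : ℝ) ^ 2 → 0 ≤ r0 →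
    r0 ≤ (1 - ε') / 4 * Real.log ((Δ : ℝ) ^ α / √k) →
    ∀ {V C : Type} [Fintype V] [Fintype C] (π : C → V) (G : SimpleGraph V) (H : SimpleGraph C)
    (hc : Cov π G H Δ k) (T : Finset C)
    (hT : ∀ v, (univ.filter (fun c => c ∈ T ∧ π c = v)).card = ℓ)
    (hD : ∀ c ∈ T, ((univ.filter (fun c' => c' ∈ T ∧ H.Adj c c')).card : ℝ) ≤ r0 * ℓ),
    ∃ φ : V → C, (∀ v, π (φ v) = v) ∧ (∀ v, φ v ∈ T) ∧ ∀ u v, ¬ H.Adj (φ u) (φ v) := by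
  set b := (1 - γ) * ε' / 4 * α with hb
  have hγ' : 0 < 1 - γ := by linarith
  have hb0 : 0 < b := by positivity
  have hev : ∀ᶠ y : ℝ in Filter.atTop, 20 * y ^ 29 ≤ Real.exp (b * y) := by
    have h1 : (fun y : ℝ => y ^ 29) =o[Filter.atTop] fun y => Real.exp (b * y) :=
      isLittleO_pow_exp_pos_mul_atTop 29 hb0
    have h2 := h1.bound (show (0 : ℝ) < 1 / 20 by norm_num)
    filter_upwards [h2, Filter.eventually_ge_atTop 0] with y hy hy0
    rw [Real.norm_of_nonneg (by positivity), Real.norm_of_nonneg (Real.exp_pos _).le] at hy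
    linarith
  obtain ⟨Y0, hY0⟩ := Filter.eventually_atTop.1 hev
  refine ⟨max Y0 (max 2000 (max (40 / ε') (4 / ε' / ((1 - γ) * α)))), ?_⟩
  intro Δ hΔ k r0 ℓ hk hk2 hℓ hℓ2 hr0 hr V C _ _ π G H hc T hT hD
  set y := Real.log Δ with hy
  have y1 : Y0 ≤ y := (le_max_left _ _).trans hΔ
  have y2 : 2000 ≤ y := (le_max_left _ _).trans ((le_max_right _ _).trans hΔ)
  have y3 : 40 / ε' ≤ y :=
    (le_max_left _ _).trans ((le_max_right _ _).trans ((le_max_right _ _).trans hΔ))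
  have y4 : 4 / ε' / ((1 - γ) * α) ≤ y :=
    (le_max_right _ _).trans ((le_max_right _ _).trans ((le_max_right _ _).trans hΔ))
  rw [div_le_iff₀ (by positivity)] at y4
  have hΔ1 : 1 ≤ Δ := by
    rcases Nat.eq_zero_or_pos Δ with h | h
    · rw [h] at hy; simp at hy; linarith
    · exact h
  have hΔ0 : (0 : ℝ) < Δ := by exact_mod_cast hΔ1
  obtain ⟨r1, r2, r3⟩ := R_bounds α γ k Δ hΔ1 hk hk2
  set R := Real.log ((Δ : ℝ) ^ α / √k) with hR
  have hk1 : 1 ≤ √k := Real.one_le_sqrt.2 hk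
  have hDp : 0 < (Δ : ℝ) ^ α := Real.rpow_pos_of_pos hΔ0 α
  have hℓ0 : (0 : ℝ) < ℓ := by linarith
  have hℓ0' : 0 < ℓ := by exact_mod_cast hℓ0
  have hRε : 4 / ε' ≤ R := by
    refine y4.trans (le_trans (le_of_eq ?_) r2); ring
  have hRε2 : 1 ≤ ε' / 4 * R := by
    rw [div_le_iff₀ hε] at hRε; linarith
  have hby : b * y ≤ ε' / 4 * R := by
    calc b * y = ε' / 4 * ((1 - γ) * (α * y)) := by rw [hb]; ring
      _ ≤ _ := by gcongr
  have hLam : Real.log (ℓ * (Real.exp (-(b * y)) / √k)) = Real.log ℓ + (-(b * y) - Real.log √k) := by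
    rw [Real.log_mul hℓ0.ne' (div_pos (Real.exp_pos _) (by linarith)).ne',
      Real.log_div (Real.exp_pos _).ne' (by linarith), Real.log_exp]
  have hlogℓ : α * y - 1 ≤ Real.log ℓ := by
    have h1 := Real.log_le_log (by linarith) hℓ
    rw [Real.log_div hDp.ne' (by norm_num), Real.log_rpow hΔ0] at h1
    have := Real.log_two_lt_d9
    linarith
  have hL : (1 - ε' / 2) * R ≤ Real.log (ℓ * (Real.exp (-(b * y)) / √k)) := by
    rw [hLam]; linarith
  have hR0 : 0 < R := lt_of_lt_of_le (by positivity) hRε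
  have hR4 : 4 ≤ R := by
    refine le_trans ?_ hRε
    rw [le_div_iff₀ hε]; linarith
  have hL1 : 1 ≤ Real.log (ℓ * (Real.exp (-(b * y)) / √k)) := by
    refine le_trans ?_ hL
    calc (1 : ℝ) ≤ (1 / 2) * 4 := by norm_num
      _ ≤ (1 - ε' / 2) * R := mul_le_mul (by linarith) hR4 (by norm_num) (by linarith)
  have hne : ∀ v, ∃ c : C, π c = v := by
    intro v
    have : (univ.filter (fun c => c ∈ T ∧ π c = v)).Nonempty := by
      rw [← Finset.card_pos, hT v]; exact hℓ0'
    obtain ⟨c, hc⟩ := this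
    exact ⟨c, (Finset.mem_filter.1 hc).2.2⟩
  choose φ0 _ using hne
  refine thmB_core Δ y b k r0 _ ε' ℓ hΔ1 hy y2 (hY0 y y1) hk hℓ0' hb0.le hℓ2 hr0 ?_ rfl hL1 hε y3
    ?_ π G H hc T φ0 hT hD
  · have : R ≤ y := r3.trans (mul_le_of_le_one_left (by linarith) hα1.le)
    have h2 : (1 - ε') / 4 * R ≤ 1 / 4 * R :=
      mul_le_mul_of_nonneg_right (by linarith) hR0.le
    linarith
  · rw [div_le_iff₀ (by linarith)]
    have h1 : (1 - ε' / 2) / 2 * ((1 - ε' / 2) * R) ≤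
        (1 - ε' / 2) / 2 * Real.log (ℓ * (Real.exp (-(b * y)) / √k)) :=
      mul_le_mul_of_nonneg_left hL (by linarith)
    have h2 : 0 ≤ ε' ^ 2 * R := by positivity
    have h3 : (1 - ε' / 2) / 2 * ((1 - ε' / 2) * R) =
      2 * ((1 - ε') / 4 * R) + ε' ^ 2 * R / 8 := by ring
    linarith

end ThmB

section Sampling

lemma choose_ratio (M s b : ℕ) (hb : b ≤ s) (hs : s ≤ M) :
    (M - b).choose (s - b) * M ^ b ≤ M.choose s * s ^ b := by
  induction b with
  | zero => simp
  | succ b ih =>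
    have ih := ih (by omega)
    obtain ⟨s', hs'⟩ : ∃ s', s - b = s' + 1 := ⟨s - b - 1, by omega⟩
    obtain ⟨M', hM'⟩ : ∃ M', M - b = M' + 1 := ⟨M - b - 1, by omega⟩
    have e1 : M - (b + 1) = M' := by omega
    have e2 : s - (b + 1) = s' := by omega
    rw [hs', hM'] at ih
    rw [e1, e2]
    have h1 := Nat.add_one_mul_choose_eq M' s'
    have h2 : M * (s' + 1) ≤ s * (M' + 1) := by
      obtain ⟨a, rfl⟩ : ∃ a, M = s + a := ⟨M - s, by omega⟩
      have : s = s' + 1 + b := by omega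
      have h4 : M' = s' + a := by omega
      subst h4; subst this
      nlinarith [Nat.zero_le (a * b)]
    refine Nat.le_of_mul_le_mul_left ?_ (show 0 < M' + 1 by omega)
    calc (M' + 1) * (M'.choose s' * M ^ (b + 1))
        = ((M' + 1) * M'.choose s') * (M * M ^ b) := by ring
      _ = ((M' + 1).choose (s' + 1) * M ^ b) * (M * (s' + 1)) := by rw [h1]; ring
      _ ≤ (M.choose s * s ^ b) * (s * (M' + 1)) := Nat.mul_le_mul ih h2
      _ = _ := by ring

variable {V C : Type} [Fintype V] [Fintype C]

lemma card_sup (L B : Finset C) (s : ℕ) (hs : s ≤ L.card) :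
    ((L.powersetCard s).filter (fun S => B ⊆ S)).card * L.card ^ B.card ≤
      L.card.choose s * s ^ B.card := by
  by_cases hB : B ⊆ L ∧ B.card ≤ s
  · refine le_trans ?_ (choose_ratio L.card s B.card hB.2 hs)
    refine Nat.mul_le_mul_right _ ?_
    rw [← Finset.card_sdiff_of_subset hB.1, ← Finset.card_powersetCard]
    refine Finset.card_le_card_of_injOn (fun S => S \ B) ?_ ?_
    · intro S hS
      simp only [Finset.coe_filter, Finset.mem_powersetCard, Set.mem_ofPred_eq] at hS
      simp only [Finset.mem_coe, Finset.mem_powersetCard]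
      refine ⟨Finset.sdiff_subset_sdiff hS.1.1 le_rfl, ?_⟩
      rw [Finset.card_sdiff_of_subset hS.2, hS.1.2]
    · intro S hS S' hS' h
      simp only [Finset.coe_filter, Finset.mem_powersetCard, Set.mem_ofPred_eq] at hS hS'
      have h' : S \ B = S' \ B := h
      rw [← Finset.sdiff_union_of_subset hS.2, ← Finset.sdiff_union_of_subset hS'.2, h']
  · have : ((L.powersetCard s).filter (fun S => B ⊆ S)) = ∅ := by
      rw [Finset.filter_eq_empty_iff]
      intro S hS hBS
      rw [Finset.mem_powersetCard] at hS
      exact hB ⟨hBS.trans hS.1, hS.2 ▸ Finset.card_le_card hBS⟩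
    rw [this]; simp

lemma mgf_subset (L A : Finset C) (s q : ℕ) (hsq : s ≤ q) (hq : 0 < q) (hqL : q ≤ L.card)
    (y : ℝ) (hy : 0 ≤ y) :
    ∑ S ∈ L.powersetCard s, ∏ c ∈ A, (1 + if c ∈ S then y else 0) ≤
      (L.card.choose s : ℝ) * (1 + y * s / q) ^ A.card := by
  have hq' : (0 : ℝ) < q := by exact_mod_cast hq
  have hL : (0 : ℝ) < L.card := by exact_mod_cast (by omega : 0 < L.card)
  have hqL' : (q : ℝ) ≤ L.card := by exact_mod_cast hqL
  have e1 : ∀ S, ∏ c ∈ A, (1 + if c ∈ S then y else 0) =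
      ∑ B ∈ A.powerset, if B ⊆ S then y ^ B.card else 0 := by
    intro S
    rw [Finset.prod_one_add]
    refine Finset.sum_congr rfl fun B _ => ?_
    split_ifs with h
    · rw [Finset.prod_congr rfl (fun c hc => if_pos (h hc)), Finset.prod_const]
    · rw [Finset.not_subset] at h
      obtain ⟨c, hc, hcS⟩ := h
      exact Finset.prod_eq_zero hc (if_neg hcS)
  have e2 : (1 + y * s / q) ^ A.card = ∑ B ∈ A.powerset, (y * s / q) ^ B.card := by
    have := Finset.prod_one_add (s := A) (f := fun _ => y * s / (q : ℝ))
    rw [Finset.prod_const] at this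
    rw [this]
    refine Finset.sum_congr rfl fun B _ => ?_
    rw [Finset.prod_const]
  rw [Finset.sum_congr rfl fun S _ => e1 S, Finset.sum_comm, e2, Finset.mul_sum]
  refine Finset.sum_le_sum fun B _ => ?_
  rw [← Finset.sum_filter, Finset.sum_const, nsmul_eq_mul]
  have h1 := card_sup L B s (by omega)
  have h1' : (((L.powersetCard s).filter (fun S => B ⊆ S)).card : ℝ) * (L.card : ℝ) ^ B.card ≤
      L.card.choose s * (s : ℝ) ^ B.card := by exact_mod_cast h1
  have h2 : (((L.powersetCard s).filter (fun S => B ⊆ S)).card : ℝ) ≤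
      L.card.choose s * ((s : ℝ) / q) ^ B.card := by
    calc _ ≤ L.card.choose s * (s : ℝ) ^ B.card / (L.card : ℝ) ^ B.card := by
          rw [le_div_iff₀ (by positivity)]; exact h1'
      _ ≤ L.card.choose s * (s : ℝ) ^ B.card / (q : ℝ) ^ B.card := by gcongr
      _ = _ := by rw [div_pow, mul_div_assoc]
  calc _ ≤ (L.card.choose s * ((s : ℝ) / q) ^ B.card) * y ^ B.card :=
        mul_le_mul_of_nonneg_right h2 (by positivity)
    _ = _ := by rw [mul_assoc, ← mul_pow]; congr 2; ring

variable {π : C → V} {G : SimpleGraph V} {H : SimpleGraph C} {Δ : ℕ} {k : ℝ}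

lemma Cov.nb_card (hc : Cov π G H Δ k) (c : C) : (nb H c).card ≤ Δ := by
  refine le_trans ?_ (hc.deg (π c))
  refine Finset.card_le_card_of_injOn π ?_ ?_
  · intro c' h
    simp only [Finset.mem_coe, mem_nb] at h
    simpa using hc.adj _ _ h
  · intro a ha b hb h
    simp only [Finset.mem_coe, mem_nb] at ha hb
    exact hc.mat c a b ha hb h

/-- Sampled degree of a color. -/
def sdeg (π : C → V) (H : SimpleGraph C) (τ : V → Finset C) (c : C) : ℕ :=
  ((nb H c).filter (fun c' => c' ∈ τ (π c'))).card

lemma bad_T (hc : Cov π G H Δ k) (s q m : ℕ) (hsq : s ≤ q) (hq : 0 < q)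
    (hqL : ∀ v, q ≤ (fib π v).card) (y : ℝ) (hy : 0 ≤ y) (v : V) (T : Finset C)
    (hT : T ⊆ fib π v) (hTm : T.card = m) :
    ∑ τ ∈ Fintype.piFinset (fun u => (fib π u).powersetCard s),
      (if T ⊆ τ v then ∏ c ∈ T.biUnion (nb H), (1 + if c ∈ τ (π c) then y else 0) else 0) ≤
    (((fib π v).powersetCard s).filter (fun S => T ⊆ S)).card *
      (∏ u ∈ univ.erase v, ((fib π u).card.choose s : ℝ)) * (1 + y * s / q) ^ (m * Δ) := by
  set N := T.biUnion (nb H) with hN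
  set g : V → Finset C → ℝ := fun u S => (if u = v then (if T ⊆ S then 1 else 0) else 1) *
    ∏ c ∈ N with π c = u, (1 + if c ∈ S then y else 0) with hg
  have hz1 : 1 ≤ 1 + y * s / q := by
    have : 0 ≤ y * s / q := by positivity
    linarith
  have e1 : ∀ τ : V → Finset C, (if T ⊆ τ v then ∏ c ∈ N, (1 + if c ∈ τ (π c) then y else 0) else 0) =
      ∏ u, g u (τ u) := by
    intro τ
    simp only [hg]
    rw [Finset.prod_mul_distrib]
    have a1 : ∏ u, (if u = v then (if T ⊆ τ u then (1 : ℝ) else 0) else 1) =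
        if T ⊆ τ v then 1 else 0 := by
      rw [Finset.prod_ite_eq' univ v (fun u => if T ⊆ τ u then (1 : ℝ) else 0)]
      simp
    have a2 : ∏ u, ∏ c ∈ N with π c = u, (1 + if c ∈ τ u then y else 0) =
        ∏ c ∈ N, (1 + if c ∈ τ (π c) then y else 0) := by
      rw [← Finset.prod_fiberwise N π]
      refine Finset.prod_congr rfl fun u _ => Finset.prod_congr rfl fun c hc => ?_
      rw [(Finset.mem_filter.1 hc).2]
    rw [a1, a2]
    split_ifs <;> simp
  rw [Finset.sum_congr rfl fun τ _ => e1 τ, ← Finset.prod_univ_sum]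
  set K : V → ℝ := fun u => if u = v then
    ((((fib π v).powersetCard s).filter (fun S => T ⊆ S)).card : ℝ)
    else ((fib π u).card.choose s : ℝ) with hK
  have hK0 : ∀ u, 0 ≤ K u := by
    intro u; simp only [hK]; split_ifs <;> positivity
  have hb : ∀ u, ∑ S ∈ (fib π u).powersetCard s, g u S ≤
      K u * (1 + y * s / q) ^ (N.filter (fun c => π c = u)).card := by
    intro u
    by_cases huv : u = v
    · have hemp : N.filter (fun c => π c = u) = ∅ := by
        rw [Finset.filter_eq_empty_iff]
        intro c hcN hcu
        rw [hN, Finset.mem_biUnion] at hcN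
        obtain ⟨c', hc', hcc⟩ := hcN
        have h1 := hT hc'
        rw [mem_fib] at h1
        rw [mem_nb] at hcc
        have := hc.adj _ _ hcc
        rw [h1, hcu, huv] at this
        exact this.ne rfl
      simp only [hg, hK, hemp, if_pos huv]
      subst huv
      simp
    · simp only [hg, hK, if_neg huv, one_mul]
      exact mgf_subset (fib π u) _ s q hsq hq (hqL u) y hy
  calc _ ≤ ∏ u, (K u * (1 + y * s / q) ^ (N.filter (fun c => π c = u)).card) := by
        refine Finset.prod_le_prod (fun u _ => Finset.sum_nonneg fun S _ => ?_) fun u _ => hb u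
        simp only [hg]
        refine mul_nonneg (by split_ifs <;> norm_num) (Finset.prod_nonneg fun c _ => ?_)
        split_ifs <;> linarith
    _ = (∏ u, K u) * (1 + y * s / q) ^ N.card := by
        rw [Finset.prod_mul_distrib, Finset.prod_pow_eq_pow_sum]
        congr 2
        exact (Finset.card_eq_sum_card_fiberwise (fun c _ => Finset.mem_univ (π c))).symm
    _ ≤ (∏ u, K u) * (1 + y * s / q) ^ (m * Δ) := by
        refine mul_le_mul_of_nonneg_left ?_ (Finset.prod_nonneg fun u _ => hK0 u)
        refine pow_le_pow_right₀ hz1 ?_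
        rw [← hTm]
        exact Finset.card_biUnion_le_card_mul _ _ _ fun c _ => hc.nb_card c
    _ = _ := by
        congr 1
        rw [← Finset.mul_prod_erase univ K (Finset.mem_univ v)]
        congr 1
        · simp [hK]
        · refine Finset.prod_congr rfl fun u hu => ?_
          simp only [hK, if_neg (Finset.ne_of_mem_erase hu)]

/-- The vertex has many crowded colors. -/
def manyBad (π : C → V) (H : SimpleGraph C) (d : ℝ) (m : ℕ) (τ : V → Finset C) (v : V) : Prop :=
  m ≤ ((τ v).filter (fun c => d < sdeg π H τ c)).card

lemma bad_count (hc : Cov π G H Δ k) (s q m : ℕ) (hsq : s ≤ q) (hq : 0 < q)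
    (hqL : ∀ v, q ≤ (fib π v).card) (y d : ℝ) (hy : 0 ≤ y) (v : V) :
    (((Fintype.piFinset (fun u => (fib π u).powersetCard s)).filter
      (fun τ => manyBad π H d m τ v)).card : ℝ) ≤
    2 ^ s * (1 + y * s / q) ^ (m * Δ) * Real.exp (-(Real.log (1 + y) * (m * d))) *
      ∏ u, ((fib π u).card.choose s : ℝ) := by
  set Ω := Fintype.piFinset (fun u => (fib π u).powersetCard s) with hΩ
  set E := Real.exp (-(Real.log (1 + y) * (m * d))) with hE
  set F : Finset C → (V → Finset C) → ℝ := fun T τ =>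
    if T ⊆ τ v then ∏ c ∈ T.biUnion (nb H), (1 + if c ∈ τ (π c) then y else 0) else 0 with hF
  have hF0 : ∀ T τ, 0 ≤ F T τ := by
    intro T τ
    simp only [hF]
    split_ifs
    · exact Finset.prod_nonneg fun c _ => by split_ifs <;> linarith
    · exact le_rfl
  have hy1 : (0:ℝ) < 1 + y := by linarith
  have hlog : 0 ≤ Real.log (1 + y) := Real.log_nonneg (by linarith)
  have h1 : ∀ τ ∈ Ω, (if manyBad π H d m τ v then (1 : ℝ) else 0) ≤
      ∑ T ∈ (fib π v).powersetCard m, E * F T τ := by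
    intro τ hτ
    have hτv : τ v ⊆ fib π v := by
      have := Fintype.mem_piFinset.1 hτ v
      exact (Finset.mem_powersetCard.1 this).1
    split_ifs with hbad
    · obtain ⟨T, hTs, hTm⟩ := Finset.exists_subset_card_eq hbad
      have hTτ : T ⊆ τ v := hTs.trans (Finset.filter_subset _ _)
      refine le_trans ?_ (Finset.single_le_sum (f := fun T => E * F T τ)
        (fun T _ => mul_nonneg (Real.exp_pos _).le (hF0 T τ))
        (Finset.mem_powersetCard.2 ⟨hTτ.trans hτv, hTm⟩))
      have e2 : F T τ = Real.exp (Real.log (1 + y) * (∑ c ∈ T, sdeg π H τ c : ℕ)) := by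
        simp only [hF, if_pos hTτ]
        have a1 : ∀ c ∈ T.biUnion (nb H), (1 + if c ∈ τ (π c) then y else 0) =
            if c ∈ τ (π c) then 1 + y else 1 := by
          intro c _; split_ifs <;> simp
        rw [Finset.prod_congr rfl a1, Finset.prod_ite, Finset.prod_const, Finset.prod_const_one,
          mul_one, mul_comm, Real.exp_nat_mul, Real.exp_log hy1]
        congr 1
        rw [Finset.filter_biUnion, Finset.card_biUnion]
        · rfl
        · intro a ha b hb hab
          rw [Function.onFun, Finset.disjoint_left]
          intro c hca hcb
          simp only [Finset.mem_filter, mem_nb] at hca hcb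
          have ha' := hτv (hTτ ha)
          have hb' := hτv (hTτ hb)
          rw [mem_fib] at ha' hb'
          exact hab (hc.mat c a b hca.1.symm hcb.1.symm (ha'.trans hb'.symm))
      change 1 ≤ E * F T τ
      rw [e2, hE, ← Real.exp_add]
      refine Real.one_le_exp ?_
      have : (m : ℝ) * d ≤ (∑ c ∈ T, sdeg π H τ c : ℕ) := by
        push_cast
        rw [← hTm, ← nsmul_eq_mul]
        exact Finset.card_nsmul_le_sum _ _ _ fun c hcT => (Finset.mem_filter.1 (hTs hcT)).2.le
      nlinarith [mul_le_mul_of_nonneg_left this hlog]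
    · exact Finset.sum_nonneg fun T _ => mul_nonneg (Real.exp_pos _).le (hF0 T τ)
  have h2 : ∑ T ∈ (fib π v).powersetCard m,
      ((((fib π v).powersetCard s).filter (fun S => T ⊆ S)).card : ℝ) ≤
      2 ^ s * ((fib π v).card.choose s : ℝ) := by
    have : ∑ T ∈ (fib π v).powersetCard m, (((fib π v).powersetCard s).filter (fun S => T ⊆ S)).card
        ≤ 2 ^ s * (fib π v).card.choose s := by
      simp only [Finset.card_filter]
      rw [Finset.sum_comm, ← Finset.card_powersetCard, mul_comm, ← smul_eq_mul]
      refine Finset.sum_le_card_nsmul _ _ _ fun S hS => ?_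
      rw [← Finset.card_filter, ← (Finset.mem_powersetCard.1 hS).2, ← Finset.card_powerset]
      refine Finset.card_le_card fun T hT => ?_
      rw [Finset.mem_powerset]
      exact (Finset.mem_filter.1 hT).2
    exact_mod_cast this
  have hz0 : 0 ≤ (1 + y * s / q) ^ (m * Δ) := by positivity
  have hP0 : 0 ≤ ∏ u ∈ univ.erase v, ((fib π u).card.choose s : ℝ) :=
    Finset.prod_nonneg fun u _ => by positivity
  rw [Finset.card_filter]
  push_cast
  calc _ ≤ ∑ τ ∈ Ω, ∑ T ∈ (fib π v).powersetCard m, E * F T τ := Finset.sum_le_sum h1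
    _ = ∑ T ∈ (fib π v).powersetCard m, E * ∑ τ ∈ Ω, F T τ := by
        rw [Finset.sum_comm]
        refine Finset.sum_congr rfl fun T _ => ?_
        rw [Finset.mul_sum]
    _ ≤ ∑ T ∈ (fib π v).powersetCard m, E *
        ((((fib π v).powersetCard s).filter (fun S => T ⊆ S)).card *
      (∏ u ∈ univ.erase v, ((fib π u).card.choose s : ℝ)) * (1 + y * s / q) ^ (m * Δ)) := by
        refine Finset.sum_le_sum fun T hT => mul_le_mul_of_nonneg_left ?_ (Real.exp_pos _).le
        have := Finset.mem_powersetCard.1 hT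
        exact bad_T hc s q m hsq hq hqL y hy v T this.1 this.2
    _ = (∑ T ∈ (fib π v).powersetCard m,
        ((((fib π v).powersetCard s).filter (fun S => T ⊆ S)).card : ℝ)) *
        (E * (∏ u ∈ univ.erase v, ((fib π u).card.choose s : ℝ)) * (1 + y * s / q) ^ (m * Δ)) := by
        rw [Finset.sum_mul]
        refine Finset.sum_congr rfl fun T _ => by ring
    _ ≤ (2 ^ s * ((fib π v).card.choose s : ℝ)) *
        (E * (∏ u ∈ univ.erase v, ((fib π u).card.choose s : ℝ)) * (1 + y * s / q) ^ (m * Δ)) :=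
        mul_le_mul_of_nonneg_right h2
          (mul_nonneg (mul_nonneg (Real.exp_pos _).le hP0) hz0)
    _ = _ := by
        rw [← Finset.mul_prod_erase univ (fun u => ((fib π u).card.choose s : ℝ))
          (Finset.mem_univ v)]
        ring

end Sampling

section Assembly

lemma sample_num (δ d : ℝ) (Δ q s m n : ℕ) (hδ : 0 < δ) (hq : 0 < q) (hs : 1 ≤ s) (hn : 1 ≤ n)
    (hm : δ * s ≤ m) (hd : d = (1 + δ) * Δ * s / q)
    (hρ : 3 ≤ δ * ((1 + δ) * Real.log (1 + δ) - δ) * ((Δ : ℝ) / q))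
    (hsn : Real.log n ≤ (s : ℝ) ^ 2) :
    2 ^ s * (1 + δ * s / q) ^ (m * Δ) * Real.exp (-(Real.log (1 + δ) * (m * d))) ≤
      1 / (n : ℝ) ^ 2 := by
  have hn' : (0 : ℝ) < n := by exact_mod_cast hn
  have hq' : (0 : ℝ) < q := by exact_mod_cast hq
  have hs' : (1 : ℝ) ≤ s := by exact_mod_cast hs
  set h := (1 + δ) * Real.log (1 + δ) - δ with hh
  have e1 : (2 : ℝ) ^ s ≤ Real.exp s := by
    rw [← Real.exp_one_pow]
    refine pow_le_pow_left₀ (by norm_num) ?_ s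
    have := Real.add_one_le_exp (1 : ℝ)
    linarith
  have e2 : (1 + δ * s / q) ^ (m * Δ) ≤ Real.exp ((m * Δ : ℕ) * (δ * s / q)) := by
    rw [Real.exp_nat_mul]
    refine pow_le_pow_left₀ (by positivity) ?_ _
    have := Real.add_one_le_exp (δ * s / q)
    linarith
  have e3 : (1 : ℝ) / (n : ℝ) ^ 2 = Real.exp (-(2 * Real.log n)) := by
    rw [Real.exp_neg, two_mul, Real.exp_add, Real.exp_log hn', one_div, sq]
  rw [e3]
  calc _ ≤ Real.exp s * Real.exp ((m * Δ : ℕ) * (δ * s / q)) *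
        Real.exp (-(Real.log (1 + δ) * (m * d))) := by gcongr
    _ = Real.exp (s - m * s * (h * (Δ / q))) := by
        rw [← Real.exp_add, ← Real.exp_add]
        congr 1
        rw [hd, hh]; push_cast; ring
    _ ≤ _ := by
        refine Real.exp_le_exp.2 ?_
        have hX : 0 ≤ h * ((Δ : ℝ) / q) := by
          by_contra hcon
          push Not at hcon
          nlinarith
        have b1 : δ * s * s * (h * (Δ / q)) ≤ m * s * (h * ((Δ : ℝ) / q)) := by gcongr
        have b2 : 3 * ((s : ℝ) ^ 2) ≤ δ * s * s * (h * (Δ / q)) := by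
          have := mul_le_mul_of_nonneg_right hρ (sq_nonneg (s : ℝ))
          nlinarith
        nlinarith

lemma union_bad {V C : Type} [Fintype V] [Fintype C] {π : C → V} {G : SimpleGraph V}
    {H : SimpleGraph C} {Δ : ℕ} {k : ℝ} (hc : Cov π G H Δ k) (s q m : ℕ) (hsq : s ≤ q) (hq : 0 < q)
    (hqL : ∀ v, q ≤ (fib π v).card) (δ d : ℝ) (hδ : 0 < δ) (hs : 1 ≤ s)
    (hm : δ * s ≤ m) (hd : d = (1 + δ) * Δ * s / q)
    (hρ : 3 ≤ δ * ((1 + δ) * Real.log (1 + δ) - δ) * ((Δ : ℝ) / q))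
    (hsn : Real.log (Fintype.card V) ≤ (s : ℝ) ^ 2) :
    (((Fintype.piFinset (fun u => (fib π u).powersetCard s)).filter
      (fun τ => ∃ v, manyBad π H d m τ v)).card : ℝ) ≤
    (1 / (Fintype.card V : ℝ)) * ((Fintype.piFinset (fun u => (fib π u).powersetCard s)).card : ℝ) := by
  set Ω := Fintype.piFinset (fun u => (fib π u).powersetCard s) with hΩ
  have hcard : (Ω.card : ℝ) = ∏ u, ((fib π u).card.choose s : ℝ) := by
    rw [hΩ, Fintype.card_piFinset]
    push_cast
    exact Finset.prod_congr rfl fun u _ => by rw [Finset.card_powersetCard]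
  have h1 : Ω.filter (fun τ => ∃ v, manyBad π H d m τ v) ⊆
      univ.biUnion (fun v => Ω.filter (fun τ => manyBad π H d m τ v)) := by
    intro τ hτ
    obtain ⟨h, v, hv⟩ := Finset.mem_filter.1 hτ
    exact Finset.mem_biUnion.2 ⟨v, Finset.mem_univ v, Finset.mem_filter.2 ⟨h, hv⟩⟩
  have h2 : ((Ω.filter (fun τ => ∃ v, manyBad π H d m τ v)).card : ℝ) ≤
      ∑ v : V, ((Ω.filter (fun τ => manyBad π H d m τ v)).card : ℝ) := by
    exact_mod_cast (Finset.card_le_card h1).trans Finset.card_biUnion_le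
  have h3 : ∀ v : V, ((Ω.filter (fun τ => manyBad π H d m τ v)).card : ℝ) ≤
      1 / (Fintype.card V : ℝ) ^ 2 * Ω.card := by
    intro v
    have hn : 1 ≤ Fintype.card V := Fintype.card_pos_iff.2 ⟨v⟩
    refine (bad_count hc s q m hsq hq hqL δ d hδ.le v).trans ?_
    rw [hcard]
    refine mul_le_mul_of_nonneg_right ?_ (Finset.prod_nonneg fun u _ => by positivity)
    exact sample_num δ d Δ q s m _ hδ hq hs hn hm hd hρ hsn
  refine h2.trans ((Finset.sum_le_sum fun v _ => h3 v).trans ?_)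
  rw [Finset.sum_const, nsmul_eq_mul, Finset.card_univ, ← mul_assoc]
  refine mul_le_mul_of_nonneg_right ?_ (by positivity)
  rcases Nat.eq_zero_or_pos (Fintype.card V) with h0 | h0
  · rw [h0]; simp
  · have : (0 : ℝ) < Fintype.card V := by exact_mod_cast h0
    apply le_of_eq
    field_simp

lemma good_T {V C : Type} [Fintype V] [Fintype C] {π : C → V} {H : SimpleGraph C}
    (s m : ℕ) (hm : 1 ≤ m) (hms : m ≤ s) (d : ℝ) (τ : V → Finset C)
    (hτ : ∀ v, τ v ∈ (fib π v).powersetCard s) (hgood : ∀ v, ¬ manyBad π H d m τ v) :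
    ∃ T : Finset C, (∀ c ∈ T, c ∈ τ (π c)) ∧
      (∀ v, (univ.filter (fun c => c ∈ T ∧ π c = v)).card = s + 1 - m) ∧
      ∀ c ∈ T, ((univ.filter (fun c' => c' ∈ T ∧ H.Adj c c')).card : ℝ) ≤ d := by
  have h1 : ∀ v, ∃ A ⊆ (τ v).filter (fun c => ¬ d < sdeg π H τ c), A.card = s + 1 - m := by
    intro v
    refine Finset.exists_subset_card_eq ?_
    have a := Finset.card_filter_add_card_filter_not (s := τ v) (fun c => d < sdeg π H τ c)
    have b := (Finset.mem_powersetCard.1 (hτ v)).2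
    have c := hgood v
    unfold manyBad at c
    omega
  choose A hA hAc using h1
  have hsub : ∀ v, ∀ c ∈ A v, c ∈ τ v ∧ π c = v ∧ ¬ d < sdeg π H τ c := by
    intro v c hc
    have a := Finset.mem_filter.1 (hA v hc)
    have b := (Finset.mem_powersetCard.1 (hτ v)).1 a.1
    rw [mem_fib] at b
    exact ⟨a.1, b, a.2⟩
  refine ⟨univ.filter (fun c => c ∈ A (π c)), ?_, ?_, ?_⟩
  · intro c hc
    exact (hsub _ c (Finset.mem_filter.1 hc).2).1
  · intro v
    rw [← hAc v]
    congr 1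
    ext c
    simp only [Finset.mem_filter, Finset.mem_univ, true_and]
    constructor
    · rintro ⟨h, rfl⟩; exact h
    · intro h
      have := (hsub v c h).2.1
      exact ⟨this.symm ▸ h, this⟩
  · intro c hc
    have h := (hsub _ c (Finset.mem_filter.1 hc).2).2.2
    refine le_trans ?_ (not_lt.1 h)
    unfold sdeg
    exact_mod_cast Finset.card_le_card (by
      intro c' hc'
      simp only [Finset.mem_filter, Finset.mem_univ, true_and, mem_nb] at hc' ⊢
      exact ⟨hc'.2, (hsub _ c' hc'.1).1⟩)

lemma cover_cov {V C : Type} [Fintype V] [Fintype C] {G : SimpleGraph V} {H : SimpleGraph C}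
    {L : V → Finset C} (hL : IsCorrespondenceCover G H L) {Δ : ℕ} {k : ℝ}
    (hdeg : ∀ v : V, G.degree v ≤ Δ) (hsp : LocallySparse G k) :
    ∃ π : C → V, (∀ v, L v = fib π v) ∧ Cov π G H Δ k := by
  choose π hπ hu using hL.partition
  have hadj : ∀ c c', H.Adj c c' → G.Adj (π c) (π c') := by
    intro c c' h
    by_contra hcon
    exact hL.not_adj _ _ hcon c (hπ c) c' (hπ c') h
  have hmat : ∀ c c1 c2, H.Adj c c1 → H.Adj c c2 → π c1 = π c2 → c1 = c2 := by
    intro c c1 c2 h1 h2 h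
    exact hL.matching (π c) (π c1) c (hπ c) c1 (hπ c1) c2 (h ▸ hπ c2) h1 h2
  refine ⟨π, ?_, hadj, hmat, ?_, ?_⟩
  · intro v
    ext c
    rw [mem_fib]
    exact ⟨fun h => (hu c v h).symm, fun h => h ▸ hπ c⟩
  · intro v
    refine le_trans (le_of_eq ?_) (hdeg v)
    rw [← SimpleGraph.card_neighborFinset_eq_degree]
    congr 1
    ext u
    simp
  · intro c
    refine le_trans ?_ (hsp (π c))
    have : ∑ c1 ∈ nb H c, (nb H c ∩ nb H c1).card ≤ pairsWithin G (G.neighborFinset (π c)) := by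
      rw [← Finset.card_sigma]
      unfold pairsWithin
      refine Finset.card_le_card_of_injOn (fun x => (π x.1, π x.2)) ?_ ?_
      · rintro ⟨a, b⟩ h
        simp only [Finset.mem_coe, Finset.mem_sigma, Finset.mem_inter, mem_nb] at h
        simp only [Finset.mem_coe, Finset.mem_filter, Finset.mem_product,
          SimpleGraph.mem_neighborFinset]
        exact ⟨⟨hadj _ _ h.1, hadj _ _ h.2.1⟩, hadj _ _ h.2.2⟩
      · rintro ⟨a, b⟩ h ⟨a', b'⟩ h' e
        simp only [Finset.mem_coe, Finset.mem_sigma, Finset.mem_inter, mem_nb] at h h'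
        simp only [Prod.mk.injEq] at e
        have e1 := hmat c a a' h.1 h'.1 e.1
        have e2 := hmat c b b' h.2.1 h'.2.1 e.2
        subst e1; subst e2; rfl
    exact_mod_cast this

lemma pi_ratio {V C : Type} [Fintype V] [Fintype C] (t : V → Finset (Finset C))
    (P : (V → Finset C) → Prop) (x : ℝ) (hne : (Fintype.piFinset t).Nonempty)
    (Bd : Finset (V → Finset C)) (hB : ∀ τ ∈ Fintype.piFinset t, ¬ P τ → τ ∈ Bd)
    (hBc : (Bd.card : ℝ) ≤ x * (Fintype.piFinset t).card) :
    1 - x ≤ (((univ.pi t).filter (fun σ => P (fun v => σ v (Finset.mem_univ v)))).card : ℝ) /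
      ((univ.pi t).card : ℝ) := by
  have h : (((Fintype.piFinset t).filter (fun τ => ¬ P τ)).card : ℝ) ≤
      x * (Fintype.piFinset t).card := by
    refine le_trans (Nat.cast_le.2 (Finset.card_le_card ?_)) hBc
    intro τ hτ
    exact hB τ (Finset.mem_filter.1 hτ).1 (Finset.mem_filter.1 hτ).2
  have e0 : (univ.pi t).card = (Fintype.piFinset t).card := by
    rw [Fintype.card_piFinset, Finset.card_pi]
  have e1 : ((Fintype.piFinset t).filter P).card ≤
      ((univ.pi t).filter (fun σ => P (fun v => σ v (Finset.mem_univ v)))).card := by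
    refine Finset.card_le_card_of_injOn (fun τ => fun v _ => τ v) ?_ ?_
    · intro τ hτ
      simp only [Finset.mem_coe, Finset.mem_filter, Fintype.mem_piFinset, Finset.mem_pi] at hτ ⊢
      exact ⟨fun a _ => hτ.1 a, hτ.2⟩
    · intro a _ b _ hab
      funext v
      exact congrFun (congrFun hab v) (Finset.mem_univ v)
  have e2 := Finset.card_filter_add_card_filter_not (s := Fintype.piFinset t) P
  have hpos : (0 : ℝ) < (Fintype.piFinset t).card := by exact_mod_cast hne.card_pos
  rw [e0, le_div_iff₀ hpos]
  have e1' : (((Fintype.piFinset t).filter P).card : ℝ) ≤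
      ((univ.pi t).filter (fun σ => P (fun v => σ v (Finset.mem_univ v)))).card := by
    exact_mod_cast e1
  have e2' : (((Fintype.piFinset t).filter P).card : ℝ) +
      ((Fintype.piFinset t).filter (fun τ => ¬ P τ)).card = (Fintype.piFinset t).card := by
    exact_mod_cast e2
  linarith

lemma gap_pos (δ : ℝ) (hδ : 0 < δ) : 0 < (1 + δ) * Real.log (1 + δ) - δ := by
  have h1 : (0 : ℝ) < 1 + δ := by linarith
  have h2 := Real.log_lt_sub_one_of_pos (inv_pos.2 h1)
    (by intro h; rw [inv_eq_one] at h; linarith)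
  rw [Real.log_inv] at h2
  have h3 : 1 - (1 + δ)⁻¹ < Real.log (1 + δ) := by linarith
  have h4 := mul_lt_mul_of_pos_left h3 h1
  rw [mul_sub, mul_inv_cancel₀ h1.ne'] at h4
  linarith

end Assembly

set_option maxHeartbeats 1000000 in
/-- Palette sparsification for correspondence coloring of locally sparse graphs: sampling a
uniformly random `s`-subset `S(v) ⊆ L(v)` independently for each vertex yields, with
probability at least `1 - 1/n`, a proper `ℋ`-coloring from the sampled lists.  Probabilities
are expressed by counting outcomes of the uniform product sample space
`Ω = Π_v {S ⊆ L(v) : |S| = s}`. -/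
theorem stmt3 (ε γ : ℝ) (hε : 0 < ε) (hγ : γ ∈ Set.Ioo (0 : ℝ) 1) :
    ∃ C : ℝ, 0 < C ∧ ∀ α : ℝ, α ∈ Set.Ioo (0 : ℝ) 1 →
    ∃ Δ₀ : ℕ, ∀ Δ : ℕ, Δ₀ ≤ Δ → ∀ (n : ℕ) (k : ℝ) (q s : ℕ),
      1 ≤ k → k ≤ (Δ : ℝ) ^ (2 * α * γ) →
      (q : ℝ) = 4 * (1 + γ + ε) * Δ / Real.log ((Δ : ℝ) ^ α / Real.sqrt k) →
      s ≤ q →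
      (Δ : ℝ) ^ α + C * Real.sqrt (Real.log n) ≤ (s : ℝ) →
      ∀ (V C' : Type) [Fintype V] [Fintype C'] (G : SimpleGraph V) (H : SimpleGraph C')
        (L : V → Finset C'),
        IsCorrespondenceCover G H L →
        (∀ v : V, q ≤ (L v).card) →
        Fintype.card V = n →
        (∀ v : V, G.degree v ≤ Δ) →
        LocallySparse G k →
        1 - 1 / (n : ℝ) ≤
          (((Finset.univ.pi fun v : V => (L v).powersetCard s).filter
                fun σ => ∃ φ : V → C',
                  (∀ v : V, φ v ∈ σ v (Finset.mem_univ v)) ∧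
                  (∀ v : V, φ v ∈ L v) ∧
                  ∀ u w : V, ¬H.Adj (φ u) (φ w)).card : ℝ) /
            ((Finset.univ.pi fun v : V => (L v).powersetCard s).card : ℝ) := by

  obtain ⟨hγ0, hγ1⟩ := hγ
  refine ⟨1, one_pos, ?_⟩
  rintro α ⟨hα0, hα1⟩
  obtain ⟨Y, hY⟩ := thmB α γ (γ / 4) hα0 hα1 hγ0 hγ1 (by linarith) (by linarith)
  set δ := γ / 8 with hδ
  have hδ0 : 0 < δ := by rw [hδ]; linarith
  have hδ1 : δ < 1 / 8 := by rw [hδ]; linarith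
  set h := (1 + δ) * Real.log (1 + δ) - δ with hh
  have hh0 : 0 < h := gap_pos δ hδ0
  set K := 1 + γ + ε with hK
  have hK0 : 1 < K := by rw [hK]; linarith
  have hga : 0 < (1 - γ) * α := mul_pos (by linarith) hα0
  set B := max Y (max (4 * (2 + ε)) (max ((12 * K / (δ * h)) / ((1 - γ) * α))
    (1 / ((1 - γ) * α)))) with hB
  refine ⟨⌈Real.exp B⌉₊, ?_⟩
  intro Δ hΔ n k q s hk1 hk hq hsq hs V C' _ _ G H L hL hqL hn hdeg hsp
  have hexp : Real.exp B ≤ Δ := Nat.ceil_le.1 hΔ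
  have hΔ0 : (0 : ℝ) < Δ := (Real.exp_pos _).trans_le hexp
  have hlog : B ≤ Real.log Δ := (Real.le_log_iff_exp_le hΔ0).2 hexp
  have hx1 : Y ≤ Real.log Δ := (le_max_left _ _).trans hlog
  have hB2 := (le_max_right Y _).trans hlog
  have hx2 := (le_max_left _ _).trans hB2
  have hB3 := (le_max_right _ _).trans hB2
  have hx3 := (le_max_left _ _).trans hB3
  have hx4 := (le_max_right _ _).trans hB3
  have hΔ1 : 1 ≤ Δ := by
    have : 0 < Δ := by exact_mod_cast hΔ0
    omega
  have hΔ1' : (1 : ℝ) ≤ Δ := by exact_mod_cast hΔ1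
  have hΔx : Real.log Δ ≤ Δ := by
    have := Real.log_le_sub_one_of_pos hΔ0
    linarith
  have hR := (R_bounds α γ k Δ (by first | exact hΔ1 | exact hΔ1') hk1 hk).2.1
  set R := Real.log ((Δ : ℝ) ^ α / Real.sqrt k) with hRdef
  rw [div_le_iff₀ hga] at hx3 hx4
  have hR1 : 1 ≤ R := by linarith only [hx4, hR]
  have hR2 : 12 * K / (δ * h) ≤ R := by linarith only [hx3, hR]
  have hR0 : 0 < R := by linarith
  have hq0' : (0 : ℝ) < q := by rw [hq]; positivity
  have hq0 : 0 < q := by exact_mod_cast hq0'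
  have hρ : (Δ : ℝ) / q = R / (4 * K) := by
    rw [hq]; field_simp
  have hρ3 : 3 ≤ δ * h * ((Δ : ℝ) / q) := by
    rw [hρ]
    rw [div_le_iff₀ (by positivity)] at hR2
    rw [← mul_div_assoc, le_div_iff₀ (by positivity)]
    linarith
  have hsq0 : 0 ≤ Real.sqrt (Real.log n) := Real.sqrt_nonneg _
  have hΔα1 : 1 ≤ (Δ : ℝ) ^ α := Real.one_le_rpow hΔ1' hα0.le
  have hs1' : (1 : ℝ) ≤ s := by linarith
  have hs1 : 1 ≤ s := by exact_mod_cast hs1'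
  have hsn : Real.log n ≤ (s : ℝ) ^ 2 := by
    have : Real.sqrt (Real.log n) ≤ s := by linarith
    exact (Real.sqrt_le_iff.1 this).2
  obtain ⟨π, hLπ, hc⟩ := cover_cov hL hdeg hsp
  obtain rfl : L = fun v => fib π v := funext hLπ
  set m := ⌈δ * s⌉₊ with hm
  have hm1 : 1 ≤ m := Nat.one_le_ceil_iff.2 (by positivity)
  have hms : m ≤ s := by
    refine Nat.ceil_le.2 ?_
    nlinarith only [hδ1, hs1']
  have hmδ : δ * s ≤ m := Nat.le_ceil _
  have hmu : (m : ℝ) < δ * s + 1 := Nat.ceil_lt_add_one (by positivity)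
  set d := (1 + δ) * Δ * s / q with hd
  have hub := union_bad hc s q m hsq hq0 hqL δ d hδ0 hs1 hmδ hd hρ3 (by rw [hn]; exact hsn)
  rw [hn] at hub
  have key := pi_ratio (fun v => (fib π v).powersetCard s) (fun τ => ∃ φ : V → C',
      (∀ v : V, φ v ∈ τ v) ∧ (∀ v : V, φ v ∈ fib π v) ∧ ∀ u w : V, ¬H.Adj (φ u) (φ w)) (1 / (n : ℝ)) ?_ _ ?_ hub
  · convert key
  · rw [Fintype.piFinset_nonempty]
    intro v
    exact Finset.powersetCard_nonempty.2 (hsq.trans (hqL v))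
  intro τ hτ1 hτ2
  refine Finset.mem_filter.2 ⟨hτ1, ?_⟩
  by_contra hcon
  push Not at hcon
  refine hτ2 ?_
  obtain ⟨T, hT1, hT2, hT3⟩ := good_T s m hm1 hms d τ (fun v => Fintype.mem_piFinset.1 hτ1 v) hcon
  have hℓ : ((s + 1 - m : ℕ) : ℝ) = s + 1 - m := by
    rw [Nat.cast_sub (by omega)]; push_cast; ring
  have hℓ1 : (1 - δ) * s ≤ ((s + 1 - m : ℕ) : ℝ) := by rw [hℓ]; linarith
  have hℓ0 : (0 : ℝ) < ((s + 1 - m : ℕ) : ℝ) := lt_of_lt_of_le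
    (mul_pos (by linarith only [hδ1]) (by linarith only [hs1'])) hℓ1
  have hd0 : 0 ≤ d := by rw [hd]; positivity
  have hqΔ : (q : ℝ) ≤ (Δ : ℝ) ^ 2 := by
    rw [hq, div_le_iff₀ hR0]
    have : 4 * K ≤ Δ := by rw [hK]; linarith
    nlinarith only [mul_le_mul_of_nonneg_right this hΔ0.le, mul_le_mul_of_nonneg_left hR1 (sq_nonneg (Δ : ℝ))]
  have hsq' : (s : ℝ) ≤ q := by exact_mod_cast hsq
  obtain ⟨φ, hφ1, hφ2, hφ3⟩ := hY Δ hx1 k (d / ((s + 1 - m : ℕ) : ℝ)) (s + 1 - m) hk1 hk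
    (by
      have a := mul_le_mul_of_nonneg_right (show 1 / 2 ≤ 1 - δ by linarith only [hδ1]) (show 0 ≤ (s : ℝ) by linarith only [hs1'])
      linarith only [a, hℓ1, hs, hsq0])
    (by rw [hℓ]; have : (1 : ℝ) ≤ m := by exact_mod_cast hm1
        linarith)
    (by positivity)
    (by
      rw [div_le_iff₀ hℓ0]
      have e : d = (1 + δ) * s * (R / (4 * K)) := by rw [← hρ, hd]; ring
      have hK1 : (1 + δ) ≤ K * ((1 - γ / 4) * (1 - δ)) := by
        have a1 : 0 ≤ (1 - γ / 4) * (1 - δ) := mul_nonneg (by linarith) (by linarith)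
        have a2 : (1 + γ) * ((1 - γ / 4) * (1 - δ)) ≤ K * ((1 - γ / 4) * (1 - δ)) :=
          mul_le_mul_of_nonneg_right (by rw [hK]; linarith) a1
        have a3 : (1 + γ / 2) ≤ (1 + γ) * (1 - γ / 4) := by nlinarith only [hγ0, hγ1]
        have a4 : (1 + γ / 2) * (1 - δ) ≤ (1 + γ) * (1 - γ / 4) * (1 - δ) :=
          mul_le_mul_of_nonneg_right a3 (by linarith)
        have a5 : 1 + δ ≤ (1 + γ / 2) * (1 - δ) := by rw [hδ]; nlinarith only [hγ0, hγ1]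
        linarith
      calc d = (1 + δ) * (s * (R / (4 * K))) := by rw [e]; ring
        _ ≤ K * ((1 - γ / 4) * (1 - δ)) * (s * (R / (4 * K))) :=
          mul_le_mul_of_nonneg_right hK1 (by positivity)
        _ = (1 - γ / 4) / 4 * R * ((1 - δ) * s) := by field_simp
        _ ≤ _ := by
          refine mul_le_mul_of_nonneg_left hℓ1 ?_
          have : 0 ≤ (1 - γ / 4) := by linarith
          positivity)
    π G H hc T hT2
    (by
      intro c hcT
      rw [div_mul_cancel₀ _ hℓ0.ne']
      exact hT3 c hcT)
  refine ⟨φ, ?_, ?_, hφ3⟩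
  · intro v
    have := hT1 _ (hφ2 v)
    rwa [hφ1 v] at this
  · intro v
    rw [mem_fib]; exact hφ1 v
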